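/- arXiv:2403.05737 — 3 statements merged into one kernel-verified Lean document; each statement's English description precedes it below -/
import Mathlib

section
/- Let F be a hereditary class of finite simple graphs that is degree-bounded by ω, i.e., there exists a function f : ℕ → ℕ such that every G ∈ F satisfies δ(G) ≤ f(ω(G)). Then there exists a polynomial p with natural-number coefficients such that every graph G ∈ F satisfies δ(G) ≤ p(ω(G)). -/
open SimpleGraph
open scoped Classical

noncomputable section

/-- Minimum degree of a finite simple graph. -/
def minDeg {V : Type} [Fintype V] (G : SimpleGraph V) : ℕ :=
  G.minDegree

/-- The clique number of a finite simple graph. -/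
def cliqNum {V : Type} [Fintype V] (G : SimpleGraph V) : ℕ :=
  sSup {n | ∃ s : Finset V, G.IsNClique n s}

/-- A class of finite simple graphs. -/
def GraphClass := ∀ (V : Type) [Fintype V], SimpleGraph V → Prop

/-- Hereditary: closed under isomorphism and nonempty induced subgraphs. -/
def Hereditary (F : GraphClass) : Prop :=
  (∀ (V W : Type) [Fintype V] [Fintype W] (G : SimpleGraph V) (H : SimpleGraph W),
      Nonempty (G ≃g H) → F V G → F W H) ∧
  (∀ (V : Type) [Fintype V] (G : SimpleGraph V) (s : Set V), s.Nonempty →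
      F V G → F s (G.induce s))

/-- Degree of `v` into the finite set `A`. -/
def dg {V : Type} (G : SimpleGraph V) (A : Finset V) (v : V) : ℕ :=
  (A.filter (fun u => G.Adj v u)).card

/-- Neighbours of `v` in `A` of larger rank. -/
def upN {V : Type} (G : SimpleGraph V) (A : Finset V) (r : V → ℕ) (v : V) : Finset V :=
  A.filter (fun u => G.Adj v u ∧ r v < r u)

/-- Ordered adjacent pairs within `B`. -/
def adjPairs {V : Type} (G : SimpleGraph V) (B : Finset V) : Finset (V × V) :=
  (B ×ˢ B).filter (fun p => G.Adj p.1 p.2)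

/-- A finite set spanning no triangle. -/
def TriFree {V : Type} (G : SimpleGraph V) (A : Finset V) : Prop :=
  ∀ x ∈ A, ∀ y ∈ A, ∀ z ∈ A, G.Adj x y → G.Adj y z → G.Adj x z → False

/-- Every nonempty subset has a vertex of degree at most `d`. -/
def Degen {V : Type} (G : SimpleGraph V) (A : Finset V) (d : ℕ) : Prop :=
  ∀ B ⊆ A, B.Nonempty → ∃ v ∈ B, dg G B v ≤ d

theorem card_adjPairs {V : Type} (G : SimpleGraph V) (B : Finset V) :
    (adjPairs G B).card = ∑ v ∈ B, dg G B v := by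
  unfold adjPairs dg
  rw [Finset.card_filter, Finset.sum_product]
  refine Finset.sum_congr rfl fun v _ => ?_
  rw [Finset.card_filter]

theorem ramsey_poly {V : Type} (G : SimpleGraph V) (w : ℕ)
    (hw : ∀ Q : Finset V, G.IsClique (Q : Set V) → Q.card ≤ w) (s : ℕ) :
    ∀ A : Finset V, (w + 1) ^ s ≤ A.card →
      ∃ I ⊆ A, I.card = s ∧ ∀ x ∈ I, ∀ y ∈ I, ¬ G.Adj x y := by
  induction s with
  | zero => intro A _; exact ⟨∅, by simp, by simp, by simp⟩
  | succ s ih =>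
    intro A hA
    -- a maximal clique in A
    obtain ⟨Q, hQ, hmax⟩ := Finset.exists_max_image
      (A.powerset.filter (fun Q : Finset V => G.IsClique (Q : Set V))) Finset.card
      ⟨∅, by simp⟩
    simp only [Finset.mem_filter, Finset.mem_powerset] at hQ hmax
    obtain ⟨hQA, hQc⟩ := hQ
    have hQw := hw Q hQc
    have hcov : A ⊆ Q.biUnion (fun q => insert q (A.filter (fun u => u ≠ q ∧ ¬ G.Adj q u))) := by
      intro a ha
      by_contra hcon
      simp only [Finset.mem_biUnion, Finset.mem_insert, Finset.mem_filter, not_exists, not_and,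
        not_or] at hcon
      have haQ : a ∉ Q := fun h => (hcon a h).1 rfl
      have hadj : ∀ q ∈ Q, G.Adj q a := by
        intro q hq
        have := hcon q hq
        by_contra h
        exact this.2 ha this.1 h
      have h1 := hmax (insert a Q) ⟨Finset.insert_subset ha hQA, by
        rw [Finset.coe_insert]
        refine hQc.insert ?_
        intro b hb _
        exact (hadj b hb).symm⟩
      rw [Finset.card_insert_of_notMem haQ] at h1
      omega
    have hex : ∃ q ∈ Q, (w + 1) ^ s ≤ (A.filter (fun u => u ≠ q ∧ ¬ G.Adj q u)).card := by
      by_contra hcon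
      push Not at hcon
      have h1 : A.card ≤ Q.card * (w + 1) ^ s := by
        refine (Finset.card_le_card hcov).trans (Finset.card_biUnion_le_card_mul _ _ _ ?_)
        intro q hq
        refine (Finset.card_insert_le _ _).trans ?_
        exact hcon q hq
      have h2 : Q.card * (w + 1) ^ s ≤ w * (w + 1) ^ s := Nat.mul_le_mul_right _ hQw
      have h3 : 0 < (w + 1) ^ s := by positivity
      rw [pow_succ] at hA
      nlinarith
    obtain ⟨q, hq, hcard⟩ := hex
    obtain ⟨I, hI, hIs, hind⟩ := ih _ hcard
    have hqI : q ∉ I := fun h => by simpa using hI h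
    refine ⟨insert q I, ?_, ?_, ?_⟩
    · exact Finset.insert_subset (hQA hq) (hI.trans (Finset.filter_subset _ _))
    · rw [Finset.card_insert_of_notMem hqI, hIs]
    · have hn : ∀ y ∈ I, ¬ G.Adj q y := fun y hy => (Finset.mem_filter.1 (hI hy)).2.2
      intro x hx y hy
      rcases Finset.mem_insert.1 hx with hx' | hx' <;>
        rcases Finset.mem_insert.1 hy with hy' | hy'
      · rw [hx', hy']; simp
      · rw [hx']; exact hn y hy'
      · rw [hy']; exact fun h => hn x hx' h.symm
      · exact hind x hx' y hy'

theorem no_biclique {V : Type} (G : SimpleGraph V) (k : ℕ)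
    (h1 : ∀ A : Finset V, A.Nonempty → TriFree G A → ∃ v ∈ A, dg G A v ≤ k)
    (I J : Finset V) (hI : I.card = k + 1) (hJ : J.card = k + 1)
    (hIi : ∀ x ∈ I, ∀ y ∈ I, ¬ G.Adj x y) (hJi : ∀ x ∈ J, ∀ y ∈ J, ¬ G.Adj x y)
    (hIJ : ∀ x ∈ I, ∀ y ∈ J, G.Adj x y) : False := by
  have hne : (I ∪ J).Nonempty := by
    have : I.Nonempty := Finset.card_pos.1 (by omega)
    exact this.mono Finset.subset_union_left
  obtain ⟨v, hv, hd⟩ := h1 (I ∪ J) hne (by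
    intro x hx y hy z hz hxy hyz hxz
    rcases Finset.mem_union.1 hx with hx | hx <;> rcases Finset.mem_union.1 hy with hy | hy <;>
      rcases Finset.mem_union.1 hz with hz | hz <;>
      first
        | exact hIi _ hx _ hy hxy
        | exact hIi _ hx _ hz hxz
        | exact hIi _ hy _ hz hyz
        | exact hJi _ hx _ hy hxy
        | exact hJi _ hx _ hz hxz
        | exact hJi _ hy _ hz hyz)
  unfold dg at hd
  rcases Finset.mem_union.1 hv with hv | hv
  · have : J ⊆ (I ∪ J).filter (fun u => G.Adj v u) := fun y hy =>
      Finset.mem_filter.2 ⟨Finset.mem_union_right _ hy, hIJ v hv y hy⟩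
    have := Finset.card_le_card this
    omega
  · have : I ⊆ (I ∪ J).filter (fun u => G.Adj v u) := fun y hy =>
      Finset.mem_filter.2 ⟨Finset.mem_union_left _ hy, (hIJ y hy v hv).symm⟩
    have := Finset.card_le_card this
    omega

/-- Few vertices see many vertices of a small block. -/
theorem few_rich {V : Type} (G : SimpleGraph V) (k w : ℕ)
    (hw : ∀ Q : Finset V, G.IsClique (Q : Set V) → Q.card ≤ w)
    (h1 : ∀ A : Finset V, A.Nonempty → TriFree G A → ∃ v ∈ A, dg G A v ≤ k)
    (A B : Finset V) (b : ℕ) (hB : B.card ≤ b) :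
    (A.filter (fun v => (w + 1) ^ (k + 1) ≤ dg G B v)).card ≤
      (w + 1) ^ (k + 1) * b ^ (k + 1) := by
  by_contra hcon
  push Not at hcon
  set X := A.filter (fun v => (w + 1) ^ (k + 1) ≤ dg G B v) with hX
  have hS : ∀ v, ∃ I : Finset V, v ∈ X → (I ⊆ B.filter (fun u => G.Adj v u) ∧ I.card = k + 1 ∧
      ∀ x ∈ I, ∀ y ∈ I, ¬ G.Adj x y) := by
    intro v
    by_cases hv : v ∈ X
    · obtain ⟨I, hI⟩ := ramsey_poly G w hw (k + 1) _ (Finset.mem_filter.1 hv).2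
      exact ⟨I, fun _ => hI⟩
    · exact ⟨∅, fun h => absurd h hv⟩
  choose S hS using hS
  have hmap : ∀ v ∈ X, S v ∈ B.powersetCard (k + 1) := by
    intro v hv
    rw [Finset.mem_powersetCard]
    exact ⟨(hS v hv).1.trans (Finset.filter_subset _ _), (hS v hv).2.1⟩
  have hcard : (B.powersetCard (k + 1)).card ≤ b ^ (k + 1) := by
    rw [Finset.card_powersetCard]
    exact (Nat.choose_le_pow _ _).trans (Nat.pow_le_pow_left hB _)
  obtain ⟨I, hI, hfib⟩ := Finset.exists_lt_card_fiber_of_mul_lt_card_of_maps_to hmap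
    (n := (w + 1) ^ (k + 1))
    (lt_of_le_of_lt (by rw [mul_comm]; exact Nat.mul_le_mul_left _ hcard) hcon)
  obtain ⟨J, hJ, hJc, hJi⟩ := ramsey_poly G w hw (k + 1) _ hfib.le
  have hJm : ∀ y ∈ J, y ∈ X ∧ S y = I := fun y hy => Finset.mem_filter.1 (hJ hy)
  have hJne : J.Nonempty := Finset.card_pos.1 (by omega)
  obtain ⟨y0, hy0⟩ := hJne
  have h0 := hS y0 (hJm y0 hy0).1
  rw [(hJm y0 hy0).2] at h0
  refine no_biclique G k h1 J I hJc h0.2.1 hJi h0.2.2 ?_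
  intro x hx y hy
  have h2 := hS x (hJm x hx).1
  rw [(hJm x hx).2] at h2
  exact (Finset.mem_filter.1 (h2.1 hy)).2

theorem exists_blocks {V : Type} (A : Finset V) (b : ℕ) (hb : 0 < b) :
    ∃ g : V → ℕ, (∀ v ∈ A, g v < A.card / b + 1) ∧
      ∀ j, (A.filter (fun v => g v = j)).card ≤ b := by
  let e := A.equivFin
  refine ⟨fun v => if h : v ∈ A then (e ⟨v, h⟩ : ℕ) / b else 0, ?_, ?_⟩
  · intro v hv
    simp only [hv, dif_pos]
    exact Nat.lt_succ_of_le (Nat.div_le_div_right (e ⟨v, hv⟩).2.le)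
  · intro j
    have : (Finset.Ico (j * b) (j * b + b)).card = b := by simp
    refine le_trans ?_ this.le
    refine Finset.card_le_card_of_injOn (fun v => if h : v ∈ A then (e ⟨v, h⟩ : ℕ) else 0) ?_ ?_
    · intro v hv
      have hv := Finset.mem_filter.1 (Finset.mem_coe.1 hv)
      obtain ⟨hvA, hvj⟩ := hv
      simp only [hvA, dif_pos] at hvj
      simp only [hvA, dif_pos, Finset.coe_Ico, Set.mem_Ico]
      have h1 := Nat.div_add_mod (e ⟨v, hvA⟩ : ℕ) b
      have h2 := Nat.mod_lt (e ⟨v, hvA⟩ : ℕ) hb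
      rw [hvj, mul_comm] at h1
      change j * b ≤ (e ⟨v, hvA⟩ : ℕ) ∧ (e ⟨v, hvA⟩ : ℕ) < j * b + b
      omega
    · intro u hu v hv huv
      have hu := (Finset.mem_filter.1 (Finset.mem_coe.1 hu)).1
      have hv := (Finset.mem_filter.1 (Finset.mem_coe.1 hv)).1
      simp only [hu, hv, dif_pos] at huv
      have := e.injective (Fin.ext huv)
      simpa using this

theorem sparse {V : Type} (G : SimpleGraph V) (k w : ℕ)
    (hw : ∀ Q : Finset V, G.IsClique (Q : Set V) → Q.card ≤ w)
    (h1 : ∀ A : Finset V, A.Nonempty → TriFree G A → ∃ v ∈ A, dg G A v ≤ k)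
    (A : Finset V) (L d R b M : ℕ) (hL : 0 < L) (hR : R = (w + 1) ^ (k + 1))
    (hb : b = 4 * R * L) (hM : M = R * b ^ (k + 1)) (hA : A.card ≤ d)
    (hd1 : 4 * L * M ≤ d) (hd2 : b ≤ d) :
    L * (adjPairs G A).card ≤ d ^ 2 := by
  have hRpos : 0 < R := by rw [hR]; positivity
  have hbpos : 0 < b := by rw [hb]; positivity
  obtain ⟨g, hg, hgb⟩ := exists_blocks A b hbpos
  set l := A.card / b + 1 with hl
  have hlb : l * b ≤ 2 * d := by
    have : A.card / b * b ≤ A.card := Nat.div_mul_le_self _ _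
    rw [hl]; nlinarith
  let B : ℕ → Finset V := fun j => A.filter (fun v => g v = j)
  have hdeg : ∀ v, dg G A v = ∑ j ∈ Finset.range l, dg G (B j) v := by
    intro v
    unfold dg
    rw [Finset.card_eq_sum_card_fiberwise (f := g) (t := Finset.range l)]
    · refine Finset.sum_congr rfl fun j _ => ?_
      congr 1
      ext u
      simp only [B, Finset.mem_filter]
      tauto
    · intro u hu
      have := (Finset.mem_filter.1 (Finset.mem_coe.1 hu)).1
      simpa using hg u this
  have hblock : ∀ j ∈ Finset.range l, ∑ v ∈ A, dg G (B j) v ≤ M * b + d * R := by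
    intro j _
    have hBj : (B j).card ≤ b := hgb j
    have hpt : ∀ v ∈ A, dg G (B j) v ≤ (if R ≤ dg G (B j) v then b else 0) + R := by
      intro v _
      split_ifs with h
      · have : dg G (B j) v ≤ b := (Finset.card_filter_le _ _).trans hBj
        omega
      · omega
    refine (Finset.sum_le_sum hpt).trans ?_
    rw [Finset.sum_add_distrib, ← Finset.sum_filter, Finset.sum_const, Finset.sum_const]
    have := few_rich G k w hw h1 A (B j) b hBj
    rw [← hR, ← hM] at this
    simp only [smul_eq_mul]
    exact Nat.add_le_add (Nat.mul_le_mul_right _ this) (Nat.mul_le_mul_right _ hA)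
  have htot : (adjPairs G A).card ≤ l * (M * b + d * R) := by
    rw [card_adjPairs]
    simp_rw [hdeg]
    rw [Finset.sum_comm]
    refine (Finset.sum_le_sum hblock).trans ?_
    simp
  have e1 : 2 * (L * (l * (M * b))) ≤ d ^ 2 := by
    calc 2 * (L * (l * (M * b))) = 2 * L * M * (l * b) := by ring
      _ ≤ 2 * L * M * (2 * d) := Nat.mul_le_mul_left _ hlb
      _ = (4 * L * M) * d := by ring
      _ ≤ d * d := Nat.mul_le_mul_right _ hd1
      _ = d ^ 2 := by ring
  have e2 : 2 * (L * (l * (d * R))) * 2 ≤ d ^ 2 * 2 := by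
    calc 2 * (L * (l * (d * R))) * 2 = l * (4 * R * L) * d := by ring
      _ = l * b * d := by rw [← hb]
      _ ≤ 2 * d * d := Nat.mul_le_mul_right _ hlb
      _ = d ^ 2 * 2 := by ring
  have e3 : L * (adjPairs G A).card ≤ L * (l * (M * b)) + L * (l * (d * R)) := by
    refine (Nat.mul_le_mul_left L htot).trans (le_of_eq (by ring))
  omega

theorem exists_rank {V : Type} (G : SimpleGraph V) (d : ℕ) (A : Finset V) :
    Degen G A d → ∃ r : V → ℕ, Set.InjOn r (A : Set V) ∧
      ∀ v ∈ A, (upN G A r v).card ≤ d := by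
  induction A using Finset.strongInduction with
  | H A ih =>
    intro hA
    rcases A.eq_empty_or_nonempty with rfl | hne
    · exact ⟨fun _ => 0, by simp, by simp⟩
    obtain ⟨v, hv, hvd⟩ := hA A subset_rfl hne
    obtain ⟨r, hr, hrd⟩ := ih (A.erase v) (Finset.erase_ssubset hv)
      (fun B hB => hA B (hB.trans (Finset.erase_subset _ _)))
    refine ⟨fun x => if x = v then 0 else r x + 1, ?_, ?_⟩
    · intro x hx y hy hxy
      by_cases h : x = v <;> by_cases h' : y = v <;> simp [h, h'] at hxy ⊢
      exact hr (by simp [h]; exact hx) (by simp [h']; exact hy) hxy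
    · intro x hx
      by_cases h : x = v
      · subst h
        refine le_trans (Finset.card_le_card ?_) hvd
        intro u hu
        simp only [upN, Finset.mem_filter] at hu ⊢
        exact ⟨hu.1, hu.2.1⟩
      · refine le_trans (Finset.card_le_card ?_) (hrd x (by simp [h, hx]))
        intro u hu
        simp only [upN, Finset.mem_filter, Finset.mem_erase, h, if_false] at hu ⊢
        by_cases h' : u = v
        · simp [h'] at hu
        · simp only [h', if_false] at hu
          exact ⟨⟨h', hu.1⟩, hu.2.1, by omega⟩

theorem sum_dg {V : Type} (G : SimpleGraph V) (A : Finset V) (r : V → ℕ)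
    (hr : Set.InjOn r (A : Set V)) :
    ∑ v ∈ A, dg G A v = 2 * ∑ v ∈ A, (upN G A r v).card := by
  have h1 : ∀ v ∈ A, dg G A v =
      (upN G A r v).card + (A.filter (fun u => G.Adj u v ∧ r u < r v)).card := by
    intro v hv
    unfold dg upN
    rw [← Finset.card_union_of_disjoint]
    · congr 1
      ext u
      simp only [Finset.mem_filter, Finset.mem_union]
      constructor
      · rintro ⟨hu, ha⟩
        have hne : r v ≠ r u := fun h => ha.ne (hr hv hu h)
        rcases lt_or_gt_of_ne hne with h | h
        · exact Or.inl ⟨hu, ha, h⟩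
        · exact Or.inr ⟨hu, ha.symm, h⟩
      · rintro (⟨hu, ha, _⟩ | ⟨hu, ha, _⟩)
        · exact ⟨hu, ha⟩
        · exact ⟨hu, ha.symm⟩
    · rw [Finset.disjoint_left]
      intro u hu hu'
      simp only [Finset.mem_filter] at hu hu'
      omega
  rw [Finset.sum_congr rfl h1, Finset.sum_add_distrib, two_mul]
  congr 1
  exact (Finset.sum_card_bipartiteAbove_eq_sum_card_bipartiteBelow
    (s := A) (t := A) (fun u v => G.Adj u v ∧ r u < r v)).symm

theorem degen_edges {V : Type} (G : SimpleGraph V) (k : ℕ) (A : Finset V) (r : V → ℕ)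
    (hr : Set.InjOn r (A : Set V)) (hA : Degen G A k) :
    ∑ v ∈ A, (upN G A r v).card ≤ k * A.card := by
  obtain ⟨r', hr', hk⟩ := exists_rank G k A hA
  have h1 := sum_dg G A r hr
  have h2 := sum_dg G A r' hr'
  have h3 : ∑ v ∈ A, (upN G A r' v).card ≤ k * A.card := by
    refine (Finset.sum_le_sum hk).trans ?_
    simp [mul_comm]
  omega

/-- Zero-one indicator of a proposition. -/
def ind (P : Prop) : ℕ := if P then 1 else 0

theorem sum_ind {V : Type} (A : Finset V) (P : V → Prop) :
    ∑ y ∈ A, ind (P y) = (A.filter P).card := by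
  unfold ind
  rw [Finset.card_filter]

/-- Number of colourings satisfying `P`. -/
def cnt {V : Type} [Fintype V] (m : ℕ) (P : (V → Fin m) → Prop) : ℕ :=
  ∑ c : V → Fin m, ind (P c)

theorem cnt_eq {V : Type} [Fintype V] (m : ℕ) (P : (V → Fin m) → Prop) :
    cnt m P = (Finset.univ.filter P).card := by
  unfold cnt ind
  rw [Finset.card_filter]

theorem count_step {V : Type} [Fintype V] (m : ℕ) (P : (V → Fin m) → Prop) (x y : V)
    (hxy : x ≠ y) (hP : ∀ c a, P c → P (Function.update c y a)) :
    m * cnt m (fun c => P c ∧ c y = c x) = cnt m P := by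
  rw [cnt_eq, cnt_eq]
  have h0 : ∀ q : ℕ, m * q = (Finset.univ : Finset (Fin m)).card * q := by simp
  rw [h0, ← Finset.card_product]
  refine Finset.card_bij' (fun p _ => Function.update p.2 y p.1)
    (fun c _ => (c y, Function.update c y (c x))) ?_ ?_ ?_ ?_
  · rintro ⟨a, c⟩ h
    simp only [Finset.mem_product, Finset.mem_filter, Finset.mem_univ, true_and] at h ⊢
    exact hP _ _ h.1
  · intro c h
    simp only [Finset.mem_product, Finset.mem_filter, Finset.mem_univ, true_and] at h ⊢
    exact ⟨hP _ _ h, by simp [Function.update_of_ne hxy]⟩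
  · rintro ⟨a, c⟩ h
    simp only [Finset.mem_product, Finset.mem_filter, Finset.mem_univ, true_and] at h
    simp [Function.update_of_ne hxy, ← h.2]
  · intro c h
    simp

theorem count2 {V : Type} [Fintype V] (m : ℕ) (x y : V) (hxy : x ≠ y) :
    m * cnt m (fun c : V → Fin m => c y = c x) = m ^ Fintype.card V := by
  have := count_step m (fun _ => True) x y hxy (by simp)
  simp only [true_and] at this
  rw [this]
  simp [cnt, ind]

theorem count3 {V : Type} [Fintype V] (m : ℕ) (x y z : V) (hxy : x ≠ y) (hxz : x ≠ z)
    (hyz : y ≠ z) :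
    m ^ 2 * cnt m (fun c : V → Fin m => c y = c x ∧ c z = c x) = m ^ Fintype.card V := by
  have := count_step m (fun c => c y = c x) x z hxz (by
    intro c a h; simpa [Function.update_of_ne hxz, Function.update_of_ne hyz] using h)
  rw [pow_two, mul_assoc, this, count2 m x y hxy]

theorem count4 {V : Type} [Fintype V] (m : ℕ) (x y z t : V) (hxy : x ≠ y) (hxz : x ≠ z)
    (hyz : y ≠ z) (hxt : x ≠ t) (hyt : y ≠ t) (hzt : z ≠ t) :
    m ^ 3 * cnt m (fun c : V → Fin m => (c y = c x ∧ c z = c x) ∧ c t = c x)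
      = m ^ Fintype.card V := by
  have := count_step m (fun c => c y = c x ∧ c z = c x) x t hxt (by
    intro c a h
    simpa [Function.update_of_ne hxt, Function.update_of_ne hyt, Function.update_of_ne hzt] using h)
  rw [pow_succ, mul_assoc, this, count3 m x y z hxy hxz hyz]

theorem per_color {V : Type} [Fintype V] (G : SimpleGraph V) (k m : ℕ) (A : Finset V)
    (r : V → ℕ) (hr : Set.InjOn r (A : Set V))
    (h1 : ∀ A : Finset V, A.Nonempty → TriFree G A → ∃ v ∈ A, dg G A v ≤ k)
    (c : V → Fin m) :
    ∑ x ∈ A, ∑ y ∈ upN G A r x, ind (c y = c x) ≤ k * A.card +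
      ∑ x ∈ A, ∑ y ∈ upN G A r x,
        (∑ p ∈ adjPairs G (upN G A r x), ind ((c y = c x ∧ c p.1 = c x) ∧ c p.2 = c x) +
         ∑ p ∈ adjPairs G (upN G A r y), ind ((c y = c x ∧ c p.1 = c x) ∧ c p.2 = c x)) := by
  let bad : V → Prop := fun z => ∃ p ∈ adjPairs G (upN G A r z), c p.1 = c z ∧ c p.2 = c z
  have hpt : ∀ x ∈ A, ∀ y ∈ upN G A r x, ind (c y = c x) ≤
      ind (c y = c x ∧ ¬ bad x ∧ ¬ bad y) +
        (∑ p ∈ adjPairs G (upN G A r x), ind ((c y = c x ∧ c p.1 = c x) ∧ c p.2 = c x) +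
         ∑ p ∈ adjPairs G (upN G A r y), ind ((c y = c x ∧ c p.1 = c x) ∧ c p.2 = c x)) := by
    intro x _ y _
    by_cases hc : c y = c x
    · by_cases hbx : bad x
      · obtain ⟨p, hp, hp1, hp2⟩ := hbx
        have h2 : ind ((c y = c x ∧ c p.1 = c x) ∧ c p.2 = c x) ≤ _ :=
          Finset.single_le_sum
          (f := fun p : V × V => ind ((c y = c x ∧ c p.1 = c x) ∧ c p.2 = c x))
          (fun _ _ => Nat.zero_le _) hp
        have h3 : ind ((c y = c x ∧ c p.1 = c x) ∧ c p.2 = c x) = 1 := by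
          simp [ind, hc, hp1, hp2]
        have h4 : ind (c y = c x) ≤ 1 := by unfold ind; split_ifs <;> omega
        omega
      · by_cases hby : bad y
        · obtain ⟨p, hp, hp1, hp2⟩ := hby
          have h2 : ind ((c y = c x ∧ c p.1 = c x) ∧ c p.2 = c x) ≤ _ :=
            Finset.single_le_sum
            (f := fun p : V × V => ind ((c y = c x ∧ c p.1 = c x) ∧ c p.2 = c x))
            (fun _ _ => Nat.zero_le _) hp
          have h3 : ind ((c y = c x ∧ c p.1 = c x) ∧ c p.2 = c x) = 1 := by
            simp [ind, hc, hp1, hp2]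
          have h4 : ind (c y = c x) ≤ 1 := by unfold ind; split_ifs <;> omega
          omega
        · have h3 : ind (c y = c x ∧ ¬ bad x ∧ ¬ bad y) = 1 := by
            simp [ind, hc, hbx, hby]
          have h4 : ind (c y = c x) ≤ 1 := by unfold ind; split_ifs <;> omega
          omega
    · simp [ind, hc]
  refine (Finset.sum_le_sum fun x hx => Finset.sum_le_sum (hpt x hx)).trans ?_
  simp_rw [Finset.sum_add_distrib]
  refine Nat.add_le_add_right ?_ _
  -- good edges
  let S : Fin m → Finset V := fun i => (A.filter (fun x => c x = i)).filter (fun x => ¬ bad x)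
  have hSA : ∀ i, S i ⊆ A := fun i =>
    (Finset.filter_subset _ _).trans (Finset.filter_subset _ _)
  have hSt : ∀ i, TriFree G (S i) := by
    -- key: a bad vertex is the lowest of a monochromatic triangle
    have key : ∀ i, ∀ x ∈ S i, ∀ y ∈ S i, ∀ z ∈ S i, G.Adj x y → G.Adj y z → G.Adj x z →
        r x < r y → r x < r z → False := by
      intro i x hx y hy z hz hxy hyz hxz h2 h3
      simp only [S, Finset.mem_filter] at hx hy hz
      refine hx.2 ⟨(y, z), ?_, ?_, ?_⟩
      · simp only [adjPairs, upN, Finset.mem_filter, Finset.mem_product]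
        exact ⟨⟨⟨hy.1.1, hxy, h2⟩, hz.1.1, hxz, h3⟩, hyz⟩
      · rw [hx.1.2]; exact hy.1.2
      · rw [hx.1.2]; exact hz.1.2
    intro i x hx y hy z hz hxy hyz hxz
    have n1 : r x ≠ r y := fun h => hxy.ne (hr (hSA i hx) (hSA i hy) h)
    have n2 : r y ≠ r z := fun h => hyz.ne (hr (hSA i hy) (hSA i hz) h)
    have n3 : r x ≠ r z := fun h => hxz.ne (hr (hSA i hx) (hSA i hz) h)
    by_cases a1 : r x < r y
    · by_cases a2 : r x < r z
      · exact key i x hx y hy z hz hxy hyz hxz a1 a2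
      · exact key i z hz x hx y hy hxz.symm hxy hyz.symm (by omega) (by omega)
    · by_cases a2 : r y < r z
      · exact key i y hy x hx z hz hxy.symm hxz hyz (by omega) a2
      · exact key i z hz x hx y hy hxz.symm hxy hyz.symm (by omega) (by omega)
  have hSe : ∀ i, ∑ v ∈ S i, (upN G (S i) r v).card ≤ k * (S i).card := by
    intro i
    refine degen_edges G k (S i) r (hr.mono (hSA i)) ?_
    intro B hB hne
    exact h1 B hne (fun x hx y hy z hz => hSt i x (hB hx) y (hB hy) z (hB hz))
  rw [← Finset.sum_fiberwise A c]
  have hi : ∀ i, ∑ x ∈ A.filter (fun x => c x = i), ∑ y ∈ upN G A r x,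
      ind (c y = c x ∧ ¬ bad x ∧ ¬ bad y) ≤ k * (A.filter (fun x => c x = i)).card := by
    intro i
    have e1 : ∑ x ∈ A.filter (fun x => c x = i), ∑ y ∈ upN G A r x,
        ind (c y = c x ∧ ¬ bad x ∧ ¬ bad y) = ∑ x ∈ S i, ∑ y ∈ upN G A r x,
        ind (c y = c x ∧ ¬ bad x ∧ ¬ bad y) := by
      refine (Finset.sum_filter_of_ne ?_).symm
      intro x _ hne hb
      apply hne
      simp [ind, hb]
    rw [e1]
    refine le_trans ?_ ((hSe i).trans (Nat.mul_le_mul_left _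
      (Finset.card_le_card (Finset.filter_subset _ _))))
    refine Finset.sum_le_sum fun x hx => ?_
    rw [sum_ind]
    refine Finset.card_le_card ?_
    intro y hy
    simp only [S, upN, Finset.mem_filter] at hx hy ⊢
    exact ⟨⟨⟨hy.1.1, hy.2.1.trans hx.1.2⟩, hy.2.2.2⟩, hy.1.2⟩
  refine (Finset.sum_le_sum fun i _ => hi i).trans ?_
  rw [← Finset.mul_sum, ← Finset.card_eq_sum_card_fiberwise (fun x _ => Finset.mem_coe.2 (Finset.mem_univ _))]

theorem averaged {V : Type} [Fintype V] (G : SimpleGraph V) (k m d e T : ℕ) (A : Finset V)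
    (hT : T = m ^ Fintype.card V)
    (r : V → ℕ) (hr : Set.InjOn r (A : Set V))
    (h1 : ∀ A : Finset V, A.Nonempty → TriFree G A → ∃ v ∈ A, dg G A v ≤ k)
    (hd : ∀ x ∈ A, (upN G A r x).card ≤ d)
    (he : ∀ x ∈ A, (adjPairs G (upN G A r x)).card ≤ e) :
    m ^ 2 * T * ∑ x ∈ A, (upN G A r x).card ≤
      m ^ 3 * (T * (k * A.card)) + A.card * (d * e * T + 2 * (e * (m * T)) + d * e * T) := by
  have hsum := Finset.sum_le_sum
    (fun (c : V → Fin m) (_ : c ∈ Finset.univ) => per_color G k m A r hr h1 c)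
  rw [Finset.sum_add_distrib] at hsum
  have eL : ∑ c : V → Fin m, ∑ x ∈ A, ∑ y ∈ upN G A r x, ind (c y = c x) =
      ∑ x ∈ A, ∑ y ∈ upN G A r x, cnt m (fun c => c y = c x) := by
    rw [Finset.sum_comm]
    refine Finset.sum_congr rfl fun x _ => ?_
    rw [Finset.sum_comm]
    rfl
  have eR : ∑ c : V → Fin m, ∑ x ∈ A, ∑ y ∈ upN G A r x,
        (∑ p ∈ adjPairs G (upN G A r x), ind ((c y = c x ∧ c p.1 = c x) ∧ c p.2 = c x) +
         ∑ p ∈ adjPairs G (upN G A r y), ind ((c y = c x ∧ c p.1 = c x) ∧ c p.2 = c x)) =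
      ∑ x ∈ A, ∑ y ∈ upN G A r x,
        (∑ p ∈ adjPairs G (upN G A r x),
            cnt m (fun c => (c y = c x ∧ c p.1 = c x) ∧ c p.2 = c x) +
         ∑ p ∈ adjPairs G (upN G A r y),
            cnt m (fun c => (c y = c x ∧ c p.1 = c x) ∧ c p.2 = c x)) := by
    rw [Finset.sum_comm]
    refine Finset.sum_congr rfl fun x _ => ?_
    rw [Finset.sum_comm]
    refine Finset.sum_congr rfl fun y _ => ?_
    rw [Finset.sum_add_distrib, Finset.sum_comm]
    congr 1
    rw [Finset.sum_comm]
    rfl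
  rw [eL, eR] at hsum
  have eC : ∑ c : V → Fin m, k * A.card = T * (k * A.card) := by
    rw [hT]; simp
  rw [eC] at hsum
  have hup : ∀ x y, y ∈ upN G A r x → y ∈ A ∧ G.Adj x y ∧ r x < r y := by
    intro x y hy
    simpa [upN] using hy
  have hpair : ∀ (B : Finset V) (p : V × V), p ∈ adjPairs G B →
      p.1 ∈ B ∧ p.2 ∈ B ∧ p.1 ≠ p.2 := by
    intro B p hp
    simp only [adjPairs, Finset.mem_filter, Finset.mem_product] at hp
    exact ⟨hp.1.1, hp.1.2, hp.2.ne⟩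
  have hlt : ∀ {x y : V}, r x < r y → x ≠ y := by
    rintro x y h rfl; omega
  have eL2 : m ^ 3 * ∑ x ∈ A, ∑ y ∈ upN G A r x, cnt m (fun c => c y = c x) =
      m ^ 2 * T * ∑ x ∈ A, (upN G A r x).card := by
    rw [Finset.mul_sum, Finset.mul_sum]
    refine Finset.sum_congr rfl fun x hx => ?_
    rw [Finset.mul_sum]
    rw [Finset.sum_congr rfl (g := fun _ => m ^ 2 * T)]
    · simp [mul_comm]
    · intro y hy
      rw [hT, ← count2 m x y (hlt (hup x y hy).2.2)]
      ring
  have b1 : ∀ x ∈ A, ∀ y ∈ upN G A r x, ∀ p ∈ adjPairs G (upN G A r x),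
      m ^ 3 * cnt m (fun c => (c y = c x ∧ c p.1 = c x) ∧ c p.2 = c x) ≤
        T + ((if y = p.1 then m * T else 0) + (if y = p.2 then m * T else 0)) := by
    intro x hx y hy p hp
    obtain ⟨q1, q2, q3⟩ := hpair _ _ hp
    have x1 := hlt (hup x _ q1).2.2
    have x2 := hlt (hup x _ q2).2.2
    have xy := hlt (hup x _ hy).2.2
    have c3 : m ^ 3 * cnt m (fun c : V → Fin m => c p.1 = c x ∧ c p.2 = c x) = m * T := by
      rw [hT, ← count3 m x p.1 p.2 x1 x2 q3]; ring
    by_cases g1 : y = p.1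
    · subst g1
      simp only [and_self]
      rw [c3]
      simp only [if_true]
      omega
    · by_cases g2 : y = p.2
      · subst g2
        have : cnt m (fun c : V → Fin m => (c p.2 = c x ∧ c p.1 = c x) ∧ c p.2 = c x) =
            cnt m (fun c : V → Fin m => c p.1 = c x ∧ c p.2 = c x) := by
          congr 1
          funext c
          apply propext
          tauto
        rw [this, c3]
        simp only [if_true]
        omega
      · rw [count4 m x y p.1 p.2 xy x1 g1 x2 g2 q3, hT]
        exact Nat.le_add_right _ _
  have b2 : ∀ x ∈ A, ∀ y ∈ upN G A r x, ∀ p ∈ adjPairs G (upN G A r y),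
      m ^ 3 * cnt m (fun c => (c y = c x ∧ c p.1 = c x) ∧ c p.2 = c x) ≤ T := by
    intro x hx y hy p hp
    obtain ⟨q1, q2, q3⟩ := hpair _ _ hp
    have xy := (hup x _ hy).2.2
    have y1 := (hup y _ q1).2.2
    have y2 := (hup y _ q2).2.2
    rw [count4 m x y p.1 p.2 (hlt xy) (hlt (xy.trans y1)) (hlt y1) (hlt (xy.trans y2)) (hlt y2) q3,
      hT]
  have eR2 : m ^ 3 * (∑ x ∈ A, ∑ y ∈ upN G A r x,
        (∑ p ∈ adjPairs G (upN G A r x),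
            cnt m (fun c => (c y = c x ∧ c p.1 = c x) ∧ c p.2 = c x) +
         ∑ p ∈ adjPairs G (upN G A r y),
            cnt m (fun c => (c y = c x ∧ c p.1 = c x) ∧ c p.2 = c x))) ≤
      A.card * (d * e * T + 2 * (e * (m * T)) + d * e * T) := by
    rw [Finset.mul_sum, ← smul_eq_mul A.card]
    refine Finset.sum_le_card_nsmul _ _ _ fun x hx => ?_
    rw [Finset.sum_add_distrib, mul_add]
    refine Nat.add_le_add ?_ ?_
    · rw [Finset.mul_sum]
      have s1 : ∀ y ∈ upN G A r x, m ^ 3 * ∑ p ∈ adjPairs G (upN G A r x),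
            cnt m (fun c => (c y = c x ∧ c p.1 = c x) ∧ c p.2 = c x) ≤
          ∑ p ∈ adjPairs G (upN G A r x),
            (T + ((if y = p.1 then m * T else 0) + (if y = p.2 then m * T else 0))) := by
        intro y hy
        rw [Finset.mul_sum]
        exact Finset.sum_le_sum (b1 x hx y hy)
      refine (Finset.sum_le_sum s1).trans ?_
      rw [Finset.sum_comm]
      have s2 : ∀ p ∈ adjPairs G (upN G A r x), ∑ y ∈ upN G A r x,
            (T + ((if y = p.1 then m * T else 0) + (if y = p.2 then m * T else 0))) ≤
            d * T + 2 * (m * T) := by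
        intro p hp
        obtain ⟨q1, q2, q3⟩ := hpair _ _ hp
        rw [Finset.sum_add_distrib, Finset.sum_add_distrib, Finset.sum_ite_eq', 
          Finset.sum_ite_eq', if_pos q1, if_pos q2, Finset.sum_const, smul_eq_mul]
        have := Nat.mul_le_mul_right T (hd x hx)
        omega
      refine (Finset.sum_le_card_nsmul _ _ _ s2).trans ?_
      rw [smul_eq_mul]
      refine (Nat.mul_le_mul_right _ (he x hx)).trans (le_of_eq (by ring))
    · rw [Finset.mul_sum]
      have s1 : ∀ y ∈ upN G A r x, m ^ 3 * ∑ p ∈ adjPairs G (upN G A r y),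
            cnt m (fun c => (c y = c x ∧ c p.1 = c x) ∧ c p.2 = c x) ≤ e * T := by
        intro y hy
        rw [Finset.mul_sum]
        refine (Finset.sum_le_card_nsmul _ _ _ (b2 x hx y hy)).trans ?_
        rw [smul_eq_mul]
        exact Nat.mul_le_mul_right _ (he y (hup x y hy).1)
      refine (Finset.sum_le_card_nsmul _ _ _ s1).trans ?_
      rw [smul_eq_mul, mul_assoc]
      exact Nat.mul_le_mul_right _ (hd x hx)
  have := Nat.mul_le_mul_left (m ^ 3) hsum
  rw [eL2, mul_add] at this
  exact this.trans (Nat.add_le_add_left eR2 _)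

/-- The explicit bound, as a function of the clique number. -/
def bnd (k w : ℕ) : ℕ :=
  4 * (48 * (2 * k + 1) ^ 3 + 1) * ((w + 1) ^ (k + 1) *
    (4 * (w + 1) ^ (k + 1) * (48 * (2 * k + 1) ^ 3 + 1)) ^ (k + 1)) +
  4 * (w + 1) ^ (k + 1) * (48 * (2 * k + 1) ^ 3 + 1) + (2 * k + 1)

theorem main_bound {V : Type} [Fintype V] (G : SimpleGraph V) (k w : ℕ)
    (hw : ∀ Q : Finset V, G.IsClique (Q : Set V) → Q.card ≤ w)
    (h1 : ∀ A : Finset V, A.Nonempty → TriFree G A → ∃ v ∈ A, dg G A v ≤ k) :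
    Degen G Finset.univ (bnd k w) := by
  have hex : ∃ d, Degen G Finset.univ d := by
    refine ⟨Fintype.card V, fun B _ hB => ?_⟩
    obtain ⟨v, hv⟩ := hB
    exact ⟨v, hv, Finset.card_le_univ _⟩
  set d := Nat.find hex with hd
  have hdeg : Degen G Finset.univ d := Nat.find_spec hex
  by_cases hle : d ≤ bnd k w
  · intro B hB hne
    obtain ⟨v, hv, h⟩ := hdeg B hB hne
    exact ⟨v, hv, h.trans hle⟩
  exfalso
  push Not at hle
  have hdpos : 0 < d := by omega
  have hnot : ¬ Degen G Finset.univ (d - 1) := Nat.find_min hex (by omega)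
  unfold Degen at hnot
  push Not at hnot
  obtain ⟨A, _, hAne, hA⟩ := hnot
  obtain ⟨r, hr, hup⟩ := exists_rank G d A (fun B _ => hdeg B (Finset.subset_univ _))
  have hedges := sum_dg G A r hr
  have hlow : d * A.card ≤ ∑ v ∈ A, dg G A v := by
    rw [mul_comm, ← smul_eq_mul]
    refine Finset.card_nsmul_le_sum _ _ _ fun v hv => ?_
    have := hA v hv
    omega
  set K := 2 * k + 1 with hK
  set L := 48 * K ^ 3 + 1 with hL
  set R := (w + 1) ^ (k + 1) with hR
  set b := 4 * R * L with hb
  set M := R * b ^ (k + 1) with hM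
  have hbnd : bnd k w = 4 * L * M + b + K := rfl
  rw [hbnd] at hle
  have hsp : ∀ x ∈ A, L * (adjPairs G (upN G A r x)).card ≤ d ^ 2 := by
    intro x hx
    exact sparse G k w hw h1 _ L d R b M (by omega) hR hb hM (hup x hx) (by omega) (by omega)
  have he : ∀ x ∈ A, (adjPairs G (upN G A r x)).card ≤ d ^ 2 / L := by
    intro x hx
    rw [Nat.le_div_iff_mul_le (by omega), mul_comm]
    exact hsp x hx
  set e := d ^ 2 / L with hee
  have heL : L * e ≤ d ^ 2 := Nat.mul_div_le _ _
  set m := d / K with hm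
  have hKpos : 0 < K := by omega
  have hm1 : 1 ≤ m := by
    rw [hm, Nat.le_div_iff_mul_le hKpos]; omega
  have hKm : K * m ≤ d := Nat.mul_div_le _ _
  have hKm2 : d ≤ 2 * (K * m) := by
    have h2 := Nat.div_add_mod d K
    have h3 := Nat.mod_lt d hKpos
    rw [← hm] at h2
    have : K * 1 ≤ K * m := Nat.mul_le_mul_left _ hm1
    omega
  have hav := averaged G k m d e (m ^ Fintype.card V) A rfl r hr h1 hup he
  have hTpos : 0 < m ^ Fintype.card V := by positivity
  set T := m ^ Fintype.card V
  have hn : 0 < A.card := Finset.card_pos.2 hAne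
  set n := A.card
  set E := ∑ x ∈ A, (upN G A r x).card
  have hE : d * n ≤ 2 * E := by omega
  -- cancel T * n
  have h5 : (T * n) * (m ^ 2 * d) ≤ (T * n) * (2 * (m ^ 3 * k) + 4 * (d * e) + 4 * (e * m)) := by
    calc (T * n) * (m ^ 2 * d) = m ^ 2 * T * (d * n) := by ring
      _ ≤ m ^ 2 * T * (2 * E) := Nat.mul_le_mul_left _ hE
      _ = 2 * (m ^ 2 * T * E) := by ring
      _ ≤ 2 * (m ^ 3 * (T * (k * n)) + n * (d * e * T + 2 * (e * (m * T)) + d * e * T)) :=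
        Nat.mul_le_mul_left _ hav
      _ = _ := by ring
  have h6 := Nat.le_of_mul_le_mul_left h5 (by positivity)
  have h7 : L * (m ^ 2 * d) ≤ L * (2 * (m ^ 3 * k)) + 4 * d ^ 3 + 4 * (d ^ 2 * m) := by
    calc L * (m ^ 2 * d) ≤ L * (2 * (m ^ 3 * k) + 4 * (d * e) + 4 * (e * m)) :=
        Nat.mul_le_mul_left _ h6
      _ = L * (2 * (m ^ 3 * k)) + 4 * d * (L * e) + 4 * m * (L * e) := by ring
      _ ≤ L * (2 * (m ^ 3 * k)) + 4 * d * d ^ 2 + 4 * m * d ^ 2 := by gcongr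
      _ = _ := by ring
  have h8 : L * (m ^ 2 * (K * m)) ≤ L * (m ^ 2 * d) := by gcongr
  have h9 : d ^ 3 ≤ 8 * K ^ 3 * m ^ 3 := by
    calc d ^ 3 ≤ (2 * (K * m)) ^ 3 := by gcongr
      _ = _ := by ring
  have h10 : d ^ 2 * m ≤ 4 * K ^ 3 * m ^ 3 := by
    calc d ^ 2 * m ≤ (2 * (K * m)) ^ 2 * m := by gcongr
      _ = 4 * K ^ 2 * m ^ 3 := by ring
      _ ≤ 4 * K ^ 3 * m ^ 3 := by gcongr; all_goals omega
  have h11 : L * (m ^ 2 * (K * m)) = L * (2 * (m ^ 3 * k)) + L * m ^ 3 := by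
    rw [hK]; ring
  have h12 : L * m ^ 3 = 48 * K ^ 3 * m ^ 3 + m ^ 3 := by rw [hL]; ring
  have h13 : 0 < m ^ 3 := by positivity
  nlinarith

theorem card_le_cliqNum {V : Type} [Fintype V] (G : SimpleGraph V) (Q : Finset V)
    (hQ : G.IsClique (Q : Set V)) : Q.card ≤ cliqNum G := by
  unfold cliqNum
  refine le_csSup ⟨Fintype.card V, ?_⟩ ⟨Q, hQ, rfl⟩
  rintro n ⟨s, hs⟩
  rw [← hs.card_eq]
  exact Finset.card_le_univ _

theorem cliqNum_le_two {V : Type} [Fintype V] (G : SimpleGraph V)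
    (h : ∀ x y z, G.Adj x y → G.Adj y z → G.Adj x z → False) : cliqNum G ≤ 2 := by
  unfold cliqNum
  refine csSup_le ⟨0, ∅, by simp [isNClique_iff]⟩ ?_
  rintro n ⟨s, hs⟩
  by_contra hn
  rw [← hs.card_eq] at hn
  obtain ⟨a, ha, b, hb, c, hc, hab, hac, hbc⟩ := Finset.two_lt_card.1 (by omega : 2 < s.card)
  exact h a b c (hs.isClique ha hb hab) (hs.isClique hb hc hbc) (hs.isClique ha hc hac)

theorem exists_low {V : Type} (G : SimpleGraph V) (A : Finset V) (hA : A.Nonempty)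
    [Fintype (A : Set V)] :
    ∃ v ∈ A, dg G A v ≤ minDeg (G.induce (A : Set V)) := by
  have : Nonempty (A : Set V) := ⟨⟨hA.choose, hA.choose_spec⟩⟩
  obtain ⟨v, hv⟩ := (G.induce (A : Set V)).exists_minimal_degree_vertex
  refine ⟨v, v.2, ?_⟩
  have hv' : minDeg (G.induce (A : Set V)) = (G.induce (A : Set V)).degree v := by
    unfold minDeg
    convert hv
  rw [hv', ← card_neighborFinset_eq_degree]
  refine le_trans (Finset.card_le_card ?_) (Finset.card_image_le (f := Subtype.val))
  intro u hu
  obtain ⟨huA, hadj⟩ := Finset.mem_filter.1 hu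
  rw [Finset.mem_image]
  exact ⟨⟨u, huA⟩, by simpa using hadj, rfl⟩

theorem low_of_bound {V : Type} (G : SimpleGraph V) (A : Finset V) (hA : A.Nonempty)
    (hT : TriFree G A) (f : ℕ → ℕ) (inst : Fintype (A : Set V))
    (hbd : minDeg (G.induce (A : Set V)) ≤ f (cliqNum (G.induce (A : Set V)))) :
    ∃ v ∈ A, dg G A v ≤ f 0 + f 1 + f 2 := by
  obtain ⟨v, hv, hle⟩ := exists_low G A hA
  refine ⟨v, hv, hle.trans (hbd.trans ?_)⟩
  have h2 := cliqNum_le_two (G.induce (A : Set V)) (by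
    intro x y z hxy hyz hxz
    exact hT x x.2 y y.2 z z.2 hxy hyz hxz)
  generalize cliqNum (G.induce (A : Set V)) = q at h2 ⊢
  interval_cases q <;> omega

theorem bnd_poly (k : ℕ) : ∃ p : Polynomial ℕ, ∀ w, p.eval w = bnd k w := by
  let L := 48 * (2 * k + 1) ^ 3 + 1
  let R : Polynomial ℕ := (Polynomial.X + 1) ^ (k + 1)
  refine ⟨Polynomial.C (4 * L) * (R * (Polynomial.C 4 * R * Polynomial.C L) ^ (k + 1)) +
    Polynomial.C 4 * R * Polynomial.C L + Polynomial.C (2 * k + 1), fun w => ?_⟩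
  simp only [Polynomial.eval_add, Polynomial.eval_mul, Polynomial.eval_pow, Polynomial.eval_C,
    Polynomial.eval_X, Polynomial.eval_one, R]
  rfl

/-- A hereditary class degree-bounded by the clique number is polynomially
degree-bounded by the clique number. -/
theorem poly_degree_bounded_by_omega (F : GraphClass) (hF : Hereditary F)
    (hDB : ∃ f : ℕ → ℕ, ∀ (V : Type) [Fintype V] (G : SimpleGraph V),
        F V G → minDeg G ≤ f (cliqNum G)) :
    ∃ p : Polynomial ℕ, ∀ (V : Type) [Fintype V] (G : SimpleGraph V),
        F V G → minDeg G ≤ p.eval (cliqNum G) := by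
  obtain ⟨f, hf⟩ := hDB
  obtain ⟨p, hp⟩ := bnd_poly (f 0 + f 1 + f 2)
  refine ⟨p, fun V _ G hG => ?_⟩
  rw [hp]
  have key : ∀ s : Set V, s.Nonempty → minDeg (G.induce s) ≤ f (cliqNum (G.induce s)) :=
    fun s hs => hf _ _ (hF.2 V G s hs hG)
  have h1 : ∀ A : Finset V, A.Nonempty → TriFree G A →
      ∃ v ∈ A, dg G A v ≤ f 0 + f 1 + f 2 := by
    intro A hA hT
    exact low_of_bound G A hA hT f _ (key (A : Set V) hA)
  have hmain := main_bound G (f 0 + f 1 + f 2) (cliqNum G) (card_le_cliqNum G) h1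
  rcases isEmpty_or_nonempty V with hV | hV
  · simp [minDeg]
  · obtain ⟨v, _, hv⟩ := hmain Finset.univ subset_rfl Finset.univ_nonempty
    refine le_trans (G.minDegree_le_degree v) (le_trans (le_of_eq ?_) hv)
    rw [← card_neighborFinset_eq_degree]
    unfold dg
    congr 1
    ext u
    simp
end
end

section
/- Let F be a hereditary, degree-bounded class of finite simple graphs. Then F has the Erdős–Hajnal property (there exists ε > 0 such that every graph G ∈ F on n ≥ 1 vertices has a clique or an independent set of size at least n^ε) if and only if there exists a polynomial p̂ with natural-number coefficients such that every graph G ∈ F satisfies δ(G) ≤ p̂(τ̂(G)). -/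
open SimpleGraph
open scoped Classical

noncomputable section

/-- `G` contains `K_{t,t}` as a (not necessarily induced) subgraph. -/
def HasBicliqueSub {V : Type} (G : SimpleGraph V) (t : ℕ) : Prop :=
  ∃ A B : Finset V, Disjoint A B ∧ A.card = t ∧ B.card = t ∧
    ∀ a ∈ A, ∀ b ∈ B, G.Adj a b

/-- The biclique number of `G`. -/
def bicliqueNum {V : Type} [Fintype V] (G : SimpleGraph V) : ℕ :=
  sSup {t | HasBicliqueSub G t}

/-- The induced biclique number: the largest `s` such that `G` has an induced subgraph
isomorphic to `K_s` or to `K_{s,s}`. -/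
def indBicliqueNum {V : Type} [Fintype V] (G : SimpleGraph V) : ℕ :=
  sSup {s | ∃ A : Set V,
    Nonempty (G.induce A ≃g (⊤ : SimpleGraph (Fin s))) ∨
    Nonempty (G.induce A ≃g completeBipartiteGraph (Fin s) (Fin s))}

/-- The Erdős–Hajnal property for a class of graphs. -/
def HasEH (F : GraphClass) : Prop :=
  ∃ ε : ℝ, 0 < ε ∧ ∀ (V : Type) [Fintype V] [Nonempty V] (G : SimpleGraph V),
    F V G → ∃ s : Finset V,
      ((Fintype.card V : ℝ) ^ ε ≤ (s.card : ℝ)) ∧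
      ((s : Set V).Pairwise G.Adj ∨ (s : Set V).Pairwise fun a b => ¬ G.Adj a b)


/-- Neighbours of `v` inside `U`. -/
def nb {V : Type} (G : SimpleGraph V) (U : Finset V) (v : V) : Finset V :=
  U.filter (fun u => G.Adj v u)

/-- Later neighbours of `v` inside `W`, with respect to the ranking `ρ`. -/
def outN {V : Type} (G : SimpleGraph V) (ρ : V → ℕ) (W : Finset V) (v : V) : Finset V :=
  W.filter (fun u => G.Adj v u ∧ ρ v < ρ u)

/-- Independent finite sets. -/
def Indep {V : Type} (G : SimpleGraph V) (I : Finset V) : Prop :=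
  ∀ a ∈ I, ∀ b ∈ I, ¬ G.Adj a b

/-- Purely combinatorial properties of a fixed graph used in the main argument. -/
structure Ctx {V : Type} [Fintype V] (G : SimpleGraph V) (g : ℕ → ℕ) (E s : ℕ) : Prop where
  hdeg : ∀ W : Finset V, W.Nonempty → ∀ t : ℕ,
    (∀ A B : Finset V, A ⊆ W → B ⊆ W → A.card = t + 1 → B.card = t + 1 →
      ¬ ∀ a ∈ A, ∀ b ∈ B, G.Adj a b) → ∃ w ∈ W, (nb G W w).card ≤ g t
  hram : ∀ (W : Finset V) (l : ℕ), s ≤ l → l ^ E ≤ W.card →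
    ∃ I ⊆ W, I.card = l ∧ Indep G I
  hK : ∀ A B : Finset V, A.card = s → B.card = s → ¬ ∀ a ∈ A, ∀ b ∈ B, G.Adj a b
  hs : 1 ≤ s
  hE : 1 ≤ E

lemma Indep.mono {V : Type} {G : SimpleGraph V} {I J : Finset V} (h : Indep G J) (hIJ : I ⊆ J) :
    Indep G I := fun a ha b hb => h a (hIJ ha) b (hIJ hb)

lemma no_plane {V : Type} [Fintype V] {G : SimpleGraph V} {g : ℕ → ℕ} {E s : ℕ}
    (C : Ctx G g E s) (p : ℕ) [Fact p.Prime] (hp : g 1 < p)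
    (pt ln : ZMod p × ZMod p → V)
    (hpt : ∀ P Q, ¬ G.Adj (pt P) (pt Q)) (hln : ∀ P Q, ¬ G.Adj (ln P) (ln Q))
    (hinc : ∀ l P, G.Adj (ln l) (pt P) ↔ P.2 = l.1 * P.1 + l.2) : False := by
  have hlninj : Function.Injective ln := by
    rintro ⟨a, b⟩ ⟨a', b'⟩ h
    have h0 := (hinc (a, b) (0, b)).2 (by simp)
    have h1 := (hinc (a, b) (1, a + b)).2 (by simp)
    rw [h, hinc] at h0 h1
    simp at h0 h1
    subst h0
    simp at h1
    simp [h1]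
  have hptinj : Function.Injective pt := by
    rintro ⟨x, y⟩ ⟨x', y'⟩ h
    have h0 := (hinc (0, y) (x, y)).2 (by simp)
    have h1 := (hinc (1, y - x) (x, y)).2 (by simp)
    rw [h, hinc] at h0 h1
    simp at h0 h1
    subst h0
    have : x = x' := by linear_combination h1
    simp [this]
  -- uniqueness
  have key : ∀ P Q l k, G.Adj (ln l) (pt P) → G.Adj (ln l) (pt Q) → G.Adj (ln k) (pt P) →
      G.Adj (ln k) (pt Q) → P = Q ∨ l = k := by
    rintro ⟨x, y⟩ ⟨x', y'⟩ ⟨a, b⟩ ⟨a', b'⟩ h1 h2 h3 h4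
    rw [hinc] at h1 h2 h3 h4
    simp only at h1 h2 h3 h4
    have : (a - a') * (x - x') = 0 := by linear_combination h2 - h1 + h3 - h4
    rcases mul_eq_zero.1 this with h | h
    · right
      have ha : a = a' := sub_eq_zero.1 h
      subst ha
      have : b = b' := by linear_combination h3 - h1
      simp [this]
    · left
      have ha : x = x' := sub_eq_zero.1 h
      subst ha
      have : y = y' := by linear_combination h1 - h2
      simp [this]
  let W : Finset V := Finset.univ.image pt ∪ Finset.univ.image ln
  have memW : ∀ w, w ∈ W ↔ (∃ P, pt P = w) ∨ (∃ l, ln l = w) := by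
    intro w; simp [W]
  obtain ⟨w, hw, hcard⟩ := C.hdeg W ⟨pt (0, 0), by rw [memW]; exact Or.inl ⟨_, rfl⟩⟩ 1 (by
    intro A B hA hB hAc hBc h
    obtain ⟨x0, x1, hx, rfl⟩ := Finset.card_eq_two.1 hAc
    obtain ⟨y0, y1, hy, rfl⟩ := Finset.card_eq_two.1 hBc
    have h00 := h x0 (by simp) y0 (by simp)
    have h01 := h x0 (by simp) y1 (by simp)
    have h10 := h x1 (by simp) y0 (by simp)
    have h11 := h x1 (by simp) y1 (by simp)
    have m0 := (memW x0).1 (hA (by simp))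
    have m1 := (memW x1).1 (hA (by simp))
    have n0 := (memW y0).1 (hB (by simp))
    have n1 := (memW y1).1 (hB (by simp))
    rcases m0 with ⟨P, rfl⟩ | ⟨l, rfl⟩
    · obtain ⟨l, rfl⟩ := n0.resolve_left (by rintro ⟨Q, rfl⟩; exact hpt _ _ h00)
      obtain ⟨k, rfl⟩ := n1.resolve_left (by rintro ⟨Q, rfl⟩; exact hpt _ _ h01)
      obtain ⟨Q, rfl⟩ := m1.resolve_right (by rintro ⟨Q, rfl⟩; exact hln _ _ h10)
      rcases key P Q l k h00.symm h10.symm h01.symm h11.symm with h | h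
      · exact hx (by rw [h])
      · exact hy (by rw [h])
    · obtain ⟨P, rfl⟩ := n0.resolve_right (by rintro ⟨Q, rfl⟩; exact hln _ _ h00)
      obtain ⟨Q, rfl⟩ := n1.resolve_right (by rintro ⟨Q, rfl⟩; exact hln _ _ h01)
      obtain ⟨k, rfl⟩ := m1.resolve_left (by rintro ⟨Q, rfl⟩; exact hpt _ _ h10)
      rcases key P Q l k h00 h01 h10 h11 with h | h
      · exact hy (by rw [h])
      · exact hx (by rw [h]))
  have hge : p ≤ (nb G W w).card := by
    rcases (memW w).1 hw with ⟨⟨x, y⟩, rfl⟩ | ⟨⟨a, b⟩, rfl⟩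
    · have hi : Function.Injective (fun a : ZMod p => ln (a, y - a * x)) := by
        intro a a' h
        have := hlninj h
        exact (Prod.ext_iff.1 this).1
      have hsub : Finset.univ.image (fun a : ZMod p => ln (a, y - a * x)) ⊆ nb G W (pt (x, y)) := by
        intro v hv
        obtain ⟨a, -, rfl⟩ := Finset.mem_image.1 hv
        refine Finset.mem_filter.2 ⟨(memW _).2 (Or.inr ⟨_, rfl⟩), ?_⟩
        have hadj := (hinc (a, y - a * x) (x, y)).2 (by simp)
        exact hadj.symm
      have := Finset.card_le_card hsub
      rwa [Finset.card_image_of_injective _ hi, Finset.card_univ, ZMod.card] at this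
    · have hi : Function.Injective (fun x : ZMod p => pt (x, a * x + b)) := by
        intro a a' h
        have := hptinj h
        exact (Prod.ext_iff.1 this).1
      have hsub : Finset.univ.image (fun x : ZMod p => pt (x, a * x + b)) ⊆ nb G W (ln (a, b)) := by
        intro v hv
        obtain ⟨x, -, rfl⟩ := Finset.mem_image.1 hv
        refine Finset.mem_filter.2 ⟨(memW _).2 (Or.inl ⟨_, rfl⟩), ?_⟩
        exact (hinc _ _).2 rfl
      have := Finset.card_le_card hsub
      rwa [Finset.card_image_of_injective _ hi, Finset.card_univ, ZMod.card] at this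
  omega

lemma card_small_subsets {α : Type} (B : Finset α) (m : ℕ) :
    (B.powerset.filter (fun S => S.card ≤ m)).card ≤ (B.card + 1) ^ m := by
  induction m with
  | zero =>
    have : B.powerset.filter (fun S => S.card ≤ 0) ⊆ {∅} := by
      intro S hS
      simp at hS
      simp [hS.2]
    simpa using Finset.card_le_card this
  | succ m ih =>
    have hsub : B.powerset.filter (fun S => S.card ≤ m + 1) ⊆
        (B.powerset.filter (fun S => S.card ≤ m)) ∪
        (B ×ˢ (B.powerset.filter (fun S => S.card ≤ m))).image (fun x => insert x.1 x.2) := by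
      intro S hS
      simp only [Finset.mem_filter, Finset.mem_powerset] at hS
      by_cases hS0 : S.card ≤ m
      · simp [hS.1, hS0]
      · have hne : S.Nonempty := by
          rw [← Finset.card_pos]; omega
        obtain ⟨x, hx⟩ := hne
        refine Finset.mem_union_right _ (Finset.mem_image.2 ⟨(x, S.erase x), ?_, ?_⟩)
        · simp only [Finset.mem_product, Finset.mem_filter, Finset.mem_powerset]
          refine ⟨hS.1 hx, (Finset.erase_subset _ _).trans hS.1, ?_⟩
          rw [Finset.card_erase_of_mem hx]; omega
        · exact Finset.insert_erase hx
    calc _ ≤ _ := Finset.card_le_card hsub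
      _ ≤ _ := Finset.card_union_le _ _
      _ ≤ (B.card + 1) ^ m + B.card * (B.card + 1) ^ m := by
          refine add_le_add ih (Finset.card_image_le.trans ?_)
          rw [Finset.card_product]
          exact Nat.mul_le_mul_left _ ih
      _ = _ := by ring

lemma trace_bound (g : ℕ → ℕ) : ∃ m : ℕ, ∀ (V : Type) [Fintype V] (G : SimpleGraph V) (E s : ℕ),
    Ctx G g E s → ∀ A B : Finset V, Indep G A → Indep G B →
    (A.image (nb G B)).card ≤ (B.card + 1) ^ m := by
  obtain ⟨p, hp, hpp⟩ := Nat.exists_infinite_primes (g 1 + 1)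
  have : Fact p.Prime := ⟨hpp⟩
  refine ⟨p ^ 2, ?_⟩
  intro V _ G E s C A B hA hB
  refine (Finset.card_le_card_shatterer _).trans ?_
  refine (Finset.card_le_card ?_).trans (card_small_subsets B (p ^ 2))
  intro S hS
  rw [Finset.mem_shatterer] at hS
  have hSB : S ⊆ B := by
    obtain ⟨u, hu, hSu⟩ := hS (Finset.Subset.refl S)
    obtain ⟨a, ha, rfl⟩ := Finset.mem_image.1 hu
    intro x hx
    rw [← hSu] at hx
    exact (Finset.mem_filter.1 (Finset.mem_inter.1 hx).2).1
  simp only [Finset.mem_filter, Finset.mem_powerset]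
  refine ⟨hSB, ?_⟩
  by_contra hcard
  push Not at hcard
  obtain ⟨S', hS'S, hS'c⟩ := Finset.exists_subset_card_eq hcard.le
  have hS' := hS.mono_right hS'S
  have hcardeq : Fintype.card (ZMod p × ZMod p) = Fintype.card S' := by
    rw [Fintype.card_prod, ZMod.card, Fintype.card_coe, hS'c]; ring
  let e := Fintype.equivOfCardEq hcardeq
  have hex : ∀ l : ZMod p × ZMod p, ∃ a ∈ A, ∀ P, G.Adj a (e P) ↔ P.2 = l.1 * P.1 + l.2 := by
    intro l
    obtain ⟨u, hu, hSu⟩ := hS' (t := (Finset.univ.filter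
      (fun P : ZMod p × ZMod p => P.2 = l.1 * P.1 + l.2)).image (fun P => (e P : V))) (by
        intro x hx
        obtain ⟨P, -, rfl⟩ := Finset.mem_image.1 hx
        exact (e P).2)
    obtain ⟨a, ha, rfl⟩ := Finset.mem_image.1 hu
    refine ⟨a, ha, fun P => ?_⟩
    have h1 := Finset.ext_iff.1 hSu (e P)
    have h2 : ((e P : V) ∈ S' ∩ nb G B a) ↔ G.Adj a (e P) := by
      simp only [Finset.mem_inter, nb, Finset.mem_filter]
      exact ⟨fun h => h.2.2, fun h => ⟨(e P).2, hSB (hS'S (e P).2), h⟩⟩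
    rw [← h2, h1]
    simp only [Finset.mem_image, Finset.mem_filter, Finset.mem_univ, true_and]
    constructor
    · rintro ⟨Q, hQ, h⟩
      have : Q = P := e.injective (Subtype.ext h)
      rwa [← this]
    · intro h
      exact ⟨P, h, rfl⟩
  choose ln hlnA hln using hex
  exact no_plane C p (by omega) (fun P => (e P : V)) ln
    (fun P Q => hB _ (hSB (hS'S (e P).2)) _ (hSB (hS'S (e Q).2)))
    (fun P Q => hA _ (hlnA P) _ (hlnA Q)) hln

/-- `TB` : the trace bound with exponent `m`. -/
def TB {V : Type} (G : SimpleGraph V) (m : ℕ) : Prop :=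
  ∀ A B : Finset V, Indep G A → Indep G B → (A.image (nb G B)).card ≤ (B.card + 1) ^ m

lemma trace_general {V : Type} [Fintype V] {G : SimpleGraph V} {g : ℕ → ℕ} {E s m : ℕ}
    (C : Ctx G g E s) (hm : TB G m) (Z B : Finset V) (hB : Indep G B) :
    (Z.image (nb G B)).card ≤ ((B.card + 1) ^ m + s) ^ E := by
  by_contra hcon
  push Not at hcon
  obtain ⟨Z', hZ', himg, hinj⟩ : ∃ Z' ⊆ Z, Z'.image (nb G B) = Z.image (nb G B) ∧
      Set.InjOn (nb G B) Z' := by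
    obtain ⟨u, hu, h1, h2⟩ := Finset.exists_subset_injOn_image_eq_of_surjOn (f := nb G B)
      Z (Z.image (nb G B)) (by intro x hx; simpa using hx)
    exact ⟨u, hu, h2, h1⟩
  have hc : Z'.card = (Z.image (nb G B)).card := by
    rw [← himg, Finset.card_image_of_injOn hinj]
  obtain ⟨I, hI, hIc, hInd⟩ := C.hram Z' ((B.card + 1) ^ m + s) (by omega) (by omega)
  have h1 := hm I B hInd hB
  rw [Finset.card_image_of_injOn (hinj.mono hI), hIc] at h1
  have := C.hs
  omega

lemma rich_bound {V : Type} [Fintype V] {G : SimpleGraph V} {g : ℕ → ℕ} {E s m : ℕ}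
    (C : Ctx G g E s) (hm : TB G m) (Z B : Finset V) (hB : Indep G B)
    (hZ : ∀ z ∈ Z, s ≤ (nb G B z).card) :
    Z.card ≤ (s * (B.card + 1) ^ m + s) ^ E := by
  by_contra hcon
  push Not at hcon
  obtain ⟨I, hI, hIc, hInd⟩ := C.hram Z (s * (B.card + 1) ^ m + s) (by omega) hcon.le
  have h1 := hm I B hInd hB
  have hs := C.hs
  have : ∃ y ∈ I.image (nb G B), s ≤ (I.filter (fun x => nb G B x = y)).card := by
    refine Finset.exists_le_card_fiber_of_mul_le_card_of_maps_to
      (fun a ha => Finset.mem_image_of_mem _ ha) ?_ ?_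
    · have : 0 < I.card := by rw [hIc]; omega
      exact (Finset.card_pos.1 this).image _
    · rw [hIc]
      calc _ ≤ (B.card + 1) ^ m * s := Nat.mul_le_mul_right _ h1
        _ ≤ _ := by rw [mul_comm]; omega
  obtain ⟨y, hy, hyc⟩ := this
  obtain ⟨a0, ha0, rfl⟩ := Finset.mem_image.1 hy
  obtain ⟨X, hX, hXc⟩ := Finset.exists_subset_card_eq hyc
  obtain ⟨Y, hY, hYc⟩ := Finset.exists_subset_card_eq (hZ a0 (hI ha0))
  refine C.hK X Y hXc hYc ?_
  intro a ha b hb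
  have h2 := (Finset.mem_filter.1 (hX ha)).2
  have h3 := hY hb
  rw [← h2] at h3
  exact (Finset.mem_filter.1 h3).2

lemma block_partition {V : Type} [Fintype V] {G : SimpleGraph V} {g : ℕ → ℕ} {E s : ℕ}
    (C : Ctx G g E s) (l : ℕ) (hl : s ≤ l) (n : ℕ) : ∀ U : Finset V, U.card ≤ n →
    ∃ P : Finset (Finset V), (∀ I ∈ P, I ⊆ U ∧ I.card = l ∧ Indep G I) ∧
      (P.card * l ≤ U.card) ∧
      ∀ X : Finset V, X ⊆ U → X.card ≤ ∑ I ∈ P, (X ∩ I).card + l ^ E := by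
  have hs := C.hs
  induction n with
  | zero =>
    intro U hU
    refine ⟨∅, by simp, by simp, ?_⟩
    intro X hX
    have := Finset.card_le_card hX
    omega
  | succ n ih =>
    intro U hU
    by_cases hbig : l ^ E ≤ U.card
    · obtain ⟨I, hI, hIc, hInd⟩ := C.hram U l hl hbig
      have hc := Finset.card_sdiff_add_card_eq_card hI
      obtain ⟨P, hP1, hP2, hP3⟩ := ih (U \ I) (by omega)
      have hIP : I ∉ P := by
        intro h
        have h1 := (hP1 I h).1
        have : I.Nonempty := by rw [← Finset.card_pos]; omega
        obtain ⟨x, hx⟩ := this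
        exact (Finset.mem_sdiff.1 (h1 hx)).2 hx
      refine ⟨insert I P, ?_, ?_, ?_⟩
      · intro J hJ
        rcases Finset.mem_insert.1 hJ with rfl | hJ
        · exact ⟨hI, hIc, hInd⟩
        · exact ⟨(hP1 J hJ).1.trans Finset.sdiff_subset, (hP1 J hJ).2⟩
      · rw [Finset.card_insert_of_notMem hIP, add_mul, one_mul]
        omega
      · intro X hX
        rw [Finset.sum_insert hIP]
        have h3 := hP3 (X \ I) (Finset.sdiff_subset_sdiff hX (Finset.Subset.refl _))
        have h4 : ∑ J ∈ P, ((X \ I) ∩ J).card ≤ ∑ J ∈ P, (X ∩ J).card :=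
          Finset.sum_le_sum fun J _ => Finset.card_le_card
            (Finset.inter_subset_inter_right Finset.sdiff_subset)
        have h5 := Finset.card_sdiff_add_card_inter X I
        omega
    · refine ⟨∅, by simp, by simp, ?_⟩
      intro X hX
      have := Finset.card_le_card hX
      simp
      omega

/-- Vertices with a large neighbourhood in `U`. -/
def heavy {V : Type} [Fintype V] (G : SimpleGraph V) (U : Finset V) (D y : ℕ) : Finset V :=
  Finset.univ.filter (fun z => D ≤ y * (nb G U z).card)

lemma heavy_bound {V : Type} [Fintype V] {G : SimpleGraph V} {g : ℕ → ℕ} {E s m : ℕ}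
    (C : Ctx G g E s) (hm : TB G m) (U : Finset V) (D y : ℕ) (hU : U.card ≤ D) (hy : 1 ≤ y)
    (hD : 2 * y * (4 * s * y) ^ E ≤ D) :
    (heavy G U D y).card ≤ 4 * y * (s * (4 * s * y + 1) ^ m + s) ^ E := by
  have hs := C.hs
  set l := 4 * s * y with hl
  have hsl : s ≤ l := by nlinarith
  have hl1 : 1 ≤ l := by omega
  have hDpos : 0 < D := by
    have : 0 < 2 * y * l ^ E := by positivity
    omega
  obtain ⟨P, hP1, hP2, hP3⟩ := block_partition C l hsl U.card U le_rfl
  set Z := heavy G U D y with hZ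
  set Q := (s * (l + 1) ^ m + s) ^ E with hQ
  -- good blocks of z
  have hgood : ∀ z ∈ Z, D ≤ 4 * y * l * (P.filter (fun I => s ≤ (nb G I z).card)).card := by
    intro z hz
    have hz1 : D ≤ y * (nb G U z).card := (Finset.mem_filter.1 hz).2
    have h1 := hP3 (nb G U z) (Finset.filter_subset _ _)
    have h2 : ∑ I ∈ P, (nb G U z ∩ I).card ≤
        ∑ I ∈ P, (s + if s ≤ (nb G I z).card then l else 0) := by
      refine Finset.sum_le_sum fun I hI => ?_
      have h3 : nb G U z ∩ I ⊆ nb G I z := by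
        intro x hx
        simp only [nb, Finset.mem_inter, Finset.mem_filter] at hx ⊢
        exact ⟨hx.2, hx.1.2⟩
      have h3' := Finset.card_le_card h3
      have h4 : (nb G I z).card ≤ I.card := Finset.card_filter_le _ _
      rw [(hP1 I hI).2.1] at h4
      split_ifs with h
      · omega
      · omega
    rw [Finset.sum_add_distrib, Finset.sum_const, smul_eq_mul, ← Finset.sum_filter,
      Finset.sum_const, smul_eq_mul] at h2
    set k := (P.filter (fun I => s ≤ (nb G I z).card)).card
    have h5 : y * (nb G U z).card ≤ y * (P.card * s + k * l + l ^ E) :=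
      Nat.mul_le_mul_left _ (by omega)
    have h6 : 4 * (y * (P.card * s)) ≤ D := by
      calc _ = P.card * l := by rw [hl]; ring
        _ ≤ D := by omega
    nlinarith
  have hsum : Z.card * D ≤ 4 * y * l * ∑ z ∈ Z, (P.filter (fun I => s ≤ (nb G I z).card)).card := by
    rw [Finset.mul_sum, ← smul_eq_mul, ← Finset.sum_const]
    exact Finset.sum_le_sum hgood
  have hswap : ∑ z ∈ Z, (P.filter (fun I => s ≤ (nb G I z).card)).card
      = ∑ I ∈ P, (Z.filter (fun z => s ≤ (nb G I z).card)).card := by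
    simp only [Finset.card_filter]
    exact Finset.sum_comm
  have hle : ∑ I ∈ P, (Z.filter (fun z => s ≤ (nb G I z).card)).card ≤ P.card * Q := by
    rw [← smul_eq_mul, ← Finset.sum_const]
    refine Finset.sum_le_sum fun I hI => ?_
    have := rich_bound C hm (Z.filter (fun z => s ≤ (nb G I z).card)) I (hP1 I hI).2.2
      (fun z hz => (Finset.mem_filter.1 hz).2)
    rwa [(hP1 I hI).2.1] at this
  rw [hswap] at hsum
  have : Z.card * D ≤ (4 * y * Q) * D := by
    calc Z.card * D ≤ 4 * y * l * (P.card * Q) := hsum.trans (Nat.mul_le_mul_left _ hle)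
      _ = 4 * y * Q * (P.card * l) := by ring
      _ ≤ 4 * y * Q * D := Nat.mul_le_mul_left _ (by omega)
  exact Nat.le_of_mul_le_mul_right this hDpos

lemma heavy_bound' {V : Type} [Fintype V] {G : SimpleGraph V} {g : ℕ → ℕ} {E s m : ℕ}
    (C : Ctx G g E s) (hm : TB G m) (U : Finset V) (D y : ℕ) (hU : U.card ≤ D) (hy : 5 ≤ y)
    (hsy : s ≤ y) (hD : y ^ ((3 * m + 3) * E + 2) ≤ D) :
    (heavy G U D y).card ≤ y ^ ((3 * m + 3) * E + 2) := by
  have hs := C.hs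
  have h1 : 4 * s * y ≤ y ^ 3 := by
    calc 4 * s * y ≤ y * y * y := by gcongr; omega
      _ = y ^ 3 := by ring
  have h1' : 4 * s * y + 1 ≤ y ^ 3 := by
    have : 1 ≤ y * y := by nlinarith
    calc 4 * s * y + 1 ≤ 4 * y * y + y * y := by gcongr
      _ = 5 * (y * y) := by ring
      _ ≤ y * (y * y) := by gcongr
      _ = y ^ 3 := by ring
  have hbase : 2 * y ≤ y ^ 2 := by nlinarith
  refine (heavy_bound C hm U D y hU (by omega) ?_).trans ?_
  · refine le_trans ?_ hD
    calc 2 * y * (4 * s * y) ^ E ≤ y ^ 2 * (y ^ 3) ^ E := by gcongr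
      _ = y ^ (3 * E + 2) := by rw [← pow_mul, ← pow_add, add_comm]
      _ ≤ _ := Nat.pow_le_pow_right (by omega) (by nlinarith [Nat.zero_le (m * E)])
  · have hone : 1 ≤ (y ^ 3) ^ m := Nat.one_le_pow _ _ (by positivity)
    have h2 : s * (4 * s * y + 1) ^ m + s ≤ y ^ (3 * m + 2) := by
      calc s * (4 * s * y + 1) ^ m + s ≤ y * (y ^ 3) ^ m + y * (y ^ 3) ^ m := by
            gcongr
            calc s ≤ y * 1 := by omega
              _ ≤ _ := Nat.mul_le_mul_left _ hone
        _ = 2 * y * (y ^ 3) ^ m := by ring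
        _ ≤ y ^ 2 * (y ^ 3) ^ m := by gcongr
        _ = _ := by rw [← pow_mul, ← pow_add, add_comm]
    calc 4 * y * (s * (4 * s * y + 1) ^ m + s) ^ E ≤ y ^ 2 * (y ^ (3 * m + 2)) ^ E := by
          gcongr
          nlinarith
      _ = y ^ ((3 * m + 2) * E + 2) := by rw [← pow_mul, ← pow_add, add_comm]
      _ ≤ _ := Nat.pow_le_pow_right (by omega) (by nlinarith)

lemma count_colorings {V : Type} [Fintype V] (q : ℕ) (hq : 1 ≤ q) (S : Finset V) :
    ∑ χ : V → Fin q, (if (∀ v ∈ S, (χ v : ℕ) = 0) then (1 : ℝ) else 0) =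
      (q : ℝ) ^ (Fintype.card V) * (1 / (q : ℝ)) ^ S.card := by
  have hq0 : (q : ℝ) ≠ 0 := by positivity
  rw [← Finset.sum_filter, Finset.sum_const, nsmul_eq_mul, mul_one]
  have h1 : (Finset.univ.filter (fun χ : V → Fin q => ∀ v ∈ S, (χ v : ℕ) = 0)) =
      Fintype.piFinset (fun v => if v ∈ S then ({⟨0, hq⟩} : Finset (Fin q)) else Finset.univ) := by
    ext χ
    simp only [Finset.mem_filter, Finset.mem_univ, true_and, Fintype.mem_piFinset]
    refine forall_congr' fun v => ?_
    by_cases hv : v ∈ S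
    · simp [hv, Fin.ext_iff]
    · simp [hv]
  rw [h1, Fintype.card_piFinset]
  have h2 : ∀ v : V, (if v ∈ S then ({⟨0, hq⟩} : Finset (Fin q)) else Finset.univ).card =
      if v ∈ S then 1 else q := by
    intro v; split_ifs <;> simp
  simp only [h2]
  rw [Finset.prod_ite, Finset.prod_const_one, one_mul, Finset.prod_const]
  have h3 : (Finset.univ.filter (fun v => v ∉ S)).card + S.card = Fintype.card V := by
    have h := Finset.card_filter_add_card_filter_not (s := (Finset.univ : Finset V)) (fun v => v ∈ S)
    have h' : Finset.univ.filter (fun v => v ∈ S) = S := by ext; simp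
    rw [h', Finset.card_univ] at h
    omega
  rw [← h3, pow_add]
  push_cast
  rw [mul_assoc, ← mul_pow, mul_one_div_cancel hq0, one_pow, mul_one]

lemma weight_insert {V : Type} (w : ℝ) (hw0 : 0 ≤ w) (v u : V) (S : Finset V) (hvu : v ≠ u)
    (hv : v ∉ S) :
    w ^ (insert v (insert u S)).card ≤ w ^ (S.card + 1) * (w + if u ∈ S then 1 else 0) := by
  rw [Finset.card_insert_of_notMem (by simp [hvu, hv])]
  by_cases hu : u ∈ S
  · rw [Finset.insert_eq_of_mem hu, if_pos hu]
    have : 0 ≤ w ^ (S.card + 1) := by positivity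
    nlinarith
  · rw [Finset.card_insert_of_notMem hu, if_neg hu]
    apply le_of_eq; ring

lemma sampling {V : Type} [Fintype V] (W : Finset V) (O : V → Finset V)
    (hOW : ∀ v, O v ⊆ W) (hOv : ∀ v, v ∉ O v) (B : V → Finset (Finset V))
    (hB : ∀ v, ∀ S ∈ B v, v ∉ S) (q : ℕ) (hq : 1 ≤ q) (Δ β κ : ℝ) (hΔ : 0 < Δ)
    (hO : ∀ v ∈ W, ((O v).card : ℝ) ≤ Δ)
    (hβ : ∀ v ∈ W, ∑ S ∈ B v, (1 / (q : ℝ)) ^ S.card * (Δ * (1 / (q : ℝ)) + S.card) ≤ β)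
    (hκ : 0 ≤ κ)
    (hmain : (3 * β + κ) * W.card < (∑ v ∈ W, ((O v).card : ℝ)) * (1 / (q : ℝ))) :
    ∃ W' ⊆ W, (∀ v ∈ W', ∀ S ∈ B v, ¬ S ⊆ W') ∧
      κ * W'.card < ∑ v ∈ W', ((O v ∩ W').card : ℝ) := by
  set w : ℝ := 1 / (q : ℝ) with hw
  have hqpos : (0 : ℝ) < q := by positivity
  have hwpos : 0 < w := by positivity
  let X : (V → Fin q) → Finset V := fun χ => Finset.univ.filter (fun v => (χ v : ℕ) = 0)
  let I : (V → Fin q) → Finset V → ℝ := fun χ S => if S ⊆ X χ then 1 else 0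
  have hI0 : ∀ χ S, 0 ≤ I χ S := by
    intro χ S; simp only [I]; split_ifs <;> norm_num
  set N : ℝ := (q : ℝ) ^ (Fintype.card V) with hN
  have hNpos : 0 < N := by positivity
  have hcount : ∀ S, ∑ χ, I χ S = N * w ^ S.card := by
    intro S
    rw [hN, hw, ← count_colorings q hq S]
    refine Finset.sum_congr rfl fun χ _ => ?_
    simp only [I, X, Finset.subset_iff, Finset.mem_filter, Finset.mem_univ, true_and]
  let Φ : (Finset V → ℝ) → ℝ := fun J =>
    ∑ v ∈ W, ∑ u ∈ O v, (J {v, u} - ∑ S ∈ B v, J (insert v (insert u S))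
      - ∑ S ∈ B u, J (insert u (insert v S))) - κ * ∑ v ∈ W, J {v}
  have hlin : ∑ χ, Φ (I χ) = N * Φ (fun S => w ^ S.card) := by
    have hl : Φ (fun S => ∑ χ, I χ S) = ∑ χ, Φ (I χ) := by
      simp only [Φ]
      rw [Finset.sum_sub_distrib, ← Finset.mul_sum]
      congr 1
      · rw [Finset.sum_comm]
        refine Finset.sum_congr rfl fun v _ => ?_
        rw [Finset.sum_comm]
        refine Finset.sum_congr rfl fun u _ => ?_
        rw [Finset.sum_sub_distrib, Finset.sum_sub_distrib]
        congr 1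
        · congr 1
          rw [Finset.sum_comm]
        · rw [Finset.sum_comm]
      · rw [Finset.sum_comm]
    rw [← hl]
    simp only [hcount, Φ, Finset.mul_sum, mul_sub]
    congr 1
    refine Finset.sum_congr rfl fun v _ => ?_
    ring
  have hWO : ∀ v ∈ W, ∀ u ∈ O v, u ∈ W ∧ v ≠ u := fun v hv u hu =>
    ⟨hOW v hu, fun h => hOv v (by rw [← h] at hu; exact hu)⟩
  -- outgoing loss
  have hout : ∑ v ∈ W, ∑ u ∈ O v, ∑ S ∈ B v, w ^ (insert v (insert u S)).card ≤ W.card * (w * β) := by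
    rw [← nsmul_eq_mul, ← Finset.sum_const]
    refine Finset.sum_le_sum fun v hv => ?_
    rw [Finset.sum_comm]
    calc _ ≤ ∑ S ∈ B v, w * (w ^ S.card * (Δ * w + S.card)) := by
          refine Finset.sum_le_sum fun S hS => ?_
          calc _ ≤ ∑ u ∈ O v, w ^ (S.card + 1) * (w + if u ∈ S then 1 else 0) :=
                Finset.sum_le_sum fun u hu => weight_insert w hwpos.le v u S (hWO v hv u hu).2 (hB v S hS)
            _ = w ^ (S.card + 1) * ((O v).card * w + ((O v).filter (· ∈ S)).card) := by
                rw [← Finset.mul_sum, Finset.sum_add_distrib, Finset.sum_const, nsmul_eq_mul,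
                  Finset.card_filter]
                push_cast; rfl
            _ ≤ w ^ (S.card + 1) * (Δ * w + S.card) := by
                have h1 := hO v hv
                have h2 : ((O v).filter (· ∈ S)).card ≤ S.card :=
                  Finset.card_le_card (fun x hx => (Finset.mem_filter.1 hx).2)
                gcongr
            _ = _ := by ring
      _ ≤ w * β := by rw [← Finset.mul_sum]; exact mul_le_mul_of_nonneg_left (hβ v hv) hwpos.le
  have hin : ∑ v ∈ W, ∑ u ∈ O v, ∑ S ∈ B u, w ^ (insert u (insert v S)).card ≤
      W.card * (2 * (w * β)) := by
    have hstep : ∑ v ∈ W, ∑ u ∈ O v, ∑ S ∈ B u, w ^ (insert u (insert v S)).card ≤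
        ∑ v ∈ W, ∑ u ∈ O v, ∑ S ∈ B u, w ^ (S.card + 2) +
        ∑ v ∈ W, ∑ u ∈ O v, ∑ S ∈ B u, w ^ (S.card + 1) * (if v ∈ S then 1 else 0) := by
      simp only [← Finset.sum_add_distrib]
      refine Finset.sum_le_sum fun v hv => Finset.sum_le_sum fun u hu => Finset.sum_le_sum fun S hS => ?_
      refine (weight_insert w hwpos.le u v S (hWO v hv u hu).2.symm (hB u S hS)).trans (le_of_eq ?_)
      ring
    have ht1 : ∑ v ∈ W, ∑ u ∈ O v, ∑ S ∈ B u, w ^ (S.card + 2) ≤ W.card * (w * β) := by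
      rw [← nsmul_eq_mul, ← Finset.sum_const]
      refine Finset.sum_le_sum fun v hv => ?_
      have hβ0 : 0 ≤ β := le_trans (Finset.sum_nonneg fun S _ => by positivity) (hβ v hv)
      calc _ ≤ ∑ u ∈ O v, w * (β / Δ) := by
            refine Finset.sum_le_sum fun u hu => ?_
            have h1 := hβ u (hWO v hv u hu).1
            have h2 : Δ * ∑ S ∈ B u, w ^ (S.card + 1) ≤ β := by
              refine le_trans ?_ h1
              rw [Finset.mul_sum]
              refine Finset.sum_le_sum fun S _ => ?_
              have : 0 ≤ w ^ S.card * S.card := by positivity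
              calc _ = w ^ S.card * (Δ * w) := by ring
                _ ≤ _ := by nlinarith
            have h3 : ∑ S ∈ B u, w ^ (S.card + 1) ≤ β / Δ := by
              rw [le_div_iff₀ hΔ]; linarith
            calc _ = w * ∑ S ∈ B u, w ^ (S.card + 1) := by
                  rw [Finset.mul_sum]; exact Finset.sum_congr rfl fun S _ => by ring
              _ ≤ _ := mul_le_mul_of_nonneg_left h3 hwpos.le
        _ = (O v).card * (w * (β / Δ)) := by rw [Finset.sum_const, nsmul_eq_mul]
        _ ≤ Δ * (w * (β / Δ)) := by
            have := hO v hv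
            gcongr
        _ = w * β := by field_simp
    have ht2 : ∑ v ∈ W, ∑ u ∈ O v, ∑ S ∈ B u, w ^ (S.card + 1) * (if v ∈ S then (1 : ℝ) else 0) ≤
        W.card * (w * β) := by
      calc _ ≤ ∑ v ∈ W, ∑ u ∈ W, ∑ S ∈ B u, w ^ (S.card + 1) * (if v ∈ S then (1 : ℝ) else 0) := by
            refine Finset.sum_le_sum fun v hv => Finset.sum_le_sum_of_subset_of_nonneg (hOW v) ?_
            intro u _ _
            refine Finset.sum_nonneg fun S _ => ?_
            split_ifs <;> positivity
        _ = ∑ u ∈ W, ∑ S ∈ B u, ∑ v ∈ W, w ^ (S.card + 1) * (if v ∈ S then (1 : ℝ) else 0) := by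
            rw [Finset.sum_comm]
            refine Finset.sum_congr rfl fun u _ => ?_
            rw [Finset.sum_comm]
        _ ≤ W.card * (w * β) := by
            rw [← nsmul_eq_mul, ← Finset.sum_const]
            refine Finset.sum_le_sum fun u hu => ?_
            calc _ ≤ ∑ S ∈ B u, w * (w ^ S.card * (Δ * w + S.card)) := by
                  refine Finset.sum_le_sum fun S _ => ?_
                  have h2 : (W.filter (· ∈ S)).card ≤ S.card :=
                    Finset.card_le_card (fun x hx => (Finset.mem_filter.1 hx).2)
                  have h2' : ((W.filter (· ∈ S)).card : ℝ) ≤ Δ * w + S.card := by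
                    have : (0 : ℝ) ≤ Δ * w := by positivity
                    have : ((W.filter (· ∈ S)).card : ℝ) ≤ S.card := by exact_mod_cast h2
                    linarith
                  rw [← Finset.mul_sum, ← Finset.sum_filter, Finset.sum_const, nsmul_eq_mul, mul_one]
                  calc _ ≤ w ^ (S.card + 1) * (Δ * w + S.card) := by gcongr
                    _ = _ := by ring
              _ ≤ w * β := by
                  rw [← Finset.mul_sum]; exact mul_le_mul_of_nonneg_left (hβ u hu) hwpos.le
    linarith
  have hmean : 0 < Φ (fun S => w ^ S.card) := by
    have h1 : Φ (fun S => w ^ S.card) = ∑ v ∈ W, ∑ u ∈ O v, w ^ ({v, u} : Finset V).card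
        - ∑ v ∈ W, ∑ u ∈ O v, ∑ S ∈ B v, w ^ (insert v (insert u S)).card
        - ∑ v ∈ W, ∑ u ∈ O v, ∑ S ∈ B u, w ^ (insert u (insert v S)).card
        - κ * ∑ v ∈ W, w ^ ({v} : Finset V).card := by
      simp only [Φ, Finset.sum_sub_distrib]
    have h2 : ∑ v ∈ W, ∑ u ∈ O v, w ^ ({v, u} : Finset V).card =
        (∑ v ∈ W, ((O v).card : ℝ)) * w * w := by
      rw [Finset.sum_mul, Finset.sum_mul]
      refine Finset.sum_congr rfl fun v hv => ?_
      rw [mul_assoc, ← nsmul_eq_mul, ← Finset.sum_const]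
      refine Finset.sum_congr rfl fun u hu => ?_
      rw [Finset.card_pair (hWO v hv u hu).2]; ring
    have h3 : ∑ v ∈ W, w ^ ({v} : Finset V).card = W.card * w := by
      simp
    rw [h1, h2, h3]
    have h4 := mul_lt_mul_of_pos_right hmain hwpos
    nlinarith
  obtain ⟨χ, hχ⟩ : ∃ χ, 0 < Φ (I χ) := by
    by_contra hcon
    push Not at hcon
    have h1 : ∑ χ, Φ (I χ) ≤ 0 := Finset.sum_nonpos fun χ _ => hcon χ
    rw [hlin] at h1
    have := mul_pos hNpos hmean
    linarith
  let W' := W.filter (fun v => v ∈ X χ ∧ ∀ S ∈ B v, ¬ S ⊆ X χ)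
  have hW'W : W' ⊆ W := Finset.filter_subset _ _
  have hW'X : W' ⊆ X χ := fun v hv => (Finset.mem_filter.1 hv).2.1
  refine ⟨W', hW'W, fun v hv S hS hSW => (Finset.mem_filter.1 hv).2.2 S hS (hSW.trans hW'X), ?_⟩
  have hA : ∑ v ∈ W, ∑ u ∈ O v, (I χ {v, u} - ∑ S ∈ B v, I χ (insert v (insert u S))
      - ∑ S ∈ B u, I χ (insert u (insert v S))) ≤ ∑ v ∈ W', ((O v ∩ W').card : ℝ) := by
    have hB' : ∑ v ∈ W', ((O v ∩ W').card : ℝ) =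
        ∑ v ∈ W, ∑ u ∈ O v, (if v ∈ W' ∧ u ∈ W' then (1 : ℝ) else 0) := by
      rw [← Finset.sum_subset hW'W]
      · refine Finset.sum_congr rfl fun v hv => ?_
        simp only [hv, true_and]
        rw [← Finset.sum_filter, Finset.sum_const, nsmul_eq_mul, mul_one, Finset.filter_mem_eq_inter]
      · intro v _ hv
        simp [hv]
    rw [hB']
    refine Finset.sum_le_sum fun v hv => Finset.sum_le_sum fun u hu => ?_
    have n1 : 0 ≤ ∑ S ∈ B v, I χ (insert v (insert u S)) := Finset.sum_nonneg fun S _ => hI0 _ _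
    have n2 : 0 ≤ ∑ S ∈ B u, I χ (insert u (insert v S)) := Finset.sum_nonneg fun S _ => hI0 _ _
    by_cases hX : v ∈ X χ ∧ u ∈ X χ
    · have hle : I χ {v, u} = 1 := by
        simp only [I]; rw [if_pos]; intro x hx
        rcases Finset.mem_insert.1 hx with rfl | hx
        · exact hX.1
        · rw [Finset.mem_singleton.1 hx]; exact hX.2
      rw [hle]
      by_cases hvW : v ∈ W'
      · by_cases huW : u ∈ W'
        · rw [if_pos ⟨hvW, huW⟩]; linarith
        · rw [if_neg (fun h => huW h.2)]
          have : ∃ S ∈ B u, S ⊆ X χ := by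
            by_contra hno
            push Not at hno
            exact huW (Finset.mem_filter.2 ⟨(hWO v hv u hu).1, hX.2, hno⟩)
          obtain ⟨S, hS, hSX⟩ := this
          have h1 := Finset.single_le_sum (f := fun S => I χ (insert u (insert v S)))
            (fun S _ => hI0 _ _) hS
          have h2 : I χ (insert u (insert v S)) = 1 := by
            simp only [I]; rw [if_pos]
            exact Finset.insert_subset hX.2 (Finset.insert_subset hX.1 hSX)
          simp only [h2] at h1
          linarith
      · rw [if_neg (fun h => hvW h.1)]
        have : ∃ S ∈ B v, S ⊆ X χ := by
          by_contra hno
          push Not at hno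
          exact hvW (Finset.mem_filter.2 ⟨hv, hX.1, hno⟩)
        obtain ⟨S, hS, hSX⟩ := this
        have h1 := Finset.single_le_sum (f := fun S => I χ (insert v (insert u S)))
          (fun S _ => hI0 _ _) hS
        have h2 : I χ (insert v (insert u S)) = 1 := by
          simp only [I]; rw [if_pos]
          exact Finset.insert_subset hX.1 (Finset.insert_subset hX.2 hSX)
        simp only [h2] at h1
        linarith
    · have hle : I χ {v, u} = 0 := by
        simp only [I]; rw [if_neg]
        intro h
        exact hX ⟨h (by simp), h (by simp)⟩
      rw [hle]
      have : (0 : ℝ) ≤ if v ∈ W' ∧ u ∈ W' then (1 : ℝ) else 0 := by split_ifs <;> norm_num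
      linarith
  have hC : (W'.card : ℝ) ≤ ∑ v ∈ W, I χ {v} := by
    have : ∑ v ∈ W', (1 : ℝ) ≤ ∑ v ∈ W, I χ {v} := by
      refine le_trans (le_of_eq ?_) (Finset.sum_le_sum_of_subset_of_nonneg hW'W
        (fun v _ _ => hI0 _ _))
      refine Finset.sum_congr rfl fun v hv => ?_
      simp only [I]
      rw [if_pos (Finset.singleton_subset_iff.2 (hW'X hv))]
    simpa using this
  have hχ' : 0 < ∑ v ∈ W, ∑ u ∈ O v, (I χ {v, u} - ∑ S ∈ B v, I χ (insert v (insert u S))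
      - ∑ S ∈ B u, I χ (insert u (insert v S))) - κ * ∑ v ∈ W, I χ {v} := hχ
  have := mul_le_mul_of_nonneg_left hC hκ
  linarith

lemma sum_union_le' {α : Type} [DecidableEq α] (s t : Finset α) (f : α → ℝ) (hf : ∀ x, 0 ≤ f x) :
    ∑ x ∈ s ∪ t, f x ≤ ∑ x ∈ s, f x + ∑ x ∈ t, f x := by
  rw [← Finset.sum_union_inter]
  have : 0 ≤ ∑ x ∈ s ∩ t, f x := Finset.sum_nonneg fun x _ => hf x
  linarith

lemma outN_inter {V : Type} (G : SimpleGraph V) (ρ : V → ℕ) (W W' : Finset V) (h : W' ⊆ W) (v : V) :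
    outN G ρ W v ∩ W' = outN G ρ W' v := by
  ext x
  simp only [outN, Finset.mem_inter, Finset.mem_filter]
  exact ⟨fun hx => ⟨hx.2, hx.1.2⟩, fun hx => ⟨⟨h hx.1, hx.2⟩, hx.1⟩⟩

lemma outN_mono {V : Type} (G : SimpleGraph V) (ρ : V → ℕ) {W W' : Finset V} (h : W' ⊆ W) (v : V) :
    outN G ρ W' v ⊆ outN G ρ W v := by
  rw [← outN_inter G ρ W W' h]; exact Finset.inter_subset_left

lemma outN_subset {V : Type} (G : SimpleGraph V) (ρ : V → ℕ) (W : Finset V) (v : V) :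
    outN G ρ W v ⊆ W := Finset.filter_subset _ _

lemma notMem_outN {V : Type} (G : SimpleGraph V) (ρ : V → ℕ) (W : Finset V) (v : V) :
    v ∉ outN G ρ W v := by
  intro h
  exact G.irrefl (Finset.mem_filter.1 h).2.1

lemma tail_bound (d : ℕ) (hd : 1 ≤ d) :
    (2 * d : ℝ) ^ (16 * d) / ((16 * d).factorial : ℝ) ≤ 1 / 20000 := by
  have h1 := Real.pow_div_factorial_le_exp (8 * d : ℝ) (by positivity) (16 * d)
  have h2 : (2 * d : ℝ) ^ (16 * d) / ((16 * d).factorial : ℝ) =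
      (1 / 16) ^ (8 * d) * ((8 * d : ℝ) ^ (16 * d) / ((16 * d).factorial : ℝ)) := by
    have : (2 * d : ℝ) = (1 / 4) * (8 * d) := by ring
    rw [this, mul_pow]
    have : ((1 : ℝ) / 4) ^ (16 * d) = (1 / 16) ^ (8 * d) := by
      rw [show 16 * d = 2 * (8 * d) by ring, pow_mul]; norm_num
    rw [this]; ring
  rw [h2]
  have h3 : Real.exp (8 * d : ℝ) = (Real.exp 1) ^ (8 * d) := by
    rw [← Real.exp_nat_mul]; push_cast; ring_nf
  rw [h3] at h1
  calc _ ≤ ((1 : ℝ) / 16) ^ (8 * d) * (Real.exp 1) ^ (8 * d) := by gcongr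
    _ = (Real.exp 1 / 16) ^ (8 * d) := by rw [← mul_pow]; ring_nf
    _ ≤ (1 / 5) ^ (8 * d) := by
        have := Real.exp_one_lt_d9
        refine pow_le_pow_left₀ (by positivity) ?_ _
        linarith
    _ ≤ (1 / 5) ^ (8 * 1) := pow_le_pow_of_le_one (by norm_num) (by norm_num) (by omega)
    _ ≤ _ := by norm_num

lemma stage1 {V : Type} [Fintype V] {G : SimpleGraph V} {g : ℕ → ℕ} {E s m : ℕ}
    (C : Ctx G g E s) (hm : TB G m) (ρ : V → ℕ) (W : Finset V) (hW : W.Nonempty) (D d : ℕ)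
    (hd : 1 ≤ d) (hO : ∀ v ∈ W, (outN G ρ W v).card ≤ D)
    (hsum : W.card * D ≤ 2 * ∑ v ∈ W, (outN G ρ W v).card)
    (hs : s ≤ 1000 * d ^ 2) (hD : (1000 * d ^ 2) ^ ((3 * m + 3) * E + 2 + 1) ≤ D) :
    ∃ W' ⊆ W, (∀ v ∈ W', Indep G (outN G ρ W' v)) ∧
      (∀ v ∈ W', (outN G ρ W' v).card ≤ 16 * d) ∧
      ((d : ℝ) / 4) * W'.card < ∑ v ∈ W', ((outN G ρ W' v).card : ℝ) := by
  set y := 1000 * d ^ 2 with hy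
  have hd2 : 1 ≤ d ^ 2 := Nat.one_le_pow _ _ hd
  have hy5 : 5 ≤ y := by omega
  set c0 := (3 * m + 3) * E + 2 with hc0
  have hpow : y * y ^ c0 ≤ D := by rw [← pow_succ']; exact hD
  have hpow1 : 1 ≤ y ^ c0 := Nat.one_le_pow _ _ (by omega)
  have hyD : y ≤ D := by nlinarith
  have hdD : d ≤ D := by nlinarith
  have hcD : y ^ c0 ≤ D := by nlinarith
  set q := D / d with hq
  have hq1 : 1 ≤ q := Nat.div_pos hdD hd
  have hqd : q * d ≤ D := Nat.div_mul_le_self D d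
  have hDq : D ≤ 2 * d * q := by
    have := Nat.lt_mul_div_succ D (show 0 < d by omega)
    rw [← hq] at this
    nlinarith
  set w : ℝ := 1 / (q : ℝ) with hw
  have hqpos : (0 : ℝ) < q := by positivity
  have hwpos : 0 < w := by positivity
  have hqw : (q : ℝ) * w = 1 := by rw [hw]; field_simp
  have hlo : (d : ℝ) ≤ D * w := by
    have h1 : (q : ℝ) * d ≤ D := by exact_mod_cast hqd
    have h2 := mul_le_mul_of_nonneg_right h1 hwpos.le
    nlinarith
  have hhi : (D : ℝ) * w ≤ 2 * d := by
    have h1 : (D : ℝ) ≤ 2 * d * q := by exact_mod_cast hDq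
    have h2 := mul_le_mul_of_nonneg_right h1 hwpos.le
    nlinarith
  have hd1 : (1 : ℝ) ≤ d := by exact_mod_cast hd
  let O := outN G ρ W
  let P : V → Finset (V × V) := fun v => (O v ×ˢ O v).filter (fun x => G.Adj x.1 x.2)
  let B : V → Finset (Finset V) := fun v =>
    (P v).image (fun x => {x.1, x.2}) ∪ (O v).powersetCard (16 * d)
  have hBsub : ∀ v, ∀ S ∈ B v, S ⊆ O v := by
    intro v S hS
    rcases Finset.mem_union.1 hS with h | h
    · obtain ⟨⟨a, b⟩, hx, rfl⟩ := Finset.mem_image.1 h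
      have := Finset.mem_product.1 (Finset.mem_filter.1 hx).1
      intro z hz
      simp only [Finset.mem_insert, Finset.mem_singleton] at hz
      rcases hz with rfl | rfl
      · exact this.1
      · exact this.2
    · exact (Finset.mem_powersetCard.1 h).1
  have hPc : ∀ v ∈ W, y * (P v).card ≤ 2 * D * D := by
    intro v hv
    have h1 : (P v).card = ∑ x ∈ O v, (nb G (O v) x).card := by
      simp only [P, nb, Finset.card_filter]
      rw [Finset.sum_product]
    have hOv : (O v).card ≤ D := hO v hv
    have hheavy := heavy_bound' C hm (O v) D y hOv hy5 hs hcD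
    rw [h1, Finset.mul_sum]
    calc _ ≤ ∑ x ∈ O v, (D + if x ∈ heavy G (O v) D y then y * D else 0) := by
          refine Finset.sum_le_sum fun x hx => ?_
          have h2 : (nb G (O v) x).card ≤ D := (Finset.card_filter_le _ _).trans hOv
          split_ifs with h
          · have := Nat.mul_le_mul_left y h2
            omega
          · simp only [heavy, Finset.mem_filter, Finset.mem_univ, true_and, not_le] at h
            omega
      _ = (O v).card * D + ((O v).filter (· ∈ heavy G (O v) D y)).card * (y * D) := by
          rw [Finset.sum_add_distrib, Finset.sum_const, smul_eq_mul, ← Finset.sum_filter,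
            Finset.sum_const, smul_eq_mul]
      _ ≤ D * D + y ^ c0 * (y * D) := by
          have : ((O v).filter (· ∈ heavy G (O v) D y)).card ≤ y ^ c0 :=
            le_trans (Finset.card_le_card (fun x hx => (Finset.mem_filter.1 hx).2)) hheavy
          gcongr
      _ = D * D + (y * y ^ c0) * D := by ring
      _ ≤ D * D + D * D := by gcongr
      _ = _ := by ring
  have hβ : ∀ v ∈ W, ∑ S ∈ B v, w ^ S.card * ((D : ℝ) * w + S.card) ≤ 0.04 * d := by
    intro v hv
    refine (sum_union_le' ((P v).image (fun x => ({x.1, x.2} : Finset V)))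
      ((O v).powersetCard (16 * d)) (fun S => w ^ S.card * ((D : ℝ) * w + S.card))
      (fun S => by positivity)).trans ?_
    have h1 : ∑ S ∈ (P v).image (fun x => ({x.1, x.2} : Finset V)), w ^ S.card * ((D : ℝ) * w + S.card) ≤
        0.032 * d := by
      have hc2 : ∀ S ∈ (P v).image (fun x => ({x.1, x.2} : Finset V)), S.card = 2 := by
        intro S hS
        obtain ⟨⟨a, b⟩, hx, rfl⟩ := Finset.mem_image.1 hS
        exact Finset.card_pair ((Finset.mem_filter.1 hx).2).ne
      calc _ = ∑ S ∈ (P v).image (fun x => ({x.1, x.2} : Finset V)), w ^ 2 * ((D : ℝ) * w + 2) := by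
            refine Finset.sum_congr rfl fun S hS => ?_
            rw [hc2 S hS]; norm_num
        _ = ((P v).image (fun x => ({x.1, x.2} : Finset V))).card * (w ^ 2 * ((D : ℝ) * w + 2)) := by
            rw [Finset.sum_const, nsmul_eq_mul]
        _ ≤ (P v).card * (w ^ 2 * ((D : ℝ) * w + 2)) := by
            have : ((P v).image (fun x => ({x.1, x.2} : Finset V))).card ≤ (P v).card :=
              Finset.card_image_le
            gcongr
        _ ≤ (P v).card * (w ^ 2 * (4 * d)) := by
            gcongr
            linarith
        _ ≤ 0.032 * d := by
            have h2 : (1000 * d ^ 2 : ℝ) * (P v).card ≤ 2 * D * D := by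
              have := hPc v hv
              rw [hy] at this
              exact_mod_cast this
            have h3 : ((D : ℝ) * w) ^ 2 ≤ (2 * d) ^ 2 := by gcongr
            have h4 : (1000 * d ^ 2 : ℝ) * ((P v).card * w ^ 2) ≤ 1000 * d ^ 2 * 0.008 := by
              calc _ = (1000 * d ^ 2 : ℝ) * (P v).card * w ^ 2 := by ring
                _ ≤ 2 * D * D * w ^ 2 := by gcongr
                _ = 2 * ((D : ℝ) * w) ^ 2 := by ring
                _ ≤ 2 * (2 * d) ^ 2 := by linarith
                _ = _ := by ring
            have h5 : ((P v).card : ℝ) * w ^ 2 ≤ 0.008 := le_of_mul_le_mul_left h4 (by positivity)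
            calc _ = ((P v).card : ℝ) * w ^ 2 * (4 * d) := by ring
              _ ≤ 0.008 * (4 * d) := by gcongr
              _ = _ := by ring
    have h2 : ∑ S ∈ (O v).powersetCard (16 * d), w ^ S.card * ((D : ℝ) * w + S.card) ≤
        0.001 * d := by
      calc _ = ∑ S ∈ (O v).powersetCard (16 * d), w ^ (16 * d) * ((D : ℝ) * w + 16 * d) := by
            refine Finset.sum_congr rfl fun S hS => ?_
            rw [(Finset.mem_powersetCard.1 hS).2]; push_cast; rfl
        _ = ((O v).card.choose (16 * d) : ℝ) * (w ^ (16 * d) * ((D : ℝ) * w + 16 * d)) := by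
            rw [Finset.sum_const, nsmul_eq_mul, Finset.card_powersetCard]
        _ ≤ ((D : ℝ) ^ (16 * d) / ((16 * d).factorial : ℝ)) * (w ^ (16 * d) * (18 * d)) := by
            have h3 : ((O v).card.choose (16 * d) : ℝ) ≤
                ((O v).card : ℝ) ^ (16 * d) / ((16 * d).factorial : ℝ) :=
              Nat.choose_le_pow_div _ _
            have h4 : ((O v).card : ℝ) ≤ D := by exact_mod_cast hO v hv
            have h5 : ((O v).card : ℝ) ^ (16 * d) / ((16 * d).factorial : ℝ) ≤
              (D : ℝ) ^ (16 * d) / ((16 * d).factorial : ℝ) := by gcongr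
            have h6 := h3.trans h5
            have h7 : (D : ℝ) * w + 16 * d ≤ 18 * d := by linarith
            gcongr
        _ = (((D : ℝ) * w) ^ (16 * d) / ((16 * d).factorial : ℝ)) * (18 * d) := by
            rw [mul_pow]; ring
        _ ≤ ((2 * d : ℝ) ^ (16 * d) / ((16 * d).factorial : ℝ)) * (18 * d) := by gcongr
        _ ≤ 1 / 20000 * (18 * d) := by
            have := tail_bound d hd
            gcongr
        _ ≤ 0.001 * d := by linarith
    linarith
  have hWc : (0 : ℝ) < W.card := by exact_mod_cast Finset.card_pos.2 hW
  obtain ⟨W', hW', hno, hbig⟩ := sampling W O (outN_subset G ρ W) (notMem_outN G ρ W) B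
    (fun v S hS hvS => notMem_outN G ρ W v (hBsub v S hS hvS)) q hq1 D (0.04 * d) (d / 4)
    (by have : 0 < D := by omega
        exact_mod_cast this)
    (fun v hv => by exact_mod_cast hO v hv) hβ (by positivity) (by
      have h1 : (W.card : ℝ) * D ≤ 2 * ∑ v ∈ W, ((O v).card : ℝ) := by exact_mod_cast hsum
      have h2 := mul_le_mul_of_nonneg_right h1 hwpos.le
      have h3 := mul_le_mul_of_nonneg_left hlo hWc.le
      have h4 : 0 < (d : ℝ) * W.card := by positivity
      nlinarith)
  refine ⟨W', hW', ?_, ?_, ?_⟩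
  · intro v hv a ha b hb hab
    refine hno v hv {a, b} (Finset.mem_union_left _ (Finset.mem_image.2 ⟨(a, b), ?_, rfl⟩)) ?_
    · exact Finset.mem_filter.2 ⟨Finset.mem_product.2
        ⟨outN_mono G ρ hW' v ha, outN_mono G ρ hW' v hb⟩, hab⟩
    · intro x hx
      simp only [Finset.mem_insert, Finset.mem_singleton] at hx
      rcases hx with rfl | rfl
      · exact outN_subset _ _ _ _ ha
      · exact outN_subset _ _ _ _ hb
  · intro v hv
    by_contra hc
    push Not at hc
    obtain ⟨T, hT, hTc⟩ := Finset.exists_subset_card_eq hc.le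
    refine hno v hv T (Finset.mem_union_right _ (Finset.mem_powersetCard.2
      ⟨hT.trans (outN_mono G ρ hW' v), hTc⟩)) (hT.trans (outN_subset _ _ _ _))
  · have : ∀ v, O v ∩ W' = outN G ρ W' v := fun v => outN_inter G ρ W W' hW' v
    simpa only [this] using hbig

lemma edges_le {V : Type} (G : SimpleGraph V) (ρ : V → ℕ) (k n : ℕ) : ∀ W : Finset V, W.card = n →
    (∀ W' ⊆ W, W'.Nonempty → ∃ w ∈ W', (nb G W' w).card ≤ k) →
    ∑ v ∈ W, (outN G ρ W v).card ≤ k * W.card := by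
  induction n with
  | zero =>
    intro W hW _
    rw [Finset.card_eq_zero] at hW
    simp [hW]
  | succ n ih =>
    intro W hW H
    obtain ⟨w, hw, hk⟩ := H W (Finset.Subset.refl _) (by rw [← Finset.card_pos]; omega)
    have hcard : (W.erase w).card = n := by rw [Finset.card_erase_of_mem hw]; omega
    have h1 := ih (W.erase w) hcard
      (fun W' hW' => H W' (hW'.trans (Finset.erase_subset _ _)))
    rw [← Finset.sum_erase_add _ _ hw]
    have h2 : ∀ v ∈ W.erase w, (outN G ρ W v).card =
        (outN G ρ (W.erase w) v).card + (if G.Adj v w ∧ ρ v < ρ w then 1 else 0) := by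
      intro v hv
      have hWi : W = insert w (W.erase w) := (Finset.insert_erase hw).symm
      conv_lhs => rw [hWi]
      unfold outN
      rw [Finset.filter_insert]
      split_ifs with h
      · rw [Finset.card_insert_of_notMem (by simp)]
      · rfl
    rw [Finset.sum_congr rfl h2, Finset.sum_add_distrib, ← Finset.card_filter]
    have h3 : ((W.erase w).filter (fun v => G.Adj v w ∧ ρ v < ρ w)).card + (outN G ρ W w).card ≤
        (nb G W w).card := by
      rw [← Finset.card_union_of_disjoint]
      · refine Finset.card_le_card ?_
        intro x hx
        rcases Finset.mem_union.1 hx with h | h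
        · have h' := Finset.mem_filter.1 h
          exact Finset.mem_filter.2 ⟨Finset.mem_of_mem_erase h'.1, h'.2.1.symm⟩
        · have h' := Finset.mem_filter.1 h
          exact Finset.mem_filter.2 ⟨h'.1, h'.2.1⟩
      · rw [Finset.disjoint_left]
        intro x hx hx'
        have h1 := (Finset.mem_filter.1 hx).2.2
        have h2 := (Finset.mem_filter.1 hx').2.2
        omega
    rw [hcard] at h1
    rw [hW, mul_add, mul_one]
    omega

lemma split_aux {V : Type} (ρ : V → ℕ) (hρ : Function.Injective ρ) (t r : ℕ) (A B : Finset V)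
    (hB : B.card = 2 * t) (hA : t ≤ (A.filter (fun a => ρ a < r + 1)).card)
    (hBr : (B.filter (fun b => ρ b < r)).card < t) :
    ∃ A' ⊆ A, ∃ B' ⊆ B, A'.card = t ∧ B'.card = t ∧ ∀ a ∈ A', ∀ b ∈ B', ρ a < ρ b := by
  obtain ⟨A', hA', hA'c⟩ := Finset.exists_subset_card_eq hA
  have h1 : (B.filter (fun b => ρ b < r + 1)).card ≤
      (B.filter (fun b => ρ b < r)).card + (B.filter (fun b => ρ b = r)).card := by
    refine (Finset.card_le_card ?_).trans (Finset.card_union_le _ _)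
    intro x hx
    simp only [Finset.mem_filter, Finset.mem_union] at hx ⊢
    rcases Nat.lt_succ_iff_lt_or_eq.1 hx.2 with h | h
    · exact Or.inl ⟨hx.1, h⟩
    · exact Or.inr ⟨hx.1, h⟩
  have h2 : (B.filter (fun b => ρ b = r)).card ≤ 1 := by
    rw [Finset.card_le_one]
    intro a ha b hb
    exact hρ ((Finset.mem_filter.1 ha).2.trans (Finset.mem_filter.1 hb).2.symm)
  have h3 := Finset.card_filter_add_card_filter_not (s := B) (fun b => ρ b < r + 1)
  obtain ⟨B', hB', hB'c⟩ := Finset.exists_subset_card_eq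
    (show t ≤ (B.filter (fun b => ¬ ρ b < r + 1)).card by omega)
  refine ⟨A', hA'.trans (Finset.filter_subset _ _), B', hB'.trans (Finset.filter_subset _ _),
    hA'c, hB'c, ?_⟩
  intro a ha b hb
  have := (Finset.mem_filter.1 (hA' ha)).2
  have := (Finset.mem_filter.1 (hB' hb)).2
  omega

lemma split_biclique {V : Type} (G : SimpleGraph V) (ρ : V → ℕ) (hρ : Function.Injective ρ)
    (t : ℕ) (ht : 1 ≤ t) (W A B : Finset V) (hAW : A ⊆ W) (hBW : B ⊆ W)
    (hA : A.card = 2 * t) (hB : B.card = 2 * t) (hAB : ∀ a ∈ A, ∀ b ∈ B, G.Adj a b) :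
    ∃ A' ⊆ W, ∃ B' ⊆ W, A'.card = t ∧ B'.card = t ∧
      ∀ a ∈ A', ∀ b ∈ B', G.Adj a b ∧ ρ a < ρ b := by
  have hex : ∃ r, t ≤ (A.filter (fun a => ρ a < r)).card ∨ t ≤ (B.filter (fun b => ρ b < r)).card := by
    refine ⟨(A.sup ρ) + 1, Or.inl ?_⟩
    rw [Finset.filter_true_of_mem]
    · omega
    · intro a ha
      exact Nat.lt_succ_of_le (Finset.le_sup ha)
  have hspec := Nat.find_spec hex
  obtain ⟨r, hr⟩ : ∃ r, Nat.find hex = r + 1 := by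
    refine Nat.exists_eq_succ_of_ne_zero fun h0 => ?_
    rw [h0] at hspec
    simp at hspec
    omega
  have hmin := Nat.find_min hex (m := r) (by omega)
  push Not at hmin
  rw [hr] at hspec
  rcases hspec with h | h
  · obtain ⟨A', hA', B', hB', h1, h2, h3⟩ := split_aux ρ hρ t r A B hB h hmin.2
    exact ⟨A', hA'.trans hAW, B', hB'.trans hBW, h1, h2,
      fun a ha b hb => ⟨hAB _ (hA' ha) _ (hB' hb), h3 a ha b hb⟩⟩
  · obtain ⟨A', hA', B', hB', h1, h2, h3⟩ := split_aux ρ hρ t r B A hA h hmin.1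
    exact ⟨A', hA'.trans hBW, B', hB'.trans hAW, h1, h2,
      fun a ha b hb => ⟨(hAB _ (hB' hb) _ (hA' ha)).symm, h3 a ha b hb⟩⟩

lemma sq_div_le_aux (a y : ℝ) (hy : 0 < y) (h : a ^ 2 ≤ y) : (a / y) ^ 2 ≤ 1 / y := by
  rw [div_pow, div_le_div_iff₀ (by positivity) hy]
  nlinarith

set_option maxHeartbeats 1000000 in
lemma stage2 {V : Type} [Fintype V] {G : SimpleGraph V} {g : ℕ → ℕ} {E s m : ℕ}
    (C : Ctx G g E s) (hm : TB G m) (ρ : V → ℕ) (hρ : Function.Injective ρ) (W : Finset V)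
    (c0 c1 t K y q d : ℕ) (hc0 : c0 = (3 * m + 3) * E + 2) (hc1 : c1 = ((c0 + 3) * m + 2) * E)
    (ht : t = 2 * (c1 + 1)) (hK : K = 8 * g (2 * t - 1) + 8) (hy1 : (16 * K) ^ 2 ≤ y)
    (hy2 : 24 * (33 * K + t) ≤ y) (hsy : s ≤ y) (hq : q = y ^ (c0 + 1)) (hd : d = q * K)
    (hind : ∀ v ∈ W, Indep G (outN G ρ W v)) (hO : ∀ v ∈ W, (outN G ρ W v).card ≤ 16 * d)
    (hbig : ((d : ℝ) / 4) * W.card < ∑ v ∈ W, ((outN G ρ W v).card : ℝ)) : False := by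
  have hK8 : 8 ≤ K := by omega
  have hy1R : ((16 : ℝ) * (K : ℝ)) ^ 2 ≤ (y : ℝ) := by
    have h := (Nat.cast_le (α := ℝ)).2 hy1
    rw [Nat.cast_pow, Nat.cast_mul] at h
    exact h
  have hy5 : 5 ≤ y := by omega
  have hK16 : 16 * K ≤ y := by nlinarith
  have hq1 : 1 ≤ q := by rw [hq]; exact Nat.one_le_pow _ _ (by omega)
  have hyc1 : 1 ≤ y ^ c0 := Nat.one_le_pow _ _ (by omega)
  have hqy : q = y ^ c0 * y := by rw [hq, pow_succ]
  have hycq : y ^ c0 ≤ q := by rw [hqy]; exact Nat.le_mul_of_pos_right _ (by omega)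
  have hycD : y ^ c0 ≤ 16 * d := by rw [hd]; nlinarith
  set Δ := 16 * d with hΔ
  have hΔq : Δ = 16 * K * q := by rw [hΔ, hd]; ring
  set w : ℝ := 1 / (q : ℝ) with hw
  have hqpos : (0 : ℝ) < q := by positivity
  have hypos : (0 : ℝ) < y := by positivity
  have hwpos : 0 < w := by positivity
  have hqw : (q : ℝ) * w = 1 := by rw [hw]; field_simp
  have hΔw : (Δ : ℝ) * w = 16 * K := by
    rw [hΔq]; push_cast
    rw [mul_assoc, hqw, mul_one]
  have hycw : (y : ℝ) ^ c0 * w * y = 1 := by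
    rw [← hqw, hqy]; push_cast; ring
  let O := outN G ρ W
  let Z : V → Finset V := fun v => heavy G (O v) Δ y
  let B1 : V → Finset (Finset V) := fun v => ((Z v).erase v).image (fun z => {z})
  let B2 : V → Finset (Finset V) := fun v =>
    ((O v).powersetCard t).filter (fun T => ∃ z ∈ W, z ∉ Z v ∧ T ⊆ nb G (O v) z)
  let B : V → Finset (Finset V) := fun v => B1 v ∪ B2 v
  have hBv : ∀ v, ∀ S ∈ B v, v ∉ S := by
    intro v S hS
    rcases Finset.mem_union.1 hS with h | h
    · obtain ⟨z, hz, rfl⟩ := Finset.mem_image.1 h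
      simpa using (Finset.ne_of_mem_erase hz).symm
    · intro hv
      exact notMem_outN G ρ W v ((Finset.mem_powersetCard.1 (Finset.mem_filter.1 h).1).1 hv)
  have hB1 : ∀ v ∈ W, ∑ S ∈ B1 v, w ^ S.card * ((Δ : ℝ) * w + S.card) ≤ 17 * K / y := by
    intro v hv
    have hZ : (Z v).card ≤ y ^ c0 := by
      have := heavy_bound' C hm (O v) Δ y (hO v hv) hy5 hsy (by rw [← hc0]; exact hycD)
      rwa [← hc0] at this
    have hB1c : (B1 v).card ≤ y ^ c0 :=
      (Finset.card_image_le.trans (Finset.card_le_card (Finset.erase_subset _ _))).trans hZ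
    have hB1c' : ((B1 v).card : ℝ) ≤ (y : ℝ) ^ c0 := by exact_mod_cast hB1c
    have hK1 : (1 : ℝ) ≤ K := by exact_mod_cast (show 1 ≤ K by omega)
    calc _ = ∑ S ∈ B1 v, w * (16 * K + 1) := by
          refine Finset.sum_congr rfl fun S hS => ?_
          obtain ⟨z, hz, rfl⟩ := Finset.mem_image.1 hS
          rw [hΔw]; simp
      _ = (B1 v).card * (w * (16 * K + 1)) := by rw [Finset.sum_const, nsmul_eq_mul]
      _ ≤ (y : ℝ) ^ c0 * (w * (17 * K)) := by
          refine mul_le_mul hB1c' (mul_le_mul_of_nonneg_left (by linarith) hwpos.le)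
            (mul_nonneg hwpos.le (by linarith)) (pow_nonneg hypos.le _)
      _ = ((y : ℝ) ^ c0 * w * y) * (17 * K) / y := by field_simp
      _ = _ := by rw [hycw, one_mul]
  have hB2 : ∀ v ∈ W, ∑ S ∈ B2 v, w ^ S.card * ((Δ : ℝ) * w + S.card) ≤ (16 * K + t) / y := by
    intro v hv
    have htr := trace_general C hm (W \ Z v) (O v) (hind v hv)
    set Tr := (W \ Z v).image (nb G (O v)) with hTr
    have hTrc : Tr.card ≤ y ^ c1 := by
      refine htr.trans ?_
      rw [hc1, pow_mul]
      refine Nat.pow_le_pow_left ?_ E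
      have h1 : (O v).card + 1 ≤ y ^ (c0 + 3) := by
        have h2 : (O v).card ≤ Δ := hO v hv
        have h3 : Δ ≤ y ^ (c0 + 2) := by
          rw [hΔq, hq, show c0 + 2 = (c0 + 1) + 1 by ring, pow_succ y (c0 + 1), mul_comm]
          exact Nat.mul_le_mul_left _ hK16
        have h4 : 1 ≤ y ^ (c0 + 2) := Nat.one_le_pow _ _ (by omega)
        have h5 : y ^ (c0 + 3) = y ^ (c0 + 2) * y := by rw [← pow_succ]
        rw [h5]
        nlinarith
      have h6 : ((O v).card + 1) ^ m ≤ y ^ ((c0 + 3) * m) := by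
        rw [pow_mul]; exact Nat.pow_le_pow_left h1 m
      have h7 : 1 ≤ y ^ ((c0 + 3) * m) := Nat.one_le_pow _ _ (by omega)
      calc _ ≤ y ^ ((c0 + 3) * m) + y := add_le_add h6 hsy
        _ ≤ y ^ ((c0 + 3) * m) * y + y ^ ((c0 + 3) * m) * y :=
            add_le_add (Nat.le_mul_of_pos_right _ (by omega)) (Nat.le_mul_of_pos_left _ (by omega))
        _ = y ^ ((c0 + 3) * m) * (2 * y) := by ring
        _ ≤ y ^ ((c0 + 3) * m) * y ^ 2 := Nat.mul_le_mul_left _ (by rw [pow_two]; gcongr; omega)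
        _ = _ := by rw [← pow_add]
    have hTrN : ∀ N ∈ Tr, (N.card : ℝ) * w ≤ 16 * K / y := by
      intro N hN
      obtain ⟨z, hz, rfl⟩ := Finset.mem_image.1 hN
      have h1 : z ∉ Z v := (Finset.mem_sdiff.1 hz).2
      simp only [Z, heavy, Finset.mem_filter, Finset.mem_univ, true_and, not_le] at h1
      have h2 : (y : ℝ) * (nb G (O v) z).card ≤ Δ := by exact_mod_cast h1.le
      rw [le_div_iff₀ hypos, ← hΔw]
      nlinarith
    have hsub : B2 v ⊆ Tr.biUnion (fun N => N.powersetCard t) := by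
      intro T hT
      obtain ⟨hT1, z, hzW, hzZ, hTz⟩ := Finset.mem_filter.1 hT
      refine Finset.mem_biUnion.2 ⟨nb G (O v) z, Finset.mem_image_of_mem _
        (Finset.mem_sdiff.2 ⟨hzW, hzZ⟩), Finset.mem_powersetCard.2 ⟨hTz, ?_⟩⟩
      exact (Finset.mem_powersetCard.1 hT1).2
    have hcount : ((B2 v).card : ℝ) * w ^ t ≤ 1 / y := by
      have h1 : (B2 v).card ≤ ∑ N ∈ Tr, N.card ^ t := by
        refine (Finset.card_le_card hsub).trans (Finset.card_biUnion_le.trans ?_)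
        refine Finset.sum_le_sum fun N _ => ?_
        rw [Finset.card_powersetCard]
        exact Nat.choose_le_pow _ _
      have h1' : ((B2 v).card : ℝ) ≤ ∑ N ∈ Tr, (N.card : ℝ) ^ t := by exact_mod_cast h1
      have hTrc' : (Tr.card : ℝ) ≤ (y : ℝ) ^ c1 := by exact_mod_cast hTrc
      have h2 : (16 * K / y : ℝ) ^ 2 ≤ 1 / y := by
        exact sq_div_le_aux _ _ hypos hy1R
      calc _ ≤ (∑ N ∈ Tr, (N.card : ℝ) ^ t) * w ^ t :=
            mul_le_mul_of_nonneg_right h1' (pow_nonneg hwpos.le _)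
        _ = ∑ N ∈ Tr, ((N.card : ℝ) * w) ^ t := by
            rw [Finset.sum_mul]; exact Finset.sum_congr rfl fun N _ => by rw [mul_pow]
        _ ≤ ∑ N ∈ Tr, (16 * K / y : ℝ) ^ t := by
            refine Finset.sum_le_sum fun N hN => ?_
            exact pow_le_pow_left₀ (mul_nonneg (Nat.cast_nonneg _) hwpos.le) (hTrN N hN) t
        _ = Tr.card * (16 * K / y : ℝ) ^ t := by rw [Finset.sum_const, nsmul_eq_mul]
        _ ≤ (y : ℝ) ^ c1 * (1 / y) ^ (c1 + 1) := by
            rw [ht, pow_mul]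
            exact mul_le_mul hTrc' (pow_le_pow_left₀ (sq_nonneg _) h2 _)
              (pow_nonneg (sq_nonneg _) _) (pow_nonneg hypos.le _)
        _ = 1 / y := by
            rw [pow_succ, ← mul_assoc, ← mul_pow, mul_one_div_cancel hypos.ne', one_pow, one_mul]
    calc _ = ∑ S ∈ B2 v, w ^ t * (16 * K + t) := by
          refine Finset.sum_congr rfl fun S hS => ?_
          rw [(Finset.mem_powersetCard.1 (Finset.mem_filter.1 hS).1).2, hΔw]
      _ = (B2 v).card * w ^ t * (16 * K + t) := by rw [Finset.sum_const, nsmul_eq_mul]; ring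
      _ ≤ 1 / y * (16 * K + t) := mul_le_mul_of_nonneg_right hcount
          (add_nonneg (mul_nonneg (by norm_num) (Nat.cast_nonneg _)) (Nat.cast_nonneg _))
      _ = _ := by ring
  have hβ : ∀ v ∈ W, ∑ S ∈ B v, w ^ S.card * ((Δ : ℝ) * w + S.card) ≤ 1 / 24 := by
    intro v hv
    refine (sum_union_le' (B1 v) (B2 v) (fun S => w ^ S.card * ((Δ : ℝ) * w + S.card))
      (fun S => mul_nonneg (pow_nonneg hwpos.le _)
        (add_nonneg (mul_nonneg (Nat.cast_nonneg _) hwpos.le) (Nat.cast_nonneg _)))).trans ?_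
    have h1 := hB1 v hv
    have h2 := hB2 v hv
    have h3 : (17 * K / y + (16 * K + t) / y : ℝ) ≤ 1 / 24 := by
      rw [← add_div, div_le_div_iff₀ hypos (by norm_num)]
      have : (24 * (33 * K + t) : ℝ) ≤ y := by exact_mod_cast hy2
      linarith
    linarith
  have hΔpos : (0 : ℝ) < Δ := by
    have : 0 < Δ := by omega
    exact_mod_cast this
  have hK1 : (8 : ℝ) ≤ K := by exact_mod_cast hK8
  obtain ⟨W', hW', hno, hgt⟩ := sampling W O (outN_subset G ρ W) (notMem_outN G ρ W) B
    hBv q hq1 Δ (1 / 24) (K / 8) hΔpos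
    (fun v hv => by exact_mod_cast hO v hv) hβ (div_nonneg (Nat.cast_nonneg _) (by norm_num)) (by
      have h2 := mul_lt_mul_of_pos_right hbig hwpos
      have h3 : (d : ℝ) * w = K := by
        rw [hd]; push_cast
        rw [mul_right_comm, hqw, one_mul]
      have h4 : (d : ℝ) / 4 * W.card * w = K / 4 * W.card := by rw [← h3]; ring
      rw [h4] at h2
      have h5 : (0 : ℝ) ≤ W.card := Nat.cast_nonneg _
      refine lt_of_le_of_lt (mul_le_mul_of_nonneg_right ?_ h5) h2
      linarith)
  have hfree : ∀ W3 ⊆ W', W3.Nonempty → ∃ x ∈ W3, (nb G W3 x).card ≤ g (2 * t - 1) := by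
    intro W3 hW3 hne
    refine C.hdeg W3 hne (2 * t - 1) ?_
    intro A Bs hA hBs hAc hBc hAB
    obtain ⟨A', hA', B', hB', hA'c, hB'c, hlt⟩ := split_biclique G ρ hρ t (by omega) W' A Bs
      (hA.trans hW3) (hBs.trans hW3) (by omega) (by omega) hAB
    obtain ⟨v, hv, v', hv', hne'⟩ := Finset.one_lt_card.1 (show 1 < A'.card by omega)
    have hvW := hA' hv
    have hv'W := hA' hv'
    have hv'Z : v' ∉ Z v := by
      intro hz
      refine hno v hvW {v'} (Finset.mem_union_left _ (Finset.mem_image.2 ⟨v', ?_, rfl⟩))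
        (Finset.singleton_subset_iff.2 hv'W)
      exact Finset.mem_erase.2 ⟨hne'.symm, hz⟩
    have hB'O : B' ⊆ O v := fun b hb =>
      Finset.mem_filter.2 ⟨hW' (hB' hb), hlt v hv b hb⟩
    refine hno v hvW B' (Finset.mem_union_right _ (Finset.mem_filter.2
      ⟨Finset.mem_powersetCard.2 ⟨hB'O, hB'c⟩, v', hW' hv'W, hv'Z, ?_⟩)) hB'
    intro b hb
    exact Finset.mem_filter.2 ⟨hB'O hb, (hlt v' hv' b hb).1⟩
  have hle := edges_le G ρ (g (2 * t - 1)) W'.card W' rfl hfree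
  have : ∀ v, O v ∩ W' = outN G ρ W' v := fun v => outN_inter G ρ W W' hW' v
  simp only [this] at hgt
  have hle' : ∑ v ∈ W', ((outN G ρ W' v).card : ℝ) ≤ g (2 * t - 1) * W'.card := by
    exact_mod_cast hle
  have hK' : (K : ℝ) = 8 * g (2 * t - 1) + 8 := by rw [hK]; push_cast; rfl
  have h5 : (0 : ℝ) ≤ W'.card := Nat.cast_nonneg _
  rw [hK'] at hgt
  nlinarith

lemma degeneracy_order {V : Type} (G : SimpleGraph V) (D n : ℕ)
    (H : ∀ W : Finset V, W.Nonempty → ∃ w ∈ W, (nb G W w).card ≤ D) :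
    ∀ W : Finset V, W.card = n → ∃ ρ : V → ℕ, Set.InjOn ρ W ∧
      ∀ v ∈ W, (outN G ρ W v).card ≤ D := by
  induction n with
  | zero =>
    intro W hW
    rw [Finset.card_eq_zero] at hW
    subst hW
    exact ⟨fun _ => 0, by simp, by simp⟩
  | succ n ih =>
    intro W hW
    obtain ⟨w, hw, hk⟩ := H W (by rw [← Finset.card_pos]; omega)
    obtain ⟨ρ, hinj, hρ⟩ := ih (W.erase w) (by rw [Finset.card_erase_of_mem hw]; omega)
    refine ⟨fun v => if v = w then 0 else ρ v + 1, ?_, ?_⟩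
    · intro a ha b hb hab
      simp only at hab
      by_cases haw : a = w
      · by_cases hbw : b = w
        · rw [haw, hbw]
        · simp [haw, hbw] at hab
      · by_cases hbw : b = w
        · simp [haw, hbw] at hab
        · simp only [haw, hbw, if_false, add_left_inj] at hab
          exact hinj (by simpa [haw] using ha) (by simpa [hbw] using hb) hab
    · intro v hv
      by_cases hvw : v = w
      · subst hvw
        refine le_trans (Finset.card_le_card ?_) hk
        intro x hx
        have := Finset.mem_filter.1 hx
        exact Finset.mem_filter.2 ⟨this.1, this.2.1⟩
      · refine le_trans (Finset.card_le_card ?_) (hρ v (Finset.mem_erase.2 ⟨hvw, hv⟩))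
        intro x hx
        obtain ⟨h1, h2, h3⟩ := Finset.mem_filter.1 hx
        simp only [hvw, if_false] at h3
        by_cases hxw : x = w
        · simp [hxw] at h3
        · simp only [hxw, if_false] at h3
          exact Finset.mem_filter.2 ⟨Finset.mem_erase.2 ⟨hxw, h1⟩, h2, by omega⟩

lemma sum_nb {V : Type} (G : SimpleGraph V) (ρ : V → ℕ) (hρ : Function.Injective ρ)
    (W : Finset V) : ∑ v ∈ W, (nb G W v).card ≤ 2 * ∑ v ∈ W, (outN G ρ W v).card := by
  have h1 : ∀ v, (nb G W v).card ≤ (outN G ρ W v).card +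
      (W.filter (fun u => G.Adj u v ∧ ρ u < ρ v)).card := by
    intro v
    refine (Finset.card_le_card ?_).trans (Finset.card_union_le _ _)
    intro x hx
    obtain ⟨hxW, hadj⟩ := Finset.mem_filter.1 hx
    rcases lt_trichotomy (ρ v) (ρ x) with h | h | h
    · exact Finset.mem_union_left _ (Finset.mem_filter.2 ⟨hxW, hadj, h⟩)
    · exact absurd (hρ h) hadj.ne
    · exact Finset.mem_union_right _ (Finset.mem_filter.2 ⟨hxW, hadj.symm, h⟩)
  have h2 : ∑ v ∈ W, (W.filter (fun u => G.Adj u v ∧ ρ u < ρ v)).card =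
      ∑ v ∈ W, (outN G ρ W v).card := by
    simp only [outN, Finset.card_filter]
    exact Finset.sum_comm
  calc _ ≤ _ := Finset.sum_le_sum fun v _ => h1 v
    _ = _ := by rw [Finset.sum_add_distrib, h2, two_mul]

lemma core (g : ℕ → ℕ) (E : ℕ) : ∃ K Y a b : ℕ, ∀ (V : Type) [Fintype V] [Nonempty V]
    (G : SimpleGraph V) (s : ℕ), Ctx G g E s →
    ∃ w : V, (nb G Finset.univ w).card ≤ (1000 * (K * (Y + s) ^ a) ^ 2) ^ b := by
  obtain ⟨m, hm⟩ := trace_bound g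
  obtain ⟨c0, hc0⟩ : ∃ c0, c0 = (3 * m + 3) * E + 2 := ⟨_, rfl⟩
  obtain ⟨c1, hc1⟩ : ∃ c1, c1 = ((c0 + 3) * m + 2) * E := ⟨_, rfl⟩
  obtain ⟨t, ht⟩ : ∃ t, t = 2 * (c1 + 1) := ⟨_, rfl⟩
  obtain ⟨K, hK⟩ : ∃ K, K = 8 * g (2 * t - 1) + 8 := ⟨_, rfl⟩
  refine ⟨K, (16 * K) ^ 2 + 24 * (33 * K + t), c0 + 1, c0 + 1, ?_⟩
  intro V _ _ G s C
  set y := (16 * K) ^ 2 + 24 * (33 * K + t) + s with hy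
  have hTB : TB G m := fun A B hA hB => hm V G E s C A B hA hB
  let P : ℕ → Prop := fun k => ∃ W : Finset V, W.Nonempty ∧ ∀ w ∈ W, k ≤ (nb G W w).card
  have hP0 : P 0 := ⟨Finset.univ, Finset.univ_nonempty, by simp⟩
  obtain ⟨D, hPD, hmax⟩ : ∃ D, P D ∧ ¬ P (D + 1) := by
    by_contra hcon
    push Not at hcon
    have hall : ∀ k, P k := fun k => Nat.rec hP0 (fun k hk => hcon k hk) k
    obtain ⟨W, ⟨w, hw⟩, h⟩ := hall (Fintype.card V + 1)
    have h1 := h w hw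
    have h2 : (nb G W w).card ≤ Fintype.card V := Finset.card_le_univ _
    omega
  have hdeg : ∀ W : Finset V, W.Nonempty → ∃ w ∈ W, (nb G W w).card ≤ D := by
    intro W hW
    by_contra hcon
    push Not at hcon
    exact hmax ⟨W, hW, fun w hw => hcon w hw⟩
  obtain ⟨ρ, hinj, hρ⟩ := degeneracy_order G D _ hdeg Finset.univ rfl
  have hρi : Function.Injective ρ := fun a b hab => hinj (by simp) (by simp) hab
  obtain ⟨W, hW, hWD⟩ := hPD
  obtain ⟨w, -, hw⟩ := hdeg Finset.univ Finset.univ_nonempty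
  refine ⟨w, hw.trans ?_⟩
  by_contra hbig
  push Not at hbig
  obtain ⟨d, hd⟩ : ∃ d, d = y ^ (c0 + 1) * K := ⟨_, rfl⟩
  have hy1 : 1 ≤ y := by omega
  have hyq : y ≤ y ^ (c0 + 1) := Nat.le_self_pow (by omega) y
  have hyd : y ≤ d := by rw [hd]; nlinarith
  have hd2 : d ≤ d ^ 2 := Nat.le_self_pow (by omega) d
  obtain ⟨W', hW', h1, h2, h3⟩ := stage1 C hTB ρ W hW D d (by omega)
    (fun v _ => (Finset.card_le_card (outN_mono G ρ (Finset.subset_univ W) v)).trans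
      (hρ v (Finset.mem_univ v)))
    (by
      refine le_trans ?_ (sum_nb G ρ hρi W)
      rw [← smul_eq_mul, ← Finset.sum_const]
      exact Finset.sum_le_sum hWD)
    (by omega) (by rw [← hc0, hd, mul_comm _ K]; exact hbig.le)
  exact stage2 C hTB ρ hρi W' c0 c1 t K y (y ^ (c0 + 1)) d hc0 hc1 ht hK (by omega) (by omega)
    (by omega) rfl hd h1 h2 h3

/-- The set whose supremum is the induced biclique number. -/
def indSet {V : Type} [Fintype V] (G : SimpleGraph V) : Set ℕ :=
  {s | ∃ A : Set V,
    Nonempty (G.induce A ≃g (⊤ : SimpleGraph (Fin s))) ∨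
    Nonempty (G.induce A ≃g completeBipartiteGraph (Fin s) (Fin s))}

lemma indSet_bdd {V : Type} [Fintype V] (G : SimpleGraph V) : BddAbove (indSet G) := by
  refine ⟨Fintype.card V, ?_⟩
  rintro s ⟨A, hA | hA⟩
  · obtain ⟨e⟩ := hA
    have h := Fintype.card_le_of_injective (fun i : Fin s => (e.symm i : V))
      (Subtype.val_injective.comp e.symm.injective)
    simpa using h
  · obtain ⟨e⟩ := hA
    have h := Fintype.card_le_of_injective (fun i : Fin s => (e.symm (Sum.inl i) : V))
      (Subtype.val_injective.comp (e.symm.injective.comp Sum.inl_injective))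
    simpa using h

lemma le_indBicliqueNum_of_clique {V : Type} [Fintype V] (G : SimpleGraph V) (A : Finset V)
    (hA : (A : Set V).Pairwise G.Adj) : A.card ≤ indBicliqueNum G := by
  refine le_csSup (indSet_bdd G) ⟨A, Or.inl ⟨?_⟩⟩
  have e : (A : Set V) ≃ Fin A.card := A.equivFin
  refine ⟨e, ?_⟩
  intro a b
  simp only [SimpleGraph.top_adj, SimpleGraph.comap_adj, ne_eq, EmbeddingLike.apply_eq_iff_eq,
    Function.Embedding.subtype_apply]
  constructor
  · intro h
    exact hA a.2 b.2 (fun h' => h (Subtype.ext h'))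
  · intro h h'
    subst h'
    exact G.irrefl h

lemma le_indBicliqueNum_of_biclique {V : Type} [Fintype V] (G : SimpleGraph V) (A B : Finset V)
    (l : ℕ) (hAc : A.card = l) (hBc : B.card = l) (hA : Indep G A) (hB : Indep G B)
    (hAB : ∀ a ∈ A, ∀ b ∈ B, G.Adj a b) : l ≤ indBicliqueNum G := by
  have eA : Fin l ≃ A := (finCongr hAc.symm).trans A.equivFin.symm
  have eB : Fin l ≃ B := (finCongr hBc.symm).trans B.equivFin.symm
  let φ : Fin l ⊕ Fin l → V := Sum.elim (fun i => (eA i : V)) (fun i => (eB i : V))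
  have hφ : Function.Injective φ := by
    intro x y hxy
    rcases x with i | i <;> rcases y with j | j
    · simp only [φ, Sum.elim_inl] at hxy
      rw [eA.injective (Subtype.ext hxy)]
    · simp only [φ, Sum.elim_inl, Sum.elim_inr] at hxy
      have := hAB _ (eA i).2 _ (eB j).2
      rw [hxy] at this
      exact absurd this (G.irrefl)
    · simp only [φ, Sum.elim_inl, Sum.elim_inr] at hxy
      have := hAB _ (eA j).2 _ (eB i).2
      rw [hxy] at this
      exact absurd this (G.irrefl)
    · simp only [φ, Sum.elim_inr] at hxy
      rw [eB.injective (Subtype.ext hxy)]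
  refine le_csSup (indSet_bdd G) ⟨Set.range φ, Or.inr ⟨RelIso.symm ⟨Equiv.ofInjective φ hφ, ?_⟩⟩⟩
  intro x y
  simp only [SimpleGraph.comap_adj, Function.Embedding.subtype_apply, Equiv.ofInjective_apply]
  rcases x with i | i <;> rcases y with j | j
  · simpa [φ] using hA _ (eA i).2 _ (eA j).2
  · simpa [φ] using hAB _ (eA i).2 _ (eB j).2
  · simpa [φ] using (hAB _ (eA j).2 _ (eB i).2).symm
  · simpa [φ] using hB _ (eB i).2 _ (eB j).2

/-- Homogeneous sets. -/
def HomSet {V : Type} (G : SimpleGraph V) (S : Finset V) : Prop :=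
  (S : Set V).Pairwise G.Adj ∨ (S : Set V).Pairwise fun a b => ¬ G.Adj a b

lemma exists_hom_indBicliqueNum {V : Type} [Fintype V] (G : SimpleGraph V) :
    ∃ S : Finset V, S.card = indBicliqueNum G ∧ HomSet G S := by
  have hne : (indSet G).Nonempty := by
    refine ⟨0, ∅, Or.inl ⟨⟨Equiv.equivOfIsEmpty _ _, ?_⟩⟩⟩
    intro a
    exact a.2.elim
  obtain ⟨A, hA | hA⟩ := Nat.sSup_mem hne (indSet_bdd G)
  · obtain ⟨e⟩ := hA
    have hinj : Function.Injective (fun i => (e.symm i : V)) :=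
      Subtype.val_injective.comp e.symm.injective
    refine ⟨Finset.univ.image (fun i => (e.symm i : V)), ?_, Or.inl ?_⟩
    · rw [Finset.card_image_of_injective _ hinj]
      exact Finset.card_fin _
    · intro a ha b hb hab
      simp only [Finset.coe_image, Finset.coe_univ, Set.image_univ, Set.mem_range] at ha hb
      obtain ⟨i, rfl⟩ := ha
      obtain ⟨j, rfl⟩ := hb
      have h := (e.symm.map_rel_iff (a := i) (b := j)).2 (by
        rw [SimpleGraph.top_adj]; rintro rfl; exact hab rfl)
      exact h
  · obtain ⟨e⟩ := hA
    have hinj : Function.Injective (fun i => (e.symm (Sum.inl i) : V)) :=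
      Subtype.val_injective.comp (e.symm.injective.comp Sum.inl_injective)
    refine ⟨Finset.univ.image (fun i => (e.symm (Sum.inl i) : V)), ?_, Or.inr ?_⟩
    · rw [Finset.card_image_of_injective _ hinj]
      exact Finset.card_fin _
    · intro a ha b hb hab
      simp only [Finset.coe_image, Finset.coe_univ, Set.image_univ, Set.mem_range] at ha hb
      obtain ⟨i, rfl⟩ := ha
      obtain ⟨j, rfl⟩ := hb
      intro hadj
      have h := (e.symm.map_rel_iff (a := Sum.inl i) (b := Sum.inl j)).1 hadj
      simp at h

lemma exists_nb_le_minDeg {V : Type} [Fintype V] (G : SimpleGraph V) (W : Finset V)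
    (hW : W.Nonempty) (inst : Fintype (W : Set V)) :
    ∃ w ∈ W, (nb G W w).card ≤ minDeg (G.induce (W : Set V)) := by
  have : Nonempty (W : Set V) := ⟨⟨hW.choose, hW.choose_spec⟩⟩
  obtain ⟨w, hw⟩ := (G.induce (W : Set V)).exists_minimal_degree_vertex
  refine ⟨w, w.2, ?_⟩
  have hw2 : minDeg (G.induce (W : Set V)) = (G.induce (W : Set V)).degree w := by
    unfold minDeg
    convert hw
  rw [hw2, ← SimpleGraph.card_neighborFinset_eq_degree]
  have hsub : nb G W w ⊆ ((G.induce (W : Set V)).neighborFinset w).map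
      (Function.Embedding.subtype _) := by
    intro x hx
    obtain ⟨h1, h2⟩ := Finset.mem_filter.1 hx
    refine Finset.mem_map.2 ⟨⟨x, h1⟩, ?_, rfl⟩
    rw [SimpleGraph.mem_neighborFinset]
    exact h2
  have := Finset.card_le_card hsub
  rwa [Finset.card_map] at this

lemma minDeg_le_nb {V : Type} [Fintype V] (G : SimpleGraph V) (w : V) :
    minDeg G ≤ (nb G Finset.univ w).card := by
  refine (G.minDegree_le_degree w).trans (le_of_eq ?_)
  rw [← SimpleGraph.card_neighborFinset_eq_degree]
  congr 1
  ext x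
  simp [nb]

lemma F_induce {F : GraphClass} (hF : Hereditary F) {V : Type} [Fintype V] {G : SimpleGraph V}
    (hG : F V G) (W : Finset V) (hW : W.Nonempty) (inst : Fintype (W : Set V)) :
    F (W : Set V) (G.induce (W : Set V)) := by
  have h := hF.2 V G (W : Set V) (by simpa using hW) hG
  convert h

lemma biclique_of_num {V : Type} [Fintype V] (G : SimpleGraph V) :
    HasBicliqueSub G (bicliqueNum G) := by
  have hne : {t | HasBicliqueSub G t}.Nonempty := ⟨0, ∅, ∅, by simp⟩
  have hb : BddAbove {t | HasBicliqueSub G t} := by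
    refine ⟨Fintype.card V, ?_⟩
    rintro t ⟨A, B, -, hA, -⟩
    rw [← hA]
    exact Finset.card_le_univ A
  exact Nat.sSup_mem hne hb

lemma EH_hom {F : GraphClass} (hF : Hereditary F) (h : HasEH F) : ∃ E : ℕ, 1 ≤ E ∧
    ∀ (V : Type) [Fintype V] (G : SimpleGraph V), F V G → ∀ (W : Finset V) (l : ℕ), 1 ≤ l →
      l ^ E ≤ W.card → ∃ I ⊆ W, I.card = l ∧ ((I : Set V).Pairwise G.Adj ∨ Indep G I) := by
  obtain ⟨ε, hε, h⟩ := h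
  have hpos : 0 < ⌈1 / ε⌉₊ := Nat.ceil_pos.2 (by positivity)
  refine ⟨⌈1 / ε⌉₊, hpos, ?_⟩
  intro V _ G hG W l hl hW
  set E := ⌈1 / ε⌉₊ with hE
  have hWc : 0 < W.card := lt_of_lt_of_le (Nat.pos_of_ne_zero (by positivity)) hW
  have hWn := Finset.card_pos.1 hWc
  have : Nonempty (W : Set V) := ⟨⟨hWn.choose, hWn.choose_spec⟩⟩
  obtain ⟨S, hSc, hS⟩ := h (W : Set V) (G.induce (W : Set V)) (F_induce hF hG W hWn _)
  have hcard : Fintype.card (W : Set V) = W.card := by simp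
  rw [hcard] at hSc
  have hEε : 1 ≤ (E : ℝ) * ε := by
    have := Nat.le_ceil (1 / ε)
    rw [← hE, div_le_iff₀ hε] at this
    exact this
  have hl1 : (1 : ℝ) ≤ l := by exact_mod_cast hl
  have hlS : (l : ℝ) ≤ S.card := by
    refine le_trans ?_ hSc
    calc (l : ℝ) = (l : ℝ) ^ (1 : ℝ) := (Real.rpow_one _).symm
      _ ≤ (l : ℝ) ^ ((E : ℝ) * ε) := Real.rpow_le_rpow_of_exponent_le hl1 hEε
      _ = ((l : ℝ) ^ E) ^ ε := by rw [Real.rpow_mul (by positivity), Real.rpow_natCast]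
      _ ≤ (W.card : ℝ) ^ ε := Real.rpow_le_rpow (by positivity) (by exact_mod_cast hW) hε.le
  obtain ⟨T, hTS, hTc⟩ := Finset.exists_subset_card_eq (show l ≤ S.card by exact_mod_cast hlS)
  refine ⟨T.map (Function.Embedding.subtype _), ?_, by rw [Finset.card_map, hTc], ?_⟩
  · intro x hx
    obtain ⟨z, hz, rfl⟩ := Finset.mem_map.1 hx
    exact z.2
  · rcases hS with hS | hS
    · left
      intro a ha b hb hab
      obtain ⟨x, hx, rfl⟩ := Finset.mem_map.1 ha
      obtain ⟨y, hy, rfl⟩ := Finset.mem_map.1 hb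
      exact hS (hTS hx) (hTS hy) (fun h => hab (by rw [h]))
    · right
      intro a ha b hb hab
      obtain ⟨x, hx, rfl⟩ := Finset.mem_map.1 ha
      obtain ⟨y, hy, rfl⟩ := Finset.mem_map.1 hb
      refine hS (hTS hx) (hTS hy) (fun h => ?_) hab
      subst h
      exact G.irrefl hab

lemma forward_dir (F : GraphClass) (hF : Hereditary F)
    (hDB : ∃ f : ℕ → ℕ, ∀ (V : Type) [Fintype V] (G : SimpleGraph V),
        F V G → minDeg G ≤ f (bicliqueNum G)) (hEH : HasEH F) :
    ∃ p : Polynomial ℕ, ∀ (V : Type) [Fintype V] (G : SimpleGraph V),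
        F V G → minDeg G ≤ p.eval (indBicliqueNum G) := by
  obtain ⟨f, hf⟩ := hDB
  obtain ⟨E, hE1, hE⟩ := EH_hom hF hEH
  let g : ℕ → ℕ := fun t => (Finset.range (t + 1)).sup f
  obtain ⟨K, Y, a, b, hcore⟩ := core g E
  refine ⟨(1000 * (Polynomial.C K * (Polynomial.C Y + (Polynomial.X + 1) ^ E) ^ a) ^ 2) ^ b, ?_⟩
  intro V _ G hG
  rcases isEmpty_or_nonempty V with hV | hV
  · have : minDeg G = 0 := by
      unfold minDeg
      exact SimpleGraph.minDegree_of_subsingleton _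
    rw [this]; exact Nat.zero_le _
  set τ := indBicliqueNum G with hτ
  have hnoclique : ∀ I : Finset V, τ + 1 ≤ I.card → ¬ (I : Set V).Pairwise G.Adj := by
    intro I hI hc
    have := le_indBicliqueNum_of_clique G I hc
    omega
  have hs1 : τ + 1 ≤ (τ + 1) ^ E := Nat.le_self_pow (by omega) _
  have C : Ctx G g E ((τ + 1) ^ E) := by
    refine ⟨?_, ?_, ?_, by omega, hE1⟩
    · intro W hW t hno
      obtain ⟨w, hw, hle⟩ := exists_nb_le_minDeg G W hW inferInstance
      refine ⟨w, hw, hle.trans ((hf _ _ (F_induce hF hG W hW _)).trans ?_)⟩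
      refine Finset.le_sup (f := f) ?_
      rw [Finset.mem_range]
      by_contra hcon
      push Not at hcon
      obtain ⟨A, B, -, hA, hB, hAB⟩ := biclique_of_num (G.induce (W : Set V))
      obtain ⟨A', hA', hA'c⟩ := Finset.exists_subset_card_eq (hcon.trans hA.ge)
      obtain ⟨B', hB', hB'c⟩ := Finset.exists_subset_card_eq (hcon.trans hB.ge)
      refine hno (A'.map (Function.Embedding.subtype _)) (B'.map (Function.Embedding.subtype _))
        ?_ ?_ (by rw [Finset.card_map, hA'c]) (by rw [Finset.card_map, hB'c]) ?_
      · intro x hx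
        obtain ⟨z, hz, rfl⟩ := Finset.mem_map.1 hx
        exact z.2
      · intro x hx
        obtain ⟨z, hz, rfl⟩ := Finset.mem_map.1 hx
        exact z.2
      · intro x0 hx0 y0 hy0
        obtain ⟨x, hx, rfl⟩ := Finset.mem_map.1 hx0
        obtain ⟨y, hy, rfl⟩ := Finset.mem_map.1 hy0
        exact hAB x (hA' hx) y (hB' hy)
    · intro W l hl hW
      obtain ⟨I, hI, hIc, h⟩ := hE V G hG W l (by omega) hW
      exact ⟨I, hI, hIc, h.resolve_left (hnoclique I (by omega))⟩
    · intro A B hA hB hAB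
      obtain ⟨I, hI, hIc, h1⟩ := hE V G hG A (τ + 1) (by omega) hA.ge
      obtain ⟨J, hJ, hJc, h2⟩ := hE V G hG B (τ + 1) (by omega) hB.ge
      have := le_indBicliqueNum_of_biclique G I J (τ + 1) hIc hJc
        (h1.resolve_left (hnoclique I (by omega))) (h2.resolve_left (hnoclique J (by omega)))
        (fun a ha b hb => hAB a (hI ha) b (hJ hb))
      omega
  obtain ⟨w, hw⟩ := hcore V G _ C
  refine (minDeg_le_nb G w).trans (hw.trans (le_of_eq ?_))
  simp

lemma greedy_indep {V : Type} (G : SimpleGraph V) (k n : ℕ)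
    (H : ∀ W : Finset V, W.Nonempty → ∃ w ∈ W, (nb G W w).card ≤ k) :
    ∀ W : Finset V, W.card ≤ n → ∃ I ⊆ W, Indep G I ∧ W.card ≤ (k + 1) * I.card := by
  induction n with
  | zero =>
    intro W hW
    exact ⟨∅, by simp, by simp [Indep], by omega⟩
  | succ n ih =>
    intro W hW
    rcases W.eq_empty_or_nonempty with rfl | hne
    · exact ⟨∅, by simp, by simp [Indep], by simp⟩
    obtain ⟨w, hw, hk⟩ := H W hne
    have hsub : insert w (nb G W w) ⊆ W :=
      Finset.insert_subset hw (Finset.filter_subset _ _)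
    have hc := Finset.card_sdiff_add_card_eq_card hsub
    have hwn : w ∉ nb G W w := fun h => G.irrefl (Finset.mem_filter.1 h).2
    rw [Finset.card_insert_of_notMem hwn] at hc
    obtain ⟨I, hI, hInd, hIc⟩ := ih (W \ insert w (nb G W w)) (by omega)
    have hnadj : ∀ b ∈ I, ¬ G.Adj w b := by
      intro b hb hadj
      have h := Finset.mem_sdiff.1 (hI hb)
      exact h.2 (Finset.mem_insert_of_mem (Finset.mem_filter.2 ⟨h.1, hadj⟩))
    have hwI : w ∉ I := fun h => (Finset.mem_sdiff.1 (hI h)).2 (Finset.mem_insert_self _ _)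
    refine ⟨insert w I, Finset.insert_subset hw (hI.trans Finset.sdiff_subset), ?_, ?_⟩
    · intro a ha b hb
      rcases Finset.mem_insert.1 ha with h1 | h1
      · rcases Finset.mem_insert.1 hb with h2 | h2
        · rw [h1, h2]
          exact G.irrefl
        · rw [h1]
          exact hnadj b h2
      · rcases Finset.mem_insert.1 hb with h2 | h2
        · rw [h2]
          exact fun h => hnadj a h1 h.symm
        · exact hInd a h1 b h2
    · rw [Finset.card_insert_of_notMem hwI, mul_add, mul_one]
      omega

lemma poly_bound (p : Polynomial ℕ) (x y : ℕ) (hxy : x ≤ y) (hy : 1 ≤ y) :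
    p.eval x ≤ p.eval 1 * y ^ p.natDegree := by
  rw [Polynomial.eval_eq_sum_range, Polynomial.eval_eq_sum_range, Finset.sum_mul]
  refine Finset.sum_le_sum fun i hi => ?_
  rw [one_pow, mul_one]
  refine Nat.mul_le_mul_left _ ?_
  have hi' : i ≤ p.natDegree := by
    have := Finset.mem_range.1 hi
    omega
  exact (Nat.pow_le_pow_left hxy i).trans (Nat.pow_le_pow_right hy hi')

lemma reverse_dir (F : GraphClass) (hF : Hereditary F)
    (hp : ∃ p : Polynomial ℕ, ∀ (V : Type) [Fintype V] (G : SimpleGraph V),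
        F V G → minDeg G ≤ p.eval (indBicliqueNum G)) : HasEH F := by
  obtain ⟨p, hp⟩ := hp
  obtain ⟨c, hc⟩ : ∃ c, c = p.eval 1 := ⟨_, rfl⟩
  obtain ⟨a, ha⟩ : ∃ a, a = p.natDegree := ⟨_, rfl⟩
  obtain ⟨N, hN⟩ : ∃ N, N = a + 1 + c := ⟨_, rfl⟩
  have hN0 : (0 : ℝ) < N := by
    have : 0 < N := by omega
    exact_mod_cast this
  refine ⟨1 / N, by positivity, ?_⟩
  intro V _ _ G hG
  obtain ⟨S, hS, hmax⟩ := Finset.exists_max_image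
    (Finset.univ.filter (fun S : Finset V => HomSet G S)) Finset.card
    ⟨∅, Finset.mem_filter.2 ⟨Finset.mem_univ _, Or.inl (by simp)⟩⟩
  have hSH : HomSet G S := (Finset.mem_filter.1 hS).2
  have hmax' : ∀ T : Finset V, HomSet G T → T.card ≤ S.card := fun T hT =>
    hmax T (Finset.mem_filter.2 ⟨Finset.mem_univ _, hT⟩)
  refine ⟨S, ?_, hSH⟩
  obtain ⟨h, hh⟩ : ∃ h, h = S.card := ⟨_, rfl⟩
  rw [← hh] at hmax' ⊢
  obtain ⟨v⟩ := ‹Nonempty V›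
  have h1 : 1 ≤ h := by
    simpa using hmax' {v} (Or.inl (by simp))
  -- key polynomial bound
  have hkey : Fintype.card V ≤ h ^ N := by
    rcases Nat.lt_or_ge h 2 with h2 | h2
    · have hh1 : h = 1 := by omega
      rw [hh1, one_pow]
      rw [Fintype.card_le_one_iff]
      intro x y
      by_contra hxy
      have : HomSet G {x, y} := by
        by_cases hadj : G.Adj x y
        · left
          intro a ha b hb hab
          simp only [Finset.coe_insert, Finset.coe_singleton, Set.mem_insert_iff,
            Set.mem_singleton_iff] at ha hb
          rcases ha with rfl | rfl <;> rcases hb with rfl | rfl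
          · exact absurd rfl hab
          · exact hadj
          · exact hadj.symm
          · exact absurd rfl hab
        · right
          intro a ha b hb hab
          simp only [Finset.coe_insert, Finset.coe_singleton, Set.mem_insert_iff,
            Set.mem_singleton_iff] at ha hb
          rcases ha with rfl | rfl <;> rcases hb with rfl | rfl
          · exact absurd rfl hab
          · exact hadj
          · exact fun h => hadj h.symm
          · exact absurd rfl hab
      have := hmax' _ this
      rw [Finset.card_pair hxy] at this
      omega
    · have hdeg : ∀ W : Finset V, W.Nonempty → ∃ w ∈ W, (nb G W w).card ≤ c * h ^ a := by
        intro W hW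
        obtain ⟨w, hw, hle⟩ := exists_nb_le_minDeg G W hW inferInstance
        refine ⟨w, hw, hle.trans ((hp _ _ (F_induce hF hG W hW _)).trans ?_)⟩
        rw [hc, ha]
        refine poly_bound p _ h ?_ h1
        obtain ⟨T, hTc, hT⟩ := exists_hom_indBicliqueNum (G.induce (W : Set V))
        rw [← hTc, ← Finset.card_map (Function.Embedding.subtype _)]
        refine hmax' _ ?_
        rcases hT with hT | hT
        · left
          intro a ha b hb hab
          obtain ⟨x, hx, rfl⟩ := Finset.mem_map.1 ha
          obtain ⟨y, hy, rfl⟩ := Finset.mem_map.1 hb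
          exact hT hx hy (fun h => hab (by rw [h]))
        · right
          intro a ha b hb hab
          obtain ⟨x, hx, rfl⟩ := Finset.mem_map.1 ha
          obtain ⟨y, hy, rfl⟩ := Finset.mem_map.1 hb
          exact hT hx hy (fun h => hab (by rw [h]))
      obtain ⟨I, -, hInd, hIc⟩ := greedy_indep G (c * h ^ a) _ hdeg Finset.univ le_rfl
      have hIh : I.card ≤ h := hmax' I (Or.inr fun a ha b hb _ => hInd a ha b hb)
      rw [Finset.card_univ] at hIc
      have hha : 1 ≤ h ^ a := Nat.one_le_pow _ _ h1
      have hcpow : c + 1 ≤ h ^ c := by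
        have : c + 1 ≤ 2 ^ c := Nat.lt_two_pow_self
        exact this.trans (Nat.pow_le_pow_left h2 c)
      calc Fintype.card V ≤ (c * h ^ a + 1) * I.card := hIc
        _ ≤ (c * h ^ a + h ^ a) * h := by gcongr
        _ = (c + 1) * (h ^ a * h) := by ring
        _ ≤ h ^ c * (h ^ a * h) := by gcongr
        _ = h ^ N := by rw [hN, ← pow_succ, ← pow_add]; congr 1; ring
  have hkey' : (Fintype.card V : ℝ) ≤ (h : ℝ) ^ (N : ℝ) := by
    rw [Real.rpow_natCast]; exact_mod_cast hkey
  calc (Fintype.card V : ℝ) ^ (1 / (N : ℝ)) ≤ ((h : ℝ) ^ (N : ℝ)) ^ (1 / (N : ℝ)) :=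
        Real.rpow_le_rpow (by positivity) hkey' (by positivity)
    _ = h := by
        rw [← Real.rpow_mul (by positivity), mul_one_div_cancel hN0.ne', Real.rpow_one]

/-- A hereditary degree-bounded class has the Erdős–Hajnal property iff its minimum degree is
polynomially bounded in the induced biclique number. -/
theorem eh_iff_poly_induced_biclique (F : GraphClass) (hF : Hereditary F)
    (hDB : ∃ f : ℕ → ℕ, ∀ (V : Type) [Fintype V] (G : SimpleGraph V),
        F V G → minDeg G ≤ f (bicliqueNum G)) :
    HasEH F ↔
      ∃ p : Polynomial ℕ, ∀ (V : Type) [Fintype V] (G : SimpleGraph V),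
        F V G → minDeg G ≤ p.eval (indBicliqueNum G) := by
  exact ⟨forward_dir F hF hDB, reverse_dir F hF⟩
end
end

section
/- A finite simple graph G is degree-perfect if and only if G has no induced subgraph isomorphic to a cycle C_ℓ for any length ℓ ≥ 3 with ℓ ≠ 4; that is, every induced cycle of G has length exactly 4. -/
open SimpleGraph
open scoped Classical

noncomputable section

/-- The cycle on `ℓ` vertices (for `ℓ ≥ 3`). -/
def cycleG (ℓ : ℕ) : SimpleGraph (Fin ℓ) := SimpleGraph.fromRel fun i j => (j : ℕ) = ((i : ℕ) + 1) % ℓ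

/-- `G` is degree-perfect: every nonempty induced subgraph `H` satisfies `δ(H) ≤ τ(H)`. -/
def DegreePerfect {V : Type} [Fintype V] (G : SimpleGraph V) : Prop :=
  ∀ s : Set V, s.Nonempty → minDeg (G.induce s) ≤ bicliqueNum (G.induce s)

/-- No induced cycle of length `≥ 3` other than four. -/
def Good {V : Type} (G : SimpleGraph V) : Prop :=
  ∀ ℓ : ℕ, 3 ≤ ℓ → ℓ ≠ 4 → IsEmpty (cycleG ℓ ↪g G)

lemma cycleG_adj (ℓ : ℕ) (hl : 3 ≤ ℓ) (i j : Fin ℓ) :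
    (cycleG ℓ).Adj i j ↔ ((j : ℕ) = i + 1 ∨ (i : ℕ) = j + 1 ∨
      ((i : ℕ) = 0 ∧ (j : ℕ) + 1 = ℓ) ∨ ((j : ℕ) = 0 ∧ (i : ℕ) + 1 = ℓ)) := by
  have hi := i.2
  have hj := j.2
  have key : ∀ a : ℕ, a < ℓ → (a + 1) % ℓ = if a + 1 = ℓ then 0 else a + 1 := by
    intro a ha
    split_ifs with h
    · rw [h, Nat.mod_self]
    · exact Nat.mod_eq_of_lt (by omega)
  unfold cycleG
  rw [SimpleGraph.fromRel_adj, key _ hi, key _ hj, Ne, Fin.ext_iff]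
  split_ifs <;> omega

lemma Good.tri {V : Type} {G : SimpleGraph V} (hG : Good G) {a b c : V}
    (h1 : G.Adj a b) (h2 : G.Adj b c) (h3 : G.Adj a c) : False := by
  refine (hG 3 le_rfl (by norm_num)).false ?_
  have h1' := h1.symm
  have h2' := h2.symm
  have h3' := h3.symm
  have n1 := h1.ne
  have n2 := h2.ne
  have n3 := h3.ne
  refine ⟨⟨![a, b, c], ?_⟩, ?_⟩
  · intro i j
    fin_cases i <;> fin_cases j <;> simp_all [eq_comm]
  · intro i j
    rw [cycleG_adj 3 le_rfl]
    change G.Adj (![a, b, c] i) (![a, b, c] j) ↔ _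
    fin_cases i <;> fin_cases j <;> simp_all

/-- The hole lemma. -/
lemma Good.hole {V : Type} {G : SimpleGraph V} (hG : Good G) {c p₁ p₂ : V}
    (h1 : G.Adj c p₁) (h2 : G.Adj c p₂) (hne : p₁ ≠ p₂) (W : Set V)
    (hW : ∀ w ∈ W, w ≠ c ∧ ¬ G.Adj c w) {w₀ w₁ : V} (q : G.Walk w₀ w₁)
    (hq : ∀ x ∈ q.support, x ∈ W) (ha : G.Adj p₁ w₀) (hb : G.Adj w₁ p₂) :
    ∃ w ∈ W, G.Adj p₁ w ∧ G.Adj w p₂ := by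
  have hex : ∃ n, ∃ f : ℕ → V, f 0 = p₁ ∧ f n = p₂ ∧ (∀ i, 0 < i → i < n → f i ∈ W) ∧
      ∀ i < n, G.Adj (f i) (f (i + 1)) := by
    refine ⟨q.length + 2, fun i => if i = 0 then p₁ else if i ≤ q.length + 1 then
      q.getVert (i - 1) else p₂, by simp, by simp, ?_, ?_⟩
    · intro i hi hi'
      have : i ≠ 0 := by omega
      have h' : i ≤ q.length + 1 := by omega
      simp only [this, h', if_true, if_false]
      exact hq _ (q.getVert_mem_support _)
    · intro i hi
      rcases Nat.eq_zero_or_pos i with rfl | hi0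
      · simpa using ha
      · have e1 : i ≠ 0 := by omega
        have e2 : i ≤ q.length + 1 := by omega
        by_cases e3 : i + 1 ≤ q.length + 1
        · have := q.adj_getVert_succ (i := i - 1) (by omega)
          rw [show i - 1 + 1 = i by omega] at this
          simpa [e1, e2, e3, show i ≤ q.length by omega] using this
        · have e4 : i - 1 = q.length := by omega
          have e5 : ¬ (i ≤ q.length) := by omega
          simp [e1, e2, e4, e5]
          exact hb
  classical
  obtain ⟨f, f0, fn, fW, fA⟩ := Nat.find_spec hex
  have hmin := fun m (hm : m < Nat.find hex) => Nat.find_min hex hm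
  generalize Nat.find hex = n at *
  have hn1 : ¬ G.Adj p₁ p₂ := fun h => hG.tri h1 h h2
  have hn : 2 ≤ n := by
    by_contra hlt
    have : n = 0 ∨ n = 1 := by omega
    rcases this with rfl | rfl
    · exact hne (f0.symm.trans fn)
    · have := fA 0 (by omega)
      rw [f0, fn] at this
      exact hn1 this
  have chord : ∀ i j, i + 2 ≤ j → j ≤ n → ¬ G.Adj (f i) (f j) := by
    intro i j hij hj hadj
    refine hmin (n - (j - i - 1)) (by omega)
      ⟨fun k => if k ≤ i then f k else f (k + (j - i - 1)), by simp [f0], ?_, ?_, ?_⟩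
    · have e : ¬ (n - (j - i - 1) ≤ i) := by omega
      simp only [e, if_false]
      rw [← fn]; congr 1; omega
    · intro k hk hk'
      by_cases e : k ≤ i
      · simp only [e, if_true]
        exact fW _ hk (by omega)
      · simp only [e, if_false]
        exact fW _ (by omega) (by omega)
    · intro k hk
      by_cases e : k + 1 ≤ i
      · have e' : k ≤ i := by omega
        simp only [e, e', if_true]
        exact fA _ (by omega)
      · by_cases e' : k ≤ i
        · have e3 : k = i := by omega
          subst e3
          simp only [e, le_refl, if_true, if_false]
          rw [show k + 1 + (j - k - 1) = j by omega]
          exact hadj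
        · simp only [e, e', if_false]
          rw [show k + 1 + (j - i - 1) = k + (j - i - 1) + 1 by omega]
          exact fA _ (by omega)
  have inj : ∀ i j, i < j → j ≤ n → f i ≠ f j := by
    intro i j hij hj he
    rcases Nat.lt_or_eq_of_le hj with hlt | rfl
    · have := fA j hlt
      rw [← he] at this
      exact chord i (j + 1) (by omega) (by omega) this
    · rcases Nat.eq_zero_or_pos i with rfl | hi
      · exact hne (by rw [← f0, ← fn, he])
      · have := fW i hi hij
        rw [he, fn] at this
        exact (hW _ this).2 h2
  by_cases hn2 : n = 2
  · subst hn2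
    refine ⟨f 1, fW 1 (by omega) (by omega), ?_, ?_⟩
    · have := fA 0 (by omega)
      rwa [f0] at this
    · have := fA 1 (by omega)
      rwa [fn] at this
  exfalso
  have cne : ∀ i ≤ n, f i ≠ c := by
    intro i hi he
    rcases Nat.eq_zero_or_pos i with rfl | hi0
    · rw [f0] at he; exact h1.ne he.symm
    · rcases Nat.lt_or_eq_of_le hi with hlt | rfl
      · exact (hW _ (fW i hi0 hlt)).1 he
      · rw [fn] at he; exact h2.ne he.symm
  have cadj : ∀ i ≤ n, (G.Adj c (f i) ↔ i = 0 ∨ i = n) := by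
    intro i hi
    constructor
    · intro h
      by_contra hc
      exact (hW _ (fW i (by omega) (by omega))).2 h
    · rintro (rfl | rfl)
      · rwa [f0]
      · rwa [fn]
  have fadj : ∀ i j, i ≤ n → j ≤ n → (G.Adj (f i) (f j) ↔ j = i + 1 ∨ i = j + 1) := by
    intro i j hi hj
    constructor
    · intro h
      by_contra hc
      rcases lt_trichotomy i j with h' | h' | h'
      · exact chord i j (by omega) hj h
      · subst h'; exact G.loopless.irrefl _ h
      · exact chord j i (by omega) hi h.symm
    · rintro (rfl | rfl)
      · exact fA _ (by omega)
      · exact (fA _ (by omega)).symm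
  refine (hG (n + 2) (by omega) (by omega)).false
    ⟨⟨fun i => if (i : ℕ) ≤ n then f i else c, ?_⟩, ?_⟩
  · intro i j hij
    have hi := i.2
    have hj := j.2
    apply Fin.ext
    by_cases ei : (i : ℕ) ≤ n <;> by_cases ej : (j : ℕ) ≤ n <;>
      simp only [ei, ej, if_true, if_false] at hij
    · rcases lt_trichotomy (i : ℕ) j with h' | h' | h'
      · exact absurd hij (inj _ _ h' ej)
      · exact h'
      · exact absurd hij.symm (inj _ _ h' ei)
    · exact absurd hij (cne _ ei)
    · exact absurd hij.symm (cne _ ej)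
    · omega
  · intro i j
    have hi := i.2
    have hj := j.2
    rw [cycleG_adj _ (by omega)]
    change G.Adj (if (i : ℕ) ≤ n then f i else c) (if (j : ℕ) ≤ n then f j else c) ↔ _
    by_cases ei : (i : ℕ) ≤ n <;> by_cases ej : (j : ℕ) ≤ n <;>
      simp only [ei, ej, if_true, if_false]
    · rw [fadj _ _ ei ej]; omega
    · rw [G.adj_comm, cadj _ ei]; omega
    · rw [cadj _ ej]; omega
    · simp only [SimpleGraph.irrefl, false_iff]; omega

/-- Existence of a nest point. -/
lemma Good.nest {V : Type} [Fintype V] {G : SimpleGraph V} (hG : Good G) (Y : Finset V)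
    (hY : ∀ a ∈ Y, ∀ b ∈ Y, ¬ G.Adj a b) : ∀ n : ℕ, ∀ X : Finset V, X.card = n →
    (∀ a ∈ X, ∀ b ∈ X, ¬ G.Adj a b) → (∀ a ∈ X, a ∉ Y) →
    ∀ E ∈ Y, (∃ x ∈ X, ¬ G.Adj E x) → ∃ p ∈ X, ¬ G.Adj E p ∧
      ∀ F ∈ Y, ∀ F' ∈ Y, G.Adj F p → G.Adj F' p →
        (∀ x ∈ X, G.Adj F x → G.Adj F' x) ∨ (∀ x ∈ X, G.Adj F' x → G.Adj F x) := by
  intro n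
  induction n using Nat.strong_induction_on with
  | _ n ih =>
  intro X hXn hX hXY E₀ hE₀ hE₀n
  -- choose a maximal non-full `E`
  obtain ⟨E, hE, hEmax⟩ := Finset.exists_max_image
    (Y.filter fun E => (∃ x ∈ X, ¬ G.Adj E x) ∧ ∀ x ∈ X, G.Adj E₀ x → G.Adj E x)
    (fun E => (X.filter fun x => G.Adj E x).card)
    ⟨E₀, by simp only [Finset.mem_filter]; exact ⟨hE₀, hE₀n, fun _ _ h => h⟩⟩
  simp only [Finset.mem_filter] at hE hEmax
  obtain ⟨hEY, ⟨k₀, hk₀X, hk₀E⟩, hE₀E⟩ := hE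
  set A : Set V := {a | (a ∈ X ∧ ¬ G.Adj E a) ∨ (a ∈ Y ∧ a ≠ E ∧ ∃ x ∈ X, ¬ G.Adj a x)} with hA
  set W : Set V := {w | ∃ q : G.Walk k₀ w, ∀ x ∈ q.support, x ∈ A} with hWdef
  have hAN : ∀ w ∈ A, w ≠ E ∧ ¬ G.Adj E w := by
    rintro w (⟨h, h'⟩ | ⟨h, h', -⟩)
    · exact ⟨fun e => hXY w h (e ▸ hEY), h'⟩
    · exact ⟨h', hY _ hEY _ h⟩
  have hWA : ∀ w ∈ W, w ∈ A := fun w ⟨q, hq⟩ => hq _ q.end_mem_support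
  have hWstep : ∀ a ∈ W, ∀ b ∈ A, G.Adj a b → b ∈ W := by
    rintro a ⟨q, hq⟩ b hb hab
    refine ⟨q.append (SimpleGraph.Walk.cons hab SimpleGraph.Walk.nil), ?_⟩
    intro x hx
    rw [SimpleGraph.Walk.mem_support_append_iff] at hx
    rcases hx with hx | hx
    · exact hq x hx
    · simp at hx
      rcases hx with rfl | rfl
      · exact hq _ q.end_mem_support
      · exact hb
  have hk₀W : k₀ ∈ W := ⟨SimpleGraph.Walk.nil, by simp [hA, hk₀X, hk₀E]⟩
  have hWconn : ∀ a ∈ W, ∀ b ∈ W, ∃ q : G.Walk a b, ∀ x ∈ q.support, x ∈ W := by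
    rintro a ⟨q, hq⟩ b ⟨r, hr⟩
    have aux : ∀ (c : V) (q : G.Walk k₀ c), (∀ x ∈ q.support, x ∈ A) →
        ∀ x ∈ q.support, x ∈ W := by
      intro c q hq x hx
      exact ⟨q.takeUntil x hx, fun y hy => hq y (q.support_takeUntil_subset_support hx hy)⟩
    refine ⟨q.reverse.append r, fun x hx => ?_⟩
    rw [SimpleGraph.Walk.mem_support_append_iff, SimpleGraph.Walk.support_reverse,
      List.mem_reverse] at hx
    exact hx.elim (aux _ q hq x) (aux _ r hr x)
  have hmeet : ∀ F ∈ W, F ∈ Y → ∃ k ∈ X, ¬ G.Adj E k ∧ G.Adj F k := by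
    rintro F ⟨q, hq⟩ hF
    have hq' : ∀ x ∈ q.reverse.support, x ∈ A := by simpa using hq
    cases hr : q.reverse with
    | nil => exact absurd hF (hXY _ hk₀X)
    | @cons _ v _ h q' =>
      have : v ∈ A := hq' v (by rw [hr]; simp)
      rcases this with ⟨h1, h2⟩ | ⟨h1, -⟩
      · exact ⟨v, h1, h2, h⟩
      · exact absurd h (hY _ hF _ h1)
  have hkW : ∀ p ∈ W, p ∈ X → ∀ F ∈ Y, G.Adj F p → (∃ x ∈ X, ¬ G.Adj F x) → F ∈ W := by
    intro p hp hpX F hF hFp hFn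
    refine hWstep p hp F (Or.inr ⟨hF, ?_, hFn⟩) hFp.symm
    rintro rfl
    exact (hAN p (hWA p hp)).2 hFp
  by_cases hnoF : ∃ F ∈ Y, F ∈ W
  swap
  · push Not at hnoF
    refine ⟨k₀, hk₀X, fun h => hk₀E (hE₀E _ hk₀X h), ?_⟩
    intro F hF F' hF' hFk hF'k
    left
    intro x hx _
    by_contra hc
    exact hnoF F' hF' (hkW k₀ hk₀W hk₀X F' hF' hF'k ⟨x, hx, hc⟩)
  obtain ⟨S, hS, hSmax⟩ := Finset.exists_max_image (Y.filter fun F => F ∈ W)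
    (fun F => (X.filter fun x => G.Adj E x ∧ G.Adj F x).card)
    (by obtain ⟨F, h, h'⟩ := hnoF; exact ⟨F, by simp [h, h']⟩)
  simp only [Finset.mem_filter] at hS hSmax
  obtain ⟨hSY, hSW⟩ := hS
  have hdom : ∀ F ∈ Y, F ∈ W → ∀ x ∈ X, G.Adj E x → G.Adj F x → G.Adj S x := by
    intro F₂ hF₂Y hF₂W p₂ hp₂X hEp₂ hF₂p₂
    by_contra hSp₂
    obtain ⟨F, hF, hFmax⟩ := Finset.exists_max_image (Y.filter fun F => F ∈ W ∧ G.Adj F p₂)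
      (fun F => (X.filter fun x => G.Adj E x ∧ G.Adj S x ∧ G.Adj F x).card)
      ⟨F₂, by simp [hF₂Y, hF₂W, hF₂p₂]⟩
    simp only [Finset.mem_filter] at hF hFmax
    obtain ⟨hFY, hFW, hFp₂⟩ := hF
    by_cases hsub : ∀ x ∈ X, G.Adj E x → G.Adj S x → G.Adj F x
    · refine absurd (hSmax F ⟨hFY, hFW⟩) (not_le.mpr (Finset.card_lt_card ?_))
      rw [Finset.ssubset_iff_of_subset]
      · exact ⟨p₂, by simp [hp₂X, hEp₂, hFp₂], by simp [hSp₂]⟩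
      · intro x hx
        simp only [Finset.mem_filter] at hx ⊢
        exact ⟨hx.1, hx.2.1, hsub x hx.1 hx.2.1 hx.2.2⟩
    · push Not at hsub
      obtain ⟨p₁, hp₁X, hEp₁, hSp₁, hFp₁⟩ := hsub
      have hne : p₁ ≠ p₂ := by rintro rfl; exact hSp₂ hSp₁
      obtain ⟨q, hq⟩ := hWconn S hSW F hFW
      obtain ⟨w, hwW, hp₁w, hwp₂⟩ := hG.hole hEp₁ hEp₂ hne W
        (fun w hw => hAN w (hWA w hw)) q hq hSp₁.symm hFp₂
      have hwY : w ∈ Y := by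
        rcases hWA w hwW with ⟨h, -⟩ | ⟨h, -⟩
        · exact absurd hp₁w (hX _ hp₁X _ h)
        · exact h
      have h3 : ∃ p₃ ∈ X, G.Adj E p₃ ∧ G.Adj S p₃ ∧ G.Adj F p₃ ∧ ¬ G.Adj w p₃ := by
        by_contra hc
        push Not at hc
        refine absurd (hFmax w ⟨hwY, hwW, hwp₂⟩) (not_le.mpr (Finset.card_lt_card ?_))
        rw [Finset.ssubset_iff_of_subset]
        · exact ⟨p₁, by simp [hp₁X, hEp₁, hSp₁, hp₁w.symm], by simp [hFp₁]⟩
        · intro x hx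
          simp only [Finset.mem_filter] at hx ⊢
          exact ⟨hx.1, hx.2.1, hx.2.2.1, hc x hx.1 hx.2.1 hx.2.2.1 hx.2.2.2⟩
      obtain ⟨p₃, hp₃X, hEp₃, hSp₃, hFp₃, hwp₃⟩ := h3
      have hne' : p₁ ≠ p₃ := by rintro rfl; exact hFp₁ hFp₃
      obtain ⟨w', hw', h1, h2⟩ := hG.hole hSp₁ hSp₃ hne' {w, p₂, F}
        (by
          rintro x (rfl | rfl | rfl)
          · exact ⟨by rintro rfl; exact hSp₂ hwp₂, hY _ hSY _ hwY⟩
          · exact ⟨by rintro rfl; exact hXY _ hp₂X hSY, hSp₂⟩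
          · exact ⟨by rintro rfl; exact hSp₂ hFp₂, hY _ hSY _ hFY⟩)
        (SimpleGraph.Walk.cons hwp₂ (SimpleGraph.Walk.cons hFp₂.symm SimpleGraph.Walk.nil))
        (by simp) hp₁w hFp₃
      rcases hw' with rfl | rfl | rfl
      · exact hwp₃ h2
      · exact hX _ hp₁X _ hp₂X h1
      · exact hFp₁ h1.symm
  have hSn : ∃ x ∈ X, ¬ G.Adj S x := by
    rcases hWA S hSW with ⟨h, -⟩ | ⟨-, -, h⟩
    · exact absurd hSY (hXY _ h)
    · exact h
  have hq : ∃ q ∈ X, G.Adj E q ∧ ¬ G.Adj S q := by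
    by_contra hc
    push Not at hc
    obtain ⟨k, hkX, hEk, hSk⟩ := hmeet S hSW hSY
    refine absurd (hEmax S ⟨hSY, hSn, fun x hx h => hc x hx (hE₀E x hx h)⟩)
      (not_le.mpr (Finset.card_lt_card ?_))
    rw [Finset.ssubset_iff_of_subset]
    · exact ⟨k, by simp [hkX, hSk], by simp [hEk]⟩
    · intro x hx
      simp only [Finset.mem_filter] at hx ⊢
      exact ⟨hx.1, hc x hx.1 hx.2⟩
  obtain ⟨q, hqX, hEq, hSq⟩ := hq
  set X' := X.filter (fun x => x ∈ W ∨ (G.Adj E x ∧ G.Adj S x)) with hX'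
  have hX'X : ∀ x ∈ X', x ∈ X := fun x hx => (Finset.mem_filter.mp hx).1
  have hlt : X'.card < n := by
    rw [← hXn]
    apply Finset.card_lt_card
    rw [Finset.ssubset_iff_of_subset (Finset.filter_subset _ _)]
    refine ⟨q, hqX, ?_⟩
    simp only [hX', Finset.mem_filter, not_and, not_or]
    exact fun _ => ⟨fun h => (hAN q (hWA q h)).2 hEq, fun _ => hSq⟩
  obtain ⟨p, hpX', hEp, hp⟩ := ih _ hlt X' rfl
    (fun a ha b hb => hX a (hX'X a ha) b (hX'X b hb)) (fun a ha => hXY a (hX'X a ha)) E hEY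
    ⟨k₀, by simp only [hX', Finset.mem_filter]; exact ⟨hk₀X, Or.inl hk₀W⟩, hk₀E⟩
  have hpX := hX'X p hpX'
  have hpW : p ∈ W := by
    rcases (Finset.mem_filter.mp hpX').2 with h | h
    · exact h
    · exact absurd h.1 hEp
  have hin : ∀ F ∈ Y, G.Adj F p → (∃ x ∈ X, ¬ G.Adj F x) → ∀ x ∈ X, G.Adj F x → x ∈ X' := by
    intro F hF hFp hFn x hx hFx
    have hFW := hkW p hpW hpX F hF hFp hFn
    simp only [hX', Finset.mem_filter]
    refine ⟨hx, ?_⟩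
    by_cases hEx : G.Adj E x
    · exact Or.inr ⟨hEx, hdom F hF hFW x hx hEx hFx⟩
    · exact Or.inl (hWstep F hFW x (Or.inl ⟨hx, hEx⟩) hFx)
  refine ⟨p, hpX, fun h => hEp (hE₀E p hpX h), ?_⟩
  intro F hF F' hF' hFp hF'p
  by_cases h1 : ∃ x ∈ X, ¬ G.Adj F x
  swap
  · push Not at h1
    exact Or.inr fun x hx _ => h1 x hx
  by_cases h2 : ∃ x ∈ X, ¬ G.Adj F' x
  swap
  · push Not at h2
    exact Or.inl fun x hx _ => h2 x hx
  rcases hp F hF F' hF' hFp hF'p with h | h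
  · exact Or.inl fun x hx hFx => h x (hin F hF hFp h1 x hx hFx) hFx
  · exact Or.inr fun x hx hFx => h x (hin F' hF' hF'p h2 x hx hFx) hFx

lemma exists_parent {V : Type} {G : SimpleGraph V} {r u : V} {k : ℕ} (hr : G.Reachable r u)
    (hd : G.dist r u = k + 1) : ∃ v, G.Adj v u ∧ G.Reachable r v ∧ G.dist r v = k := by
  obtain ⟨p, hp⟩ := hr.symm.exists_walk_length_eq_dist
  rw [SimpleGraph.dist_comm, hd] at hp
  cases p with
  | nil => simp at hp
  | @cons _ v _ h q =>
    have hv : G.Reachable r v := q.reachable.symm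
    refine ⟨v, h.symm, hv, ?_⟩
    have h1 := SimpleGraph.dist_le q.reverse
    have h2 : G.dist r u ≤ G.dist r v + 1 := by
      obtain ⟨s, hs⟩ := hv.exists_walk_length_eq_dist
      have := SimpleGraph.dist_le (s.concat h.symm)
      rw [SimpleGraph.Walk.length_concat] at this
      omega
    simp at hp h1
    omega

lemma dist_adj_le {V : Type} {G : SimpleGraph V} {r u v : V} (hr : G.Reachable r u)
    (h : G.Adj u v) : G.dist r v ≤ G.dist r u + 1 := by
  obtain ⟨s, hs⟩ := hr.exists_walk_length_eq_dist
  have := SimpleGraph.dist_le (s.concat h)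
  rw [SimpleGraph.Walk.length_concat] at this
  omega

/-- a shortest-type walk from the root, with controlled support -/
lemma exists_level_walk {V : Type} {G : SimpleGraph V} {r : V} : ∀ (k : ℕ) (u : V),
    G.Reachable r u → G.dist r u = k →
    ∃ q : G.Walk r u, ∀ x ∈ q.support, G.Reachable r x ∧ (x = u ∨ G.dist r x < k) := by
  intro k
  induction k with
  | zero =>
    intro u hr hd
    have : r = u := hr.dist_eq_zero_iff.mp hd
    subst this
    exact ⟨SimpleGraph.Walk.nil, by simp⟩
  | succ k ih =>
    intro u hr hd
    obtain ⟨v, hvu, hrv, hdv⟩ := exists_parent hr hd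
    obtain ⟨q, hq⟩ := ih v hrv hdv
    refine ⟨q.concat hvu, ?_⟩
    intro x hx
    rw [SimpleGraph.Walk.support_concat] at hx
    simp at hx
    rcases hx with hx | rfl
    · obtain ⟨h1, h2⟩ := hq x hx
      refine ⟨h1, Or.inr ?_⟩
      rcases h2 with rfl | h2 <;> omega
    · exact ⟨hr, Or.inl rfl⟩

lemma Good.level {V : Type} {G : SimpleGraph V} (hG : Good G) (r : V) : ∀ (d : ℕ) (u v : V),
    G.Reachable r u → G.dist r u = d → G.dist r v = d → ¬ G.Adj u v := by
  intro d
  induction d with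
  | zero =>
    intro u v hu hdu hdv h
    have e1 : r = u := hu.dist_eq_zero_iff.mp hdu
    have e2 : r = v := (hu.trans h.reachable).dist_eq_zero_iff.mp hdv
    exact h.ne (e1.symm.trans e2)
  | succ k ih =>
    intro u v hu hdu hdv h
    have hv := hu.trans h.reachable
    obtain ⟨p₂, hp₂u, hrp₂, hdp₂⟩ := exists_parent hu hdu
    obtain ⟨v', hv'v, hrv', hdv'⟩ := exists_parent hv hdv
    have hv'u : ¬ G.Adj u v' := fun h' => hG.tri h'.symm h hv'v
    cases k with
    | zero =>
      have e1 : r = p₂ := hrp₂.dist_eq_zero_iff.mp hdp₂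
      have e2 : r = v' := hrv'.dist_eq_zero_iff.mp hdv'
      exact hv'u (by rw [← e2, e1]; exact hp₂u.symm)
    | succ k =>
      obtain ⟨w₁, hw₁, hrw₁, hdw₁⟩ := exists_parent hrp₂ hdp₂
      obtain ⟨q₁, hq₁⟩ := exists_level_walk _ _ hrv' hdv'
      obtain ⟨q₂, hq₂⟩ := exists_level_walk _ _ hrw₁ hdw₁
      have far : ∀ x, G.Reachable r x → G.dist r x < k + 1 → ¬ G.Adj u x := by
        intro x hx hdx hux
        have := dist_adj_le hx hux.symm
        omega
      obtain ⟨w, ⟨hw1, hw2, hw3⟩, hvw, hwp⟩ := hG.hole h hp₂u.symm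
        (by rintro rfl; omega) {x | G.Reachable r x ∧ G.dist r x ≤ k + 1 ∧ ¬ G.Adj u x}
        (by
          rintro w ⟨h1, h2, h3⟩
          exact ⟨by rintro rfl; omega, h3⟩)
        (q₁.reverse.append q₂)
        (by
          intro x hx
          rw [SimpleGraph.Walk.mem_support_append_iff, SimpleGraph.Walk.support_reverse,
            List.mem_reverse] at hx
          rcases hx with hx | hx
          · obtain ⟨h1, h2⟩ := hq₁ x hx
            rcases h2 with rfl | h2
            · exact ⟨h1, by omega, hv'u⟩
            · exact ⟨h1, by omega, far x h1 h2⟩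
          · obtain ⟨h1, h2⟩ := hq₂ x hx
            have : G.dist r x < k + 1 := by rcases h2 with rfl | h2 <;> omega
            exact ⟨h1, by omega, far x h1 this⟩)
        hv'v.symm hw₁
      have := dist_adj_le hw1 hvw.symm
      exact ih w p₂ hw1 (by omega) hdp₂ hwp

lemma Good.biclique {V : Type} [Fintype V] [Nonempty V] {G : SimpleGraph V} (hG : Good G) :
    HasBicliqueSub G (G.minDegree) := by
  by_cases h0 : G.minDegree = 0
  · rw [h0]
    exact ⟨∅, ∅, by simp⟩
  obtain ⟨r⟩ := ‹Nonempty V›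
  have hdeg : ∀ v, ∃ w, G.Adj v w := by
    intro v
    have := G.minDegree_le_degree v
    have h1 : 0 < G.degree v := by omega
    rw [SimpleGraph.degree_pos_iff_exists_adj] at h1
    exact h1
  set X : Finset V := Finset.univ.filter fun v => G.Reachable r v ∧ G.dist r v % 2 = 0 with hX
  set Y : Finset V := Finset.univ.filter fun v => G.Reachable r v ∧ G.dist r v % 2 = 1 with hY
  have step : ∀ u v, G.Reachable r u → G.Adj u v → G.Reachable r v ∧
      G.dist r u % 2 ≠ G.dist r v % 2 := by
    intro u v hu h
    have hv := hu.trans h.reachable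
    refine ⟨hv, ?_⟩
    have h1 := dist_adj_le hu h
    have h2 := dist_adj_le hv h.symm
    have h3 : G.dist r v ≠ G.dist r u := fun e => hG.level r _ u v hu rfl e h
    omega
  have hXI : ∀ a ∈ X, ∀ b ∈ X, ¬ G.Adj a b := by
    intro a ha b hb h
    simp only [hX, Finset.mem_filter] at ha hb
    have := (step a b ha.2.1 h).2
    omega
  have hYI : ∀ a ∈ Y, ∀ b ∈ Y, ¬ G.Adj a b := by
    intro a ha b hb h
    simp only [hY, Finset.mem_filter] at ha hb
    have := (step a b ha.2.1 h).2
    omega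
  have hXY : ∀ a ∈ X, a ∉ Y := by
    intro a ha hb
    simp only [hX, hY, Finset.mem_filter] at ha hb
    omega
  have hXN : ∀ a ∈ X, ∀ b, G.Adj a b → b ∈ Y := by
    intro a ha b h
    simp only [hX, hY, Finset.mem_filter, Finset.mem_univ, true_and] at ha ⊢
    have := step a b ha.1 h
    exact ⟨this.1, by omega⟩
  have hYN : ∀ a ∈ Y, ∀ b, G.Adj a b → b ∈ X := by
    intro a ha b h
    simp only [hX, hY, Finset.mem_filter, Finset.mem_univ, true_and] at ha ⊢
    have := step a b ha.1 h
    exact ⟨this.1, by omega⟩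
  have hrX : r ∈ X := by simp [hX]
  have hnest : ∃ p ∈ X, ∀ F ∈ Y, ∀ F' ∈ Y, G.Adj F p → G.Adj F' p →
        (∀ x ∈ X, G.Adj F x → G.Adj F' x) ∨ (∀ x ∈ X, G.Adj F' x → G.Adj F x) := by
    by_cases hc : ∃ E ∈ Y, ∃ x ∈ X, ¬ G.Adj E x
    · obtain ⟨E, hE, hx⟩ := hc
      obtain ⟨p, h1, -, h2⟩ := hG.nest Y hYI _ X rfl hXI hXY E hE hx
      exact ⟨p, h1, h2⟩
    · push Not at hc
      exact ⟨r, hrX, fun F hF F' hF' _ _ => Or.inl fun x hx _ => hc F' hF' x hx⟩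
  obtain ⟨p, hpX, hp⟩ := hnest
  obtain ⟨F, hF, hFmin⟩ := Finset.exists_min_image (G.neighborFinset p)
    (fun F => (G.neighborFinset F).card)
    (by obtain ⟨w, hw⟩ := hdeg p; exact ⟨w, by simpa using hw⟩)
  rw [SimpleGraph.mem_neighborFinset] at hF
  have hFY := hXN p hpX F hF
  have hall : ∀ a ∈ G.neighborFinset p, ∀ b ∈ G.neighborFinset F, G.Adj a b := by
    intro a ha b hb
    have hmin := hFmin a ha
    rw [SimpleGraph.mem_neighborFinset] at ha hb
    have haY := hXN p hpX a ha
    rcases hp F hFY a haY hF.symm ha.symm with h | h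
    · exact h b (hYN F hFY b hb) hb
    · have hsub : G.neighborFinset a ⊆ G.neighborFinset F := by
        intro x hx
        rw [SimpleGraph.mem_neighborFinset] at hx ⊢
        exact h x (hYN a haY x hx) hx
      have := Finset.eq_of_subset_of_card_le hsub hmin
      rw [← SimpleGraph.mem_neighborFinset, this, SimpleGraph.mem_neighborFinset]
      exact hb
  obtain ⟨A, hA, hAc⟩ := Finset.exists_subset_card_eq (G.minDegree_le_degree p)
  obtain ⟨B, hB, hBc⟩ := Finset.exists_subset_card_eq (G.minDegree_le_degree F)
  refine ⟨A, B, ?_, hAc, hBc, fun a ha b hb => hall a (hA ha) b (hB hb)⟩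
  rw [Finset.disjoint_left]
  intro a ha hb
  exact G.loopless.irrefl _ (hall a (hA ha) a (hB hb))

lemma bddAbove_biclique {V : Type} [Fintype V] (G : SimpleGraph V) :
    BddAbove {t | HasBicliqueSub G t} := by
  refine ⟨Fintype.card V, ?_⟩
  rintro t ⟨A, B, -, hA, -⟩
  rw [← hA]
  exact Finset.card_le_univ A

/-- Characterization of degree-perfect graphs: every induced cycle has length four. -/
theorem degreePerfect_iff (V : Type) [Fintype V] [Nonempty V] (G : SimpleGraph V) :
    DegreePerfect G ↔
      ∀ ℓ : ℕ, 3 ≤ ℓ → ℓ ≠ 4 →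
        ¬ ∃ s : Set V, Nonempty (G.induce s ≃g cycleG ℓ) := by
  constructor
  · rintro hD ℓ hl hl4 ⟨s, ⟨e⟩⟩
    have hne : s.Nonempty := ⟨_, (e.symm ⟨0, by omega⟩).2⟩
    have h := hD s hne
    haveI : Nonempty s := hne.to_subtype
    have h2 : 2 ≤ minDeg (G.induce s) := by
      unfold minDeg
      apply SimpleGraph.le_minDegree_of_forall_le_degree
      intro v
      set i := e v with hi
      have hi2 := i.2
      obtain ⟨a, b, hab, ha, hb⟩ : ∃ a b : Fin ℓ, a ≠ b ∧ (cycleG ℓ).Adj i a ∧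
          (cycleG ℓ).Adj i b := by
        simp only [cycleG_adj ℓ hl, Ne, Fin.ext_iff]
        by_cases h0 : (i : ℕ) = 0
        · exact ⟨⟨1, by omega⟩, ⟨ℓ - 1, by omega⟩, by simp; omega, by simp; omega, by simp; omega⟩
        · by_cases h1 : (i : ℕ) + 1 = ℓ
          · exact ⟨⟨i - 1, by omega⟩, ⟨0, by omega⟩, by simp; omega, by simp; omega, by simp; omega⟩
          · exact ⟨⟨i - 1, by omega⟩, ⟨i + 1, by omega⟩, by simp <;> omega, by simp <;> omega,
              by simp⟩
      have hsub : ({e.symm a, e.symm b} : Finset s) ⊆ (G.induce s).neighborFinset v := by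
        intro x hx
        rw [SimpleGraph.mem_neighborFinset, ← e.map_adj_iff]
        simp only [Finset.mem_insert, Finset.mem_singleton] at hx
        rcases hx with rfl | rfl
        · rw [e.apply_symm_apply]; exact ha
        · rw [e.apply_symm_apply]; exact hb
      have := Finset.card_le_card hsub
      rw [Finset.card_pair (fun h => hab (e.symm.injective h))] at this
      exact this
    have hmem : HasBicliqueSub (G.induce s) (bicliqueNum (G.induce s)) :=
      Nat.sSup_mem (s := {t | HasBicliqueSub (G.induce s) t}) ⟨0, ∅, ∅, by simp⟩
        (bddAbove_biclique _)
    obtain ⟨A, B, -, hA, hB, hAB⟩ := hmem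
    obtain ⟨a, ha, a', ha', haa⟩ := Finset.one_lt_card.mp (show 1 < A.card by omega)
    obtain ⟨b, hb, b', hb', hbb⟩ := Finset.one_lt_card.mp (show 1 < B.card by omega)
    have k1 := e.map_adj_iff.mpr (hAB a ha b hb)
    have k2 := e.map_adj_iff.mpr (hAB a ha b' hb')
    have k3 := e.map_adj_iff.mpr (hAB a' ha' b hb)
    have k4 := e.map_adj_iff.mpr (hAB a' ha' b' hb')
    have n1 := e.injective.ne haa
    have n2 := e.injective.ne hbb
    generalize e a = x at *
    generalize e a' = x' at *
    generalize e b = y at *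
    generalize e b' = y' at *
    rw [cycleG_adj ℓ hl] at k1 k2 k3 k4
    rw [Ne, Fin.ext_iff] at n1 n2
    have := x.2
    have := x'.2
    have := y.2
    have := y'.2
    clear h h2 hA hB
    omega
  · intro hc s hs
    haveI : Nonempty s := hs.to_subtype
    have hG : Good (G.induce s) := by
      intro ℓ hl hl4
      refine ⟨fun f => hc ℓ hl hl4 ?_⟩
      let g : cycleG ℓ ↪g G := (SimpleGraph.Embedding.induce s).comp f
      refine ⟨Set.range g, ⟨SimpleGraph.Iso.symm ⟨Equiv.ofInjective g g.injective, ?_⟩⟩⟩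
      intro a b
      simp
    exact le_csSup (bddAbove_biclique _) hG.biclique
end
end
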